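/- arXiv:math/0701251 — 3 statements merged into one kernel-verified Lean document; each statement's English description precedes it below -/
import Mathlib

section
/- Let b_n be the coefficient of q^n in ∏_{m=1}^∞ (1 - q^m)(1 - q^{2m}). Then there exists a real constant E > 0 such that ∑_{n=0}^{N} b_n^2 is asymptotically equivalent to E·N as N → ∞, and E = 4·L, where L is the limit as x → ∞ of the finite product over primes p ≤ x given by ∏_{p ≤ x, p ≡ 3,5,7 (mod 8)} (1 + 1/p)^{-1} · ∏_{p ≤ x, p ≡ 1 (mod 8)} (1 + 1/p)(1 - 1/p)^{-2}. -/
open Filter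

/-- The representations of `n` by the form `x ^ 2 + 2 * y ^ 2`. -/
noncomputable def formReps (n : ℤ) : Finset (ℤ × ℤ) :=
  (Finset.Icc (-n) n ×ˢ Finset.Icc (-n) n).filter fun z => z.1 ^ 2 + 2 * z.2 ^ 2 = n

theorem mem_formReps {n : ℤ} {z : ℤ × ℤ} : z ∈ formReps n ↔ z.1 ^ 2 + 2 * z.2 ^ 2 = n := by
  simp only [formReps, Finset.mem_filter, Finset.mem_product, Finset.mem_Icc, and_iff_right_iff_imp]
  intro h
  have h1 : |z.1| ≤ z.1 ^ 2 := by simpa using Int.natAbs_le_self_sq z.1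
  have h2 : |z.2| ≤ z.2 ^ 2 := by simpa using Int.natAbs_le_self_sq z.2
  rw [← abs_le, ← abs_le]
  constructor <;> nlinarith [sq_nonneg z.1, sq_nonneg z.2]

/-- The residue-level quartic character `x + y √-2 ↦ i ^ (x * y)` for `x` odd, `0` for `x` even. -/
def quarticCharMod (x y : ZMod 4) : GaussianInt :=
  if x = 1 ∨ x = 3 then
    if x * y = 0 then 1 else if x * y = 1 then ⟨0, 1⟩ else if x * y = 2 then -1 else ⟨0, -1⟩
  else 0

/-- The quartic character `x + y √-2 ↦ i ^ (x * y)` (for `x` odd) of `ℤ[√-2]`. -/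
def quarticChar (z : ℤ × ℤ) : GaussianInt := quarticCharMod z.1 z.2

/-- Multiplication of `ℤ[√-2]` in coordinates. -/
def formMul (w z : ℤ × ℤ) : ℤ × ℤ := (w.1 * z.1 - 2 * w.2 * z.2, w.1 * z.2 + w.2 * z.1)

set_option maxRecDepth 100000 in
theorem quarticCharMod_mul : ∀ a b x y : ZMod 4,
    quarticCharMod (a * x - 2 * b * y) (a * y + b * x) =
      quarticCharMod a b * quarticCharMod x y := by
  decide

theorem quarticChar_formMul (w z : ℤ × ℤ) :
    quarticChar (formMul w z) = quarticChar w * quarticChar z := by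
  simp only [quarticChar, formMul]
  push_cast
  exact quarticCharMod_mul _ _ _ _

/-- The theta coefficient `∑ ψ(z)` over the `z` of norm `n`. -/
noncomputable def thetaCoeff (n : ℤ) : GaussianInt := ∑ z ∈ formReps n, quarticChar z

/-- Multiplication by `w` of norm `k` identifies the elements of norm `m` with the elements of norm
`k * m` divisible by `w`. -/
theorem sum_filter_dvd_eq_sum_formMul {R : Type*} [AddCommMonoid R] (g : ℤ × ℤ → R) (w : ℤ × ℤ)
    (k m : ℤ) (hk : w.1 ^ 2 + 2 * w.2 ^ 2 = k) (hk0 : k ≠ 0) :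
    ∑ z ∈ (formReps (k * m)).filter
        (fun z => k ∣ w.1 * z.1 + 2 * w.2 * z.2 ∧ k ∣ w.1 * z.2 - w.2 * z.1), g z =
      ∑ z ∈ formReps m, g (formMul w z) := by
  symm
  refine Finset.sum_bij (fun z _ => formMul w z) ?_ ?_ ?_ ?_
  · intro z hz
    rw [mem_formReps] at hz
    simp only [Finset.mem_filter, mem_formReps, formMul]
    refine ⟨?_, ⟨z.1, ?_⟩, ⟨z.2, ?_⟩⟩
    · rw [← hk, ← hz]; ring
    · rw [← hk]; ring
    · rw [← hk]; ring
  · intro z _ z' _ h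
    simp only [formMul, Prod.mk.injEq] at h
    obtain ⟨h1, h2⟩ := h
    have e1 : k * (z.1 - z'.1) = 0 := by rw [← hk]; linear_combination w.1 * h1 + 2 * w.2 * h2
    have e2 : k * (z.2 - z'.2) = 0 := by rw [← hk]; linear_combination w.1 * h2 - w.2 * h1
    have e1' := (mul_eq_zero.mp e1).resolve_left hk0
    have e2' := (mul_eq_zero.mp e2).resolve_left hk0
    exact Prod.ext (by linarith) (by linarith)
  · intro z hz
    simp only [Finset.mem_filter, mem_formReps] at hz
    obtain ⟨h, ⟨s, hs⟩, ⟨t, ht⟩⟩ := hz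
    refine ⟨(s, t), ?_, ?_⟩
    · rw [mem_formReps]
      apply mul_left_cancel₀ (pow_ne_zero 2 hk0)
      have : (k * s) ^ 2 + 2 * (k * t) ^ 2 = k * (k * m) := by
        rw [← hs, ← ht, ← h, ← hk]; ring
      linear_combination this
    · apply Prod.ext
      · apply mul_left_cancel₀ hk0
        simp only [formMul]
        rw [← hk]
        rw [← hk] at hs ht
        linear_combination -w.1 * hs + 2 * w.2 * ht
      · apply mul_left_cancel₀ hk0
        simp only [formMul]
        rw [← hk]
        rw [← hk] at hs ht
        linear_combination -w.1 * ht - w.2 * hs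
  · intro z _
    rfl

theorem sum_filter_dvd (w : ℤ × ℤ) (k m : ℤ) (hk : w.1 ^ 2 + 2 * w.2 ^ 2 = k) (hk0 : k ≠ 0) :
    ∑ z ∈ (formReps (k * m)).filter
        (fun z => k ∣ w.1 * z.1 + 2 * w.2 * z.2 ∧ k ∣ w.1 * z.2 - w.2 * z.1), quarticChar z =
      quarticChar w * thetaCoeff m := by
  rw [sum_filter_dvd_eq_sum_formMul _ w k m hk hk0, thetaCoeff, Finset.mul_sum]
  exact Finset.sum_congr rfl fun z _ => quarticChar_formMul w z

theorem thetaCoeff_one : thetaCoeff 1 = 2 := by decide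

/-- A prime congruent to `1` or `3` modulo `8` is of the form `a ^ 2 + 2 * b ^ 2`. -/
theorem exists_eq_sq_add_two_mul_sq {p : ℕ} (hp : p.Prime) (h8 : p % 8 = 1 ∨ p % 8 = 3) :
    ∃ a b : ℤ, a ^ 2 + 2 * b ^ 2 = p := by
  have := Fact.mk hp
  have h2 : p ≠ 2 := by rintro rfl; omega
  obtain ⟨t, ht⟩ := (ZMod.exists_sq_eq_neg_two_iff h2).mpr h8
  set s := Nat.sqrt p with hs
  have hs1 : s * s < p := by
    refine lt_of_le_of_ne (Nat.sqrt_le p) fun h => ?_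
    exact (Nat.Prime.prime hp).irreducible.not_isSquare ⟨s, h.symm⟩
  have hs2 : p < (s + 1) * (s + 1) := Nat.lt_succ_sqrt p
  obtain ⟨z, hz, z', hz', hne, heq⟩ := Finset.exists_ne_map_eq_of_card_lt_of_maps_to
    (s := Finset.range (s + 1) ×ˢ Finset.range (s + 1)) (t := (Finset.univ : Finset (ZMod p)))
    (f := fun z => (z.1 : ZMod p) - t * z.2) (by simpa [ZMod.card] using hs2)
    (by intro _ _; simp)
  simp only [Finset.mem_product, Finset.mem_range] at hz hz'
  obtain ⟨x, hx⟩ : ∃ x : ℤ, x = z.1 - z'.1 := ⟨_, rfl⟩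
  obtain ⟨y, hy⟩ : ∃ y : ℤ, y = z.2 - z'.2 := ⟨_, rfl⟩
  have hxs : x ^ 2 ≤ s * s := by nlinarith
  have hys : y ^ 2 ≤ s * s := by nlinarith
  have hsp : (s * s : ℤ) < p := by exact_mod_cast hs1
  have hdvd : (p : ℤ) ∣ x ^ 2 + 2 * y ^ 2 := by
    rw [← ZMod.intCast_zmod_eq_zero_iff_dvd]
    have : (x : ZMod p) = t * y := by
      rw [hx, hy]; push_cast; linear_combination heq
    push_cast
    rw [this]
    linear_combination -(y : ZMod p) ^ 2 * ht
  have hpos : 0 < x ^ 2 + 2 * y ^ 2 := by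
    rcases eq_or_ne x 0 with h0 | h0
    · have : y ≠ 0 := by
        intro h; apply hne; apply Prod.ext <;> omega
      positivity
    · positivity
  obtain ⟨k, hk⟩ := hdvd
  have hp0 : (0 : ℤ) < p := by exact_mod_cast hp.pos
  have hk1 : 0 < k := by nlinarith
  have hk3 : k < 3 := by nlinarith
  interval_cases k
  · exact ⟨x, y, by linarith⟩
  · obtain ⟨e, he⟩ : Even x := by
      have : Even (x ^ 2) := ⟨p - y ^ 2, by linarith⟩
      exact (Int.even_pow.mp this).1
    exact ⟨y, e, by subst he; linarith⟩

theorem thetaCoeff_two_mul (m : ℤ) : thetaCoeff (2 * m) = 0 := by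
  refine Finset.sum_eq_zero fun z hz => ?_
  rw [mem_formReps] at hz
  obtain ⟨e, he⟩ : Even z.1 := by
    have : Even (z.1 ^ 2) := ⟨m - z.2 ^ 2, by linarith⟩
    exact (Int.even_pow.mp this).1
  have : ∀ e y : ZMod 4, quarticCharMod (e + e) y = 0 := by decide
  rw [quarticChar, he]
  push_cast
  exact this _ _

theorem cast_zmod_four_odd {n : ℤ} (h : n % 2 = 1) : (n : ZMod 4) = 1 ∨ (n : ZMod 4) = 3 := by
  have h' : n % 4 = 1 ∨ n % 4 = 3 := by omega
  rcases h' with h | h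
  · left
    have : ((n : ℤ) : ZMod 4) = ((1 : ℤ) : ZMod 4) :=
      (ZMod.intCast_eq_intCast_iff _ _ 4).mpr h
    simpa using this
  · right
    have : ((n : ℤ) : ZMod 4) = ((3 : ℤ) : ZMod 4) :=
      (ZMod.intCast_eq_intCast_iff _ _ 4).mpr h
    simpa using this

theorem cast_zmod_four_even {n : ℤ} (h : n % 2 = 0) : (n : ZMod 4) = 0 ∨ (n : ZMod 4) = 2 := by
  have h' : n % 4 = 0 ∨ n % 4 = 2 := by omega
  rcases h' with h | h
  · left
    have : ((n : ℤ) : ZMod 4) = ((0 : ℤ) : ZMod 4) :=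
      (ZMod.intCast_eq_intCast_iff _ _ 4).mpr h
    simpa using this
  · right
    have : ((n : ℤ) : ZMod 4) = ((2 : ℤ) : ZMod 4) :=
      (ZMod.intCast_eq_intCast_iff _ _ 4).mpr h
    simpa using this

theorem quarticChar_intCast {n : ℤ} (h : n % 2 = 1) : quarticChar (n, 0) = 1 := by
  rcases cast_zmod_four_odd h with h | h <;> simp [quarticChar, h] <;> decide

/-- Elements of norm `p * m` divisible by the odd rational integer `p`. -/
theorem sum_filter_prime_dvd {p : ℕ} (hp : p.Prime) (h2 : p ≠ 2) (m : ℤ) :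
    ∑ z ∈ (formReps (p * m)).filter (fun z => (p : ℤ) ∣ z.1 ∧ (p : ℤ) ∣ z.2), quarticChar z =
      if (p : ℤ) ∣ m then thetaCoeff (m / p) else 0 := by
  have hp0 : (p : ℤ) ≠ 0 := by exact_mod_cast hp.ne_zero
  split_ifs with h
  · obtain ⟨m', rfl⟩ := h
    rw [Int.mul_ediv_cancel_left _ hp0]
    have := sum_filter_dvd (p, 0) (p ^ 2) m' (by simp) (pow_ne_zero 2 hp0)
    rw [quarticChar_intCast (by
      have := hp.eq_two_or_odd.resolve_left h2; omega), one_mul] at this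
    rw [← this, pow_two, mul_assoc]
    congr 1
    ext z
    simp only [Finset.mem_filter, mul_zero, zero_mul, add_zero, sub_zero,
      mul_dvd_mul_iff_left hp0]
  · refine Finset.sum_eq_zero fun z hz => absurd ?_ h
    simp only [Finset.mem_filter, mem_formReps] at hz
    obtain ⟨hz, ⟨s, hs⟩, ⟨t, ht⟩⟩ := hz
    refine ⟨s ^ 2 + 2 * t ^ 2, mul_left_cancel₀ hp0 ?_⟩
    rw [← hz, hs, ht]; ring

theorem thetaCoeff_inert_mul {p : ℕ} (hp : p.Prime) (h8 : p % 8 = 5 ∨ p % 8 = 7) (m : ℤ) :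
    thetaCoeff (p * m) = if (p : ℤ) ∣ m then thetaCoeff (m / p) else 0 := by
  have := Fact.mk hp
  have h2 : p ≠ 2 := by rintro rfl; omega
  rw [← sum_filter_prime_dvd hp h2, Finset.filter_true_of_mem, thetaCoeff]
  intro z hz
  rw [mem_formReps] at hz
  have hpp : Prime (p : ℤ) := Nat.prime_iff_prime_int.mp hp
  have hy : (p : ℤ) ∣ z.2 := by
    by_contra hy
    have hy0 : (z.2 : ZMod p) ≠ 0 := by rwa [Ne, ZMod.intCast_zmod_eq_zero_iff_dvd]
    have hsq : IsSquare (-2 : ZMod p) := by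
      refine ⟨z.1 / z.2, ?_⟩
      have := congrArg (Int.cast : ℤ → ZMod p) hz
      push_cast at this
      rw [ZMod.natCast_self, zero_mul] at this
      field_simp
      linear_combination -this
    rw [ZMod.exists_sq_eq_neg_two_iff h2] at hsq
    omega
  refine ⟨?_, hy⟩
  apply hpp.dvd_of_dvd_pow (n := 2)
  have : z.1 ^ 2 = p * m - 2 * z.2 * z.2 := by linarith
  rw [this]
  exact dvd_sub (dvd_mul_right _ _) (Dvd.dvd.mul_left hy _)

theorem thetaCoeff_split_mul {p : ℕ} (hp : p.Prime) (h2 : p ≠ 2) {a b : ℤ}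
    (hab : a ^ 2 + 2 * b ^ 2 = p) (m : ℤ) :
    thetaCoeff (p * m) = (quarticChar (a, b) + quarticChar (a, -b)) * thetaCoeff m -
      if (p : ℤ) ∣ m then thetaCoeff (m / p) else 0 := by
  have hpp : Prime (p : ℤ) := Nat.prime_iff_prime_int.mp hp
  have hp0 : (p : ℤ) ≠ 0 := hpp.ne_zero
  have hp2 : ¬ (p : ℤ) ∣ 2 := by
    intro h
    have h' : p ∣ 2 := by exact_mod_cast h
    exact h2 ((Nat.prime_dvd_prime_iff_eq hp Nat.prime_two).mp h')
  have hpa : ¬ (p : ℤ) ∣ a := by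
    rintro ⟨c, hc⟩
    have hb : (p : ℤ) ∣ b := by
      have : (p : ℤ) ∣ 2 * b ^ 2 := ⟨1 - p * c ^ 2, by rw [hc] at hab; linear_combination hab⟩
      exact hpp.dvd_of_dvd_pow ((hpp.dvd_or_dvd this).resolve_left hp2)
    obtain ⟨d, hd⟩ := hb
    have : (p : ℤ) * (p * (c ^ 2 + 2 * d ^ 2)) = p * 1 := by
      rw [hc, hd] at hab; linear_combination hab
    exact hpp.not_isUnit (IsUnit.of_mul_eq_one _ (mul_left_cancel₀ hp0 this))
  have hpb : ¬ (p : ℤ) ∣ b := by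
    rintro ⟨c, hc⟩
    refine hpa (hpp.dvd_of_dvd_pow (n := 2) ⟨1 - 2 * p * c ^ 2, ?_⟩)
    rw [hc] at hab; linear_combination hab
  have key : ∀ a b : ℤ, a ^ 2 + 2 * b ^ 2 = p → ∑ z ∈ (formReps (p * m)).filter
      (fun z => (p : ℤ) ∣ a * z.2 - b * z.1), quarticChar z =
        quarticChar (a, b) * thetaCoeff m := by
    intro a b hab
    rw [← sum_filter_dvd (a, b) p m hab hp0]
    congr 1
    ext z
    simp only [Finset.mem_filter, mem_formReps]
    refine and_congr_right fun hz => ⟨fun h => ⟨?_, h⟩, fun h => h.2⟩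
    apply hpp.dvd_of_dvd_pow (n := 2)
    have : (a * z.1 + 2 * b * z.2) ^ 2 = p * (p * m) - 2 * (a * z.2 - b * z.1) ^ 2 := by
      rw [← hz, ← hab]; ring
    rw [this]
    exact dvd_sub (dvd_mul_right _ _) (Dvd.dvd.mul_left (dvd_pow h two_ne_zero) _)
  have k1 := key a b hab
  have k2 := key a (-b) (by rw [neg_sq]; exact hab)
  rw [add_mul, ← k1, ← k2, ← sum_filter_prime_dvd hp h2, ← Finset.sum_union_inter,
    thetaCoeff, ← Finset.filter_or, ← Finset.filter_and, eq_sub_iff_add_eq]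
  congr 1
  · rw [Finset.filter_true_of_mem]
    intro z hz
    rw [mem_formReps] at hz
    refine hpp.dvd_or_dvd ⟨z.2 ^ 2 - b ^ 2 * m, ?_⟩
    have : a ^ 2 = p - 2 * b ^ 2 := by linarith
    linear_combination z.2 ^ 2 * this - b ^ 2 * hz
  · congr 1
    ext z
    simp only [Finset.mem_filter]
    refine and_congr_right fun _ => ⟨fun ⟨h, h'⟩ => ⟨?_, ?_⟩, fun ⟨h, h'⟩ => ⟨?_, ?_⟩⟩
    · exact dvd_sub (h'.mul_left _) (h.mul_left _)
    · exact dvd_sub (h'.mul_left _) (h.mul_left _)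
    · have := dvd_sub h' h
      rw [show a * z.2 - -b * z.1 - (a * z.2 - b * z.1) = 2 * (b * z.1) by ring] at this
      exact (hpp.dvd_or_dvd ((hpp.dvd_or_dvd this).resolve_left hp2)).resolve_left hpb
    · have := dvd_add h' h
      rw [show a * z.2 - -b * z.1 + (a * z.2 - b * z.1) = 2 * (a * z.2) by ring] at this
      exact (hpp.dvd_or_dvd ((hpp.dvd_or_dvd this).resolve_left hp2)).resolve_left hpa

theorem exists_thetaCoeff_mul_of_mod_eight_eq_one {p : ℕ} (hp : p.Prime) (h8 : p % 8 = 1) :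
    ∃ ε : GaussianInt, ε ^ 2 = 1 ∧ ∀ m : ℤ, thetaCoeff (p * m) = 2 * ε * thetaCoeff m -
      if (p : ℤ) ∣ m then thetaCoeff (m / p) else 0 := by
  have h2 : p ≠ 2 := by rintro rfl; omega
  obtain ⟨a, b, hab⟩ := exists_eq_sq_add_two_mul_sq hp (Or.inl h8)
  have ha : a % 2 = 1 := by
    rcases Int.emod_two_eq_zero_or_one a with h | h
    · obtain ⟨c, rfl⟩ := Int.dvd_of_emod_eq_zero h
      ring_nf at hab; omega
    · exact h
  have hb : b % 2 = 0 := by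
    rcases Int.emod_two_eq_zero_or_one b with h | h
    · exact h
    · have h1 := Int.sq_mod_four_eq_one_of_odd (Int.odd_iff.mpr ha)
      have h2 := Int.sq_mod_four_eq_one_of_odd (Int.odd_iff.mpr h)
      omega
  have e : quarticChar (a, -b) = quarticChar (a, b) := by
    rcases cast_zmod_four_odd ha with h | h <;> rcases cast_zmod_four_even hb with h' | h' <;>
      simp only [quarticChar, h, h', Int.cast_neg] <;> decide
  refine ⟨quarticChar (a, b), ?_, fun m => ?_⟩
  · rcases cast_zmod_four_odd ha with h | h <;> rcases cast_zmod_four_even hb with h' | h' <;>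
      simp only [quarticChar, h, h'] <;> decide
  · rw [thetaCoeff_split_mul hp h2 hab, e, two_mul]

theorem exists_thetaCoeff_mul_of_mod_eight_ne_one {p : ℕ} (hp : p.Prime) (h2 : p ≠ 2)
    (h8 : p % 8 ≠ 1) :
    ∃ ε : GaussianInt, ε ^ 2 = 1 ∧ ∀ m : ℤ, thetaCoeff (p * m) =
      ε * if (p : ℤ) ∣ m then thetaCoeff (m / p) else 0 := by
  have hodd := hp.eq_two_or_odd.resolve_left h2
  by_cases h3 : p % 8 = 3
  · obtain ⟨a, b, hab⟩ := exists_eq_sq_add_two_mul_sq hp (Or.inr h3)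
    have ha : a % 2 = 1 := by
      rcases Int.emod_two_eq_zero_or_one a with h | h
      · obtain ⟨c, rfl⟩ := Int.dvd_of_emod_eq_zero h
        ring_nf at hab; omega
      · exact h
    have hb : b % 2 = 1 := by
      rcases Int.emod_two_eq_zero_or_one b with h | h
      · obtain ⟨c, rfl⟩ := Int.dvd_of_emod_eq_zero h
        have h1 := Int.sq_mod_four_eq_one_of_odd (Int.odd_iff.mpr ha)
        ring_nf at hab; omega
      · exact h
    have e : quarticChar (a, b) + quarticChar (a, -b) = 0 := by
      rcases cast_zmod_four_odd ha with h | h <;> rcases cast_zmod_four_odd hb with h' | h' <;>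
        simp only [quarticChar, h, h', Int.cast_neg] <;> decide
    refine ⟨-1, by norm_num, fun m => ?_⟩
    rw [thetaCoeff_split_mul hp h2 hab, e]
    ring
  · refine ⟨1, by norm_num, fun m => ?_⟩
    rw [thetaCoeff_inert_mul hp (by omega), one_mul]

/-- The local factor at `p ^ k` of the square of the normalised theta coefficients. -/
def localSq (p k : ℕ) : ℤ :=
  if p = 2 then (if k = 0 then 1 else 0)
  else if p % 8 = 1 then (k + 1) ^ 2 else if Even k then 1 else 0

theorem thetaCoeff_prime_pow_mul_sq {p : ℕ} (hp : p.Prime) {m : ℤ} (hm : ¬ (p : ℤ) ∣ m) (k : ℕ) :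
    thetaCoeff (p ^ k * m) ^ 2 = localSq p k * thetaCoeff m ^ 2 := by
  have hp0 : (p : ℤ) ≠ 0 := by exact_mod_cast hp.ne_zero
  have hdvd : ∀ k : ℕ, (p : ℤ) ∣ p ^ (k + 1) * m := fun k => ⟨p ^ k * m, by ring⟩
  have hdiv : ∀ k : ℕ, (p ^ (k + 1) * m : ℤ) / p = p ^ k * m := fun k => by
    rw [pow_succ', mul_assoc, Int.mul_ediv_cancel_left _ hp0]
  have hsucc : ∀ k : ℕ, (p ^ (k + 1) * m : ℤ) = p * (p ^ k * m) := fun k => by ring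
  unfold localSq
  split_ifs with h2 hk h1 he
  · simp [hk]
  · obtain ⟨j, rfl⟩ := Nat.exists_eq_succ_of_ne_zero hk
    rw [Nat.succ_eq_add_one, hsucc, h2]
    simp [thetaCoeff_two_mul]
  · obtain ⟨ε, hε, h⟩ := exists_thetaCoeff_mul_of_mod_eight_eq_one hp h1
    have key : ∀ k : ℕ, thetaCoeff (p ^ k * m) = ε ^ k * (k + 1) * thetaCoeff m ∧
        thetaCoeff (p ^ (k + 1) * m) = ε ^ (k + 1) * (k + 2) * thetaCoeff m := by
      intro k
      induction k with
      | zero =>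
        have := h m
        rw [if_neg hm] at this
        refine ⟨by simp, ?_⟩
        rw [zero_add, pow_one, this]
        push_cast
        ring
      | succ k ih =>
        refine ⟨by rw [ih.2]; push_cast; ring, ?_⟩
        rw [hsucc, h, if_pos (hdvd k), hdiv, ih.1, ih.2]
        push_cast
        linear_combination (ε ^ k * (k + 1) * thetaCoeff m) * hε
    rw [(key k).1, mul_pow, mul_pow, ← pow_mul, mul_comm k 2, pow_mul, hε, one_pow]
    push_cast
    ring
  all_goals
    obtain ⟨ε, hε, h⟩ := exists_thetaCoeff_mul_of_mod_eight_ne_one hp h2 h1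
    have key : ∀ k : ℕ, thetaCoeff (p ^ (k + 2) * m) ^ 2 = thetaCoeff (p ^ k * m) ^ 2 := by
      intro k
      rw [hsucc, h, if_pos (hdvd k), hdiv, mul_pow, hε, one_mul]
  · obtain ⟨j, rfl⟩ := he
    induction j with
    | zero => simp
    | succ j ih => rw [show j + 1 + (j + 1) = j + j + 2 by ring, key, ih]
  · obtain ⟨j, rfl⟩ := Nat.not_even_iff_odd.mp he
    induction j with
    | zero => simp [h, hm]
    | succ j ih =>
      rw [show 2 * (j + 1) + 1 = 2 * j + 1 + 2 by ring, key, ih]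
      simp

theorem thetaCoeff_sq_eq (F : ArithmeticFunction ℤ) (hF : F.IsMultiplicative)
    (hloc : ∀ p k : ℕ, p.Prime → F (p ^ k) = localSq p k) (n : ℕ) (hn : n ≠ 0) :
    thetaCoeff n ^ 2 = 4 * F n := by
  induction n using Nat.recOnPrimePow with
  | zero => exact absurd rfl hn
  | one => rw [Nat.cast_one, thetaCoeff_one, hF.map_one]; norm_num
  | prime_pow_mul m p k hp hm hk ih =>
    have hm0 : m ≠ 0 := by rintro rfl; simp at hm
    have := thetaCoeff_prime_pow_mul_sq hp (m := m) (by exact_mod_cast hm) k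
    rw [ih hm0] at this
    rw [hF.map_mul_of_coprime (Nat.Coprime.pow_left _ ((Nat.Prime.coprime_iff_not_dvd hp).mpr hm)),
      hloc p k hp]
    push_cast
    rw [this]; ring

theorem formReps_odd_parity {m : ℤ} (hm : m % 8 = 1) {z : ℤ × ℤ} (hz : z ∈ formReps m) :
    z.1 % 2 = 1 ∧ z.2 % 2 = 0 := by
  rw [mem_formReps] at hz
  have h1 : z.1 % 2 = 1 := by
    rcases Int.emod_two_eq_zero_or_one z.1 with h | h
    · obtain ⟨c, hc⟩ := Int.dvd_of_emod_eq_zero h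
      rw [hc] at hz; ring_nf at hz; omega
    · exact h
  refine ⟨h1, ?_⟩
  rcases Int.emod_two_eq_zero_or_one z.2 with h | h
  · exact h
  · have h1 := Int.sq_mod_four_eq_one_of_odd (Int.odd_iff.mpr h1)
    have h2 := Int.sq_mod_four_eq_one_of_odd (Int.odd_iff.mpr h)
    omega

theorem thetaCoeff_eq_zero {m : ℤ} (hm : m % 8 ≠ 1) : thetaCoeff m = 0 := by
  have key : thetaCoeff m = -thetaCoeff m := by
    rw [thetaCoeff, ← Finset.sum_neg_distrib]
    refine Finset.sum_bij (fun z _ => (z.1, -z.2)) ?_ ?_ ?_ ?_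
    · intro z hz
      rw [mem_formReps] at hz ⊢
      rw [neg_sq]; exact hz
    · intro z _ z' _ h
      simp only [Prod.mk.injEq, neg_inj] at h
      exact Prod.ext h.1 h.2
    · intro z hz
      refine ⟨(z.1, -z.2), ?_, by simp⟩
      rw [mem_formReps] at hz ⊢
      rw [neg_sq]; exact hz
    · intro z hz
      rw [mem_formReps] at hz
      have hcase : z.1 % 2 = 0 ∨ (z.1 % 2 = 1 ∧ z.2 % 2 = 1) := by
        rcases Int.emod_two_eq_zero_or_one z.1 with h | h
        · exact Or.inl h
        rcases Int.emod_two_eq_zero_or_one z.2 with h' | h'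
        · exfalso
          obtain ⟨c, hc⟩ := Int.dvd_of_emod_eq_zero h'
          obtain ⟨d, hd⟩ := Int.odd_iff.mpr h
          obtain ⟨e, he⟩ := Int.even_mul_succ_self d
          rw [hc, hd] at hz
          have : m = 8 * e + 8 * c ^ 2 + 1 := by linear_combination -hz + 4 * he
          omega
        · exact Or.inr ⟨h, h'⟩
      rcases hcase with h | ⟨h, h'⟩
      · rcases cast_zmod_four_even h with h | h <;> simp only [quarticChar, h, Int.cast_neg] <;>
          generalize (z.2 : ZMod 4) = y <;> revert y <;> decide
      · rcases cast_zmod_four_odd h with h | h <;> rcases cast_zmod_four_odd h' with h' | h' <;>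
          simp only [quarticChar, h, h', Int.cast_neg] <;> decide
  have h2 : (2 : GaussianInt) * thetaCoeff m = 0 := by linear_combination key
  exact (mul_eq_zero.mp h2).resolve_left (by decide)

/-- The even Dirichlet character modulo `12`. -/
def charTwelve (x : ZMod 12) : ℤ :=
  if x = 1 ∨ x = 11 then 1 else if x = 5 ∨ x = 7 then -1 else 0

theorem charTwelve_neg : ∀ x : ZMod 12, charTwelve (-x) = charTwelve x := by decide

theorem cast_zmod_twelve (x : ℤ) : ((x % 12 : ℤ) : ZMod 12) = x :=
  (ZMod.intCast_mod x 12)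

theorem emod_six_of_charTwelve_ne_zero {x : ℤ} (h : charTwelve x ≠ 0) :
    x % 6 = 1 ∨ x % 6 = 5 := by
  rw [← cast_zmod_twelve] at h
  have h1 : 0 ≤ x % 12 := by omega
  have h2 : x % 12 < 12 := by omega
  have h3 : x % 6 = (x % 12) % 6 := by omega
  rw [h3]
  generalize x % 12 = r at *
  interval_cases r <;> first | decide | exact absurd (by decide) h

theorem charTwelve_six_mul_sub_one (k : ℤ) : charTwelve ((6 * k - 1 : ℤ) : ZMod 12) =
    Int.negOnePow k := by
  rcases Int.even_or_odd' k with ⟨j, rfl | rfl⟩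
  · rw [Int.negOnePow_even _ (by simp)]
    have : ((12 : ℤ) : ZMod 12) = 0 := by decide
    have h : ((6 * (2 * j) - 1 : ℤ) : ZMod 12) = ((12 : ℤ) : ZMod 12) * j - 1 := by
      push_cast; ring
    rw [h, this, zero_mul]; decide
  · rw [Int.negOnePow_odd _ (by simp)]
    have : ((12 : ℤ) : ZMod 12) = 0 := by decide
    have h : ((6 * (2 * j + 1) - 1 : ℤ) : ZMod 12) = ((12 : ℤ) : ZMod 12) * j + 5 := by
      push_cast; ring
    rw [h, this, zero_mul]; decide

/-- The square roots of `m`. -/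
noncomputable def sqReps (m : ℤ) : Finset ℤ := (Finset.Icc (-m) m).filter fun x => x ^ 2 = m

theorem mem_sqReps {m x : ℤ} : x ∈ sqReps m ↔ x ^ 2 = m := by
  simp only [sqReps, Finset.mem_filter, Finset.mem_Icc, and_iff_right_iff_imp]
  intro h
  have h1 : |x| ≤ x ^ 2 := by simpa using Int.natAbs_le_self_sq x
  rw [← abs_le, ← h]; exact h1

theorem two_mul_coeff_pentagonalSeries (n : ℕ) :
    2 * (PowerSeries.pentagonalSeries ℤ).coeff n =
      ∑ x ∈ sqReps (24 * n + 1), charTwelve x := by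
  by_cases hn : n ∈ Set.range pentagonal
  · obtain ⟨k, rfl⟩ := hn
    have h := two_mul_natCast_pentagonal k
    have hset : sqReps (24 * (pentagonal k : ℤ) + 1) = {6 * k - 1, -(6 * k - 1)} := by
      ext x
      rw [mem_sqReps, show 24 * (pentagonal k : ℤ) + 1 = (6 * k - 1) ^ 2 by
        linear_combination 12 * h, sq_eq_sq_iff_eq_or_eq_neg]
      simp
    rw [hset, Finset.sum_pair (by omega), PowerSeries.coeff_pentagonalSeries_pentagonal]
    rw [Int.cast_neg, charTwelve_neg, charTwelve_six_mul_sub_one]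
    simp only [Int.cast_id]
    ring
  · rw [PowerSeries.coeff_pentagonalSeries_eq_zero _ hn, mul_zero]
    symm
    refine Finset.sum_eq_zero fun x hx => ?_
    rw [mem_sqReps] at hx
    by_contra hne
    apply hn
    have : ∃ k : ℤ, (6 * k - 1) ^ 2 = 24 * (n : ℤ) + 1 := by
      rcases emod_six_of_charTwelve_ne_zero hne with h | h
      · refine ⟨-(x / 6), ?_⟩
        rw [← hx, show 6 * -(x / 6) - 1 = - x by omega, neg_sq]
      · refine ⟨x / 6 + 1, ?_⟩
        rw [← hx, show 6 * (x / 6 + 1) - 1 = x by omega]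
    obtain ⟨k, hk⟩ := this
    refine ⟨k, ?_⟩
    have h := two_mul_natCast_pentagonal k
    have : (pentagonal k : ℤ) = n := by linarith
    exact_mod_cast this


theorem charTwelve_mul_self_dvd {x y : ℤ} (h1 : (3 : ℤ) ∣ x - y) (h2 : (3 : ℤ) ∣ x + y) :
    charTwelve x * charTwelve y = 0 := by
  by_contra h
  have := emod_six_of_charTwelve_ne_zero (left_ne_zero_of_mul h)
  omega

set_option maxRecDepth 100000 in
theorem charTwelve_mul_eq_quarticCharMod : ∀ s t : ZMod 12,
    (s.val % 2 = 1 ∧ t.val % 2 = 0) →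
      ((charTwelve (s - 2 * t) * charTwelve (s + t) : ℤ) : GaussianInt) =
        if (s + t).val % 3 = 0 then 0 else quarticCharMod s.cast t.cast := by
  decide

theorem val_cast_zmod_twelve (x : ℤ) : (((x : ZMod 12).val : ℕ) : ℤ) = x % 12 :=
  ZMod.val_intCast x

theorem charTwelve_formMul {z : ℤ × ℤ} (h1 : z.1 % 2 = 1) (h2 : z.2 % 2 = 0) :
    ((charTwelve (formMul (1, 1) z).1 * charTwelve (formMul (1, 1) z).2 : ℤ) : GaussianInt) =
      if (3 : ℤ) ∣ z.1 + z.2 then 0 else quarticChar z := by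
  have e1 := val_cast_zmod_twelve z.1
  have e2 := val_cast_zmod_twelve z.2
  have e3 := val_cast_zmod_twelve (z.1 + z.2)
  have := charTwelve_mul_eq_quarticCharMod z.1 z.2 ⟨by omega, by omega⟩
  have hd : (((z.1 : ZMod 12) + (z.2 : ZMod 12)).val % 3 = 0) ↔ (3 : ℤ) ∣ z.1 + z.2 := by
    push_cast at e3
    omega
  rw [quarticChar]
  simp only [hd] at this
  rw [ZMod.cast_intCast (by norm_num), ZMod.cast_intCast (by norm_num)] at this
  rw [← this]
  simp [formMul, add_comm]

theorem sum_charTwelve_eq_two_mul_thetaCoeff (m : ℤ) (hm : m % 8 = 1) :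
    ((∑ z ∈ (formReps (3 * m)), charTwelve z.1 * charTwelve z.2 : ℤ) : GaussianInt)
      = 2 * thetaCoeff m := by
  have h3 : Prime (3 : ℤ) := Int.prime_three
  set T₁ := ∑ z ∈ (formReps (3 * m)).filter (fun z => (3 : ℤ) ∣ z.1 - z.2),
    charTwelve z.1 * charTwelve z.2 with hT₁
  set T₂ := ∑ z ∈ (formReps (3 * m)).filter (fun z => (3 : ℤ) ∣ z.1 + z.2),
    charTwelve z.1 * charTwelve z.2 with hT₂
  have hsum : ∑ z ∈ (formReps (3 * m)), charTwelve z.1 * charTwelve z.2 = T₁ + T₂ := by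
    rw [hT₁, hT₂, ← Finset.sum_union_inter, ← Finset.filter_or, ← Finset.filter_and]
    rw [Finset.filter_true_of_mem, Finset.sum_eq_zero (s := Finset.filter _ _), add_zero]
    · intro z hz
      simp only [Finset.mem_filter] at hz
      exact charTwelve_mul_self_dvd hz.2.1 hz.2.2
    · intro z hz
      rw [mem_formReps] at hz
      refine h3.dvd_or_dvd ⟨m - z.2 ^ 2, ?_⟩
      linear_combination hz
  have hT : T₂ = T₁ := by
    refine Finset.sum_bij (fun z _ => (z.1, -z.2)) ?_ ?_ ?_ ?_
    · intro z hz
      simpa [mem_formReps] using hz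
    · intro z _ z' _ h
      simp only [Prod.mk.injEq, neg_inj] at h
      exact Prod.ext h.1 h.2
    · intro z hz
      refine ⟨(z.1, -z.2), ?_, by simp⟩
      simpa [mem_formReps, sub_eq_add_neg] using hz
    · intro z _
      simp only [Int.cast_neg, charTwelve_neg]
  have hT₁' : (T₁ : GaussianInt) = thetaCoeff m := by
    have e := sum_filter_dvd_eq_sum_formMul
      (fun z : ℤ × ℤ => charTwelve z.1 * charTwelve z.2) (1, 1) 3 m (by norm_num) (by norm_num)
    have hfil : (formReps (3 * m)).filter (fun z => (3 : ℤ) ∣ z.1 - z.2) =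
        (formReps (3 * m)).filter (fun z => (3 : ℤ) ∣ 1 * z.1 + 2 * 1 * z.2 ∧
          (3 : ℤ) ∣ 1 * z.2 - 1 * z.1) := by
      refine Finset.filter_congr fun z _ => ?_
      omega
    rw [hT₁, hfil, e, Int.cast_sum, Finset.sum_congr rfl fun z hz =>
      charTwelve_formMul (formReps_odd_parity hm hz).1 (formReps_odd_parity hm hz).2]
    have hz : ∑ z ∈ (formReps m).filter (fun z => (3 : ℤ) ∣ z.1 + z.2), quarticChar z = 0 := by
      by_cases hd : (3 : ℤ) ∣ m
      · obtain ⟨m', rfl⟩ := hd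
        have := sum_filter_dvd (1, -1) 3 m' (by norm_num) (by norm_num)
        rw [thetaCoeff_eq_zero (by omega), mul_zero] at this
        rw [← this]
        congr 1
        refine Finset.filter_congr fun z _ => ?_
        dsimp only
        omega
      · refine Finset.sum_eq_zero fun z hz => absurd ?_ hd
        simp only [Finset.mem_filter, mem_formReps] at hz
        obtain ⟨hz, c, hc⟩ := hz
        refine ⟨c * (z.1 - z.2) + z.2 ^ 2, ?_⟩
        rw [← hz]
        linear_combination (z.1 - z.2) * hc
    rw [thetaCoeff, ← Finset.sum_filter_add_sum_filter_not (formReps m)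
      (fun z => (3 : ℤ) ∣ z.1 + z.2) quarticChar, hz, zero_add, Finset.sum_filter]
    exact Finset.sum_congr rfl fun z _ => by split_ifs <;> simp_all
  rw [hsum, hT, Int.cast_add, hT₁', two_mul]

theorem sum_antidiagonal_sqReps (n : ℕ) :
    ∑ ij ∈ Finset.HasAntidiagonal.antidiagonal n, (∑ x ∈ sqReps (24 * ij.1 + 1), charTwelve x) *
      (if 2 ∣ ij.2 then ∑ y ∈ sqReps (24 * (ij.2 / 2 : ℕ) + 1), charTwelve y else 0) =
    ∑ z ∈ formReps (3 * (8 * n + 1)), charTwelve z.1 * charTwelve z.2 := by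
  rw [← Finset.sum_filter_ne_zero (s := formReps _)]
  have hmod : ∀ {x : ℤ}, charTwelve x ≠ 0 → ∃ i : ℕ, x ^ 2 = 24 * i + 1 := by
    intro x hx
    have h6 := emod_six_of_charTwelve_ne_zero hx
    have h24 : x ^ 2 % 24 = 1 := by
      obtain ⟨k, hk⟩ | ⟨k, hk⟩ : (∃ k, x = 6 * k + 1) ∨ (∃ k, x = 6 * k - 1) := by
        rcases h6 with h | h
        · exact Or.inl ⟨x / 6, by omega⟩
        · exact Or.inr ⟨x / 6 + 1, by omega⟩
      all_goals
        have hk' : Even (k * (3 * k + 1)) ∧ Even (k * (3 * k - 1)) := by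
          rcases Int.even_or_odd k with h | h
          · exact ⟨h.mul_right _, h.mul_right _⟩
          · exact ⟨(by grind), (by grind)⟩
        obtain ⟨⟨e, he⟩, ⟨f, hf⟩⟩ := hk'
      · have : x ^ 2 = 24 * e + 1 := by rw [hk]; linear_combination 12 * he
        omega
      · have : x ^ 2 = 24 * f + 1 := by rw [hk]; linear_combination 12 * hf
        omega
    refine ⟨(x ^ 2 / 24).toNat, ?_⟩
    have := sq_nonneg x
    omega
  rw [← Finset.sum_fiberwise_of_maps_to (t := Finset.HasAntidiagonal.antidiagonal n)
    (g := fun z : ℤ × ℤ => ((z.1 ^ 2 / 24).toNat, 2 * (z.2 ^ 2 / 24).toNat))]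
  · refine Finset.sum_congr rfl fun ij hij => ?_
    rw [Finset.HasAntidiagonal.mem_antidiagonal] at hij
    split_ifs with h2
    · rw [Finset.sum_mul_sum, ← Finset.sum_product', ← Finset.sum_filter_ne_zero]
      refine Finset.sum_congr ?_ fun _ _ => rfl
      ext z
      simp only [Finset.mem_filter, Finset.mem_product, mem_sqReps, mem_formReps, Prod.ext_iff]
      constructor
      · rintro ⟨⟨h, h'⟩, hne⟩
        refine ⟨⟨?_, hne⟩, ?_, ?_⟩ <;> omega
      · rintro ⟨⟨h, hne⟩, h', h''⟩
        obtain ⟨i, hi⟩ := hmod (left_ne_zero_of_mul hne)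
        obtain ⟨j, hj⟩ := hmod (right_ne_zero_of_mul hne)
        refine ⟨⟨?_, ?_⟩, hne⟩ <;> omega
    · rw [mul_zero]
      symm
      refine Finset.sum_eq_zero fun z hz => absurd ?_ h2
      simp only [Finset.mem_filter, Prod.ext_iff] at hz
      exact ⟨_, hz.2.2.symm⟩
  · intro z hz
    simp only [Finset.mem_filter, mem_formReps] at hz
    obtain ⟨h, hne⟩ := hz
    obtain ⟨i, hi⟩ := hmod (left_ne_zero_of_mul hne)
    obtain ⟨j, hj⟩ := hmod (right_ne_zero_of_mul hne)
    rw [Finset.HasAntidiagonal.mem_antidiagonal]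
    omega

theorem coeff_prod_eq_sum (n : ℕ) : ∃ N, n ≤ N ∧
    ((∏ m ∈ Finset.Icc 1 N, (((1 : Polynomial ℤ) - Polynomial.X ^ m) *
          ((1 : Polynomial ℤ) - Polynomial.X ^ (2 * m)))).coeff n) =
    ∑ ij ∈ Finset.HasAntidiagonal.antidiagonal n, (PowerSeries.pentagonalSeries ℤ).coeff ij.1 *
      (if 2 ∣ ij.2 then (PowerSeries.pentagonalSeries ℤ).coeff (ij.2 / 2) else 0) := by
  have hev : ∀ i : ℕ, ∀ᶠ N : ℕ in Filter.atTop,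
      (∏ n ∈ Finset.range N, (1 - PowerSeries.X ^ (n + 1) : PowerSeries ℤ)).coeff i =
        (PowerSeries.pentagonalSeries ℤ).coeff i := fun i =>
    Filter.tendsto_finset_range.eventually (PowerSeries.coeff_prod_one_sub_X_pow_eventually_eq ℤ i)
  have hall : ∀ᶠ N : ℕ in Filter.atTop, ∀ i ∈ Finset.range (n + 1),
      (∏ n ∈ Finset.range N, (1 - PowerSeries.X ^ (n + 1) : PowerSeries ℤ)).coeff i =
        (PowerSeries.pentagonalSeries ℤ).coeff i :=
    (Filter.eventually_all_finset _).mpr fun i _ => hev i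
  obtain ⟨N, hN, hnN⟩ := (hall.and (Filter.eventually_ge_atTop n)).exists
  refine ⟨N, hnN, ?_⟩
  rw [← Polynomial.coeff_coe]
  have hprod : ((∏ m ∈ Finset.Icc 1 N, (((1 : Polynomial ℤ) - Polynomial.X ^ m) *
      ((1 : Polynomial ℤ) - Polynomial.X ^ (2 * m))) : Polynomial ℤ) : PowerSeries ℤ) =
      (∏ n ∈ Finset.range N, (1 - PowerSeries.X ^ (n + 1) : PowerSeries ℤ)) *
      PowerSeries.expand 2 two_ne_zero
        (∏ n ∈ Finset.range N, (1 - PowerSeries.X ^ (n + 1) : PowerSeries ℤ)) := by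
    rw [Finset.range_eq_Ico, Finset.prod_Ico_add'
      (fun m => (1 - PowerSeries.X ^ m : PowerSeries ℤ)),
      map_prod, ← Finset.prod_mul_distrib, zero_add, ← Finset.Ico_succ_right_eq_Icc,
      ← Polynomial.coeToPowerSeries.ringHom_apply, map_prod]
    refine Finset.prod_congr rfl fun m _ => ?_
    simp [pow_mul, PowerSeries.expand_X]
  rw [hprod, PowerSeries.coeff_mul]
  refine Finset.sum_congr rfl fun ij hij => ?_
  rw [Finset.HasAntidiagonal.mem_antidiagonal] at hij
  rw [hN _ (by rw [Finset.mem_range]; omega), PowerSeries.coeff_expand]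
  split_ifs
  · rw [hN _ (by rw [Finset.mem_range]; omega)]
  · rfl

/-- The coefficients of `∏ (1 - q ^ m) (1 - q ^ (2 * m))` in terms of `ℤ[√-2]`. -/
theorem thetaCoeff_eq_two_mul (b : ℕ → ℤ)
    (hb : ∀ n N : ℕ, n ≤ N →
      b n = ((∏ m ∈ Finset.Icc 1 N,
        (((1 : Polynomial ℤ) - Polynomial.X ^ m) *
          ((1 : Polynomial ℤ) - Polynomial.X ^ (2 * m)))).coeff n)) (n : ℕ) :
    thetaCoeff (8 * n + 1) = 2 * b n := by
  obtain ⟨N, hN, h⟩ := coeff_prod_eq_sum n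
  have h1 : 4 * b n = ∑ z ∈ formReps (3 * (8 * n + 1)), charTwelve z.1 * charTwelve z.2 := by
    rw [← sum_antidiagonal_sqReps, hb n N hN, h, Finset.mul_sum]
    refine Finset.sum_congr rfl fun ij _ => ?_
    rw [← two_mul_coeff_pentagonalSeries]
    split_ifs
    · rw [← two_mul_coeff_pentagonalSeries]; ring
    · simp
  have h2 := sum_charTwelve_eq_two_mul_thetaCoeff (8 * n + 1) (by omega)
  rw [← h1] at h2
  push_cast at h2
  have h3 : (2 : GaussianInt) * (thetaCoeff (8 * n + 1) - 2 * b n) = 0 := by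
    linear_combination -h2
  exact sub_eq_zero.mp ((mul_eq_zero.mp h3).resolve_left (by decide))

section

open ArithmeticFunction

/-- A character modulo `8` as an arithmetic function. -/
def modEightFun (χ : MulChar (ZMod 8) ℤ) : ArithmeticFunction ℤ :=
  ⟨fun n => χ n, by simpa using χ.map_nonunit (by decide : ¬ IsUnit ((0 : ℕ) : ZMod 8))⟩

theorem modEightFun_apply (χ : MulChar (ZMod 8) ℤ) (n : ℕ) : modEightFun χ n = χ n := rfl

theorem modEightFun_mul (χ : MulChar (ZMod 8) ℤ) (m n : ℕ) :
    modEightFun χ (m * n) = modEightFun χ m * modEightFun χ n := by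
  simp [modEightFun_apply]

theorem modEightFun_one (χ : MulChar (ZMod 8) ℤ) : modEightFun χ 1 = 1 := by
  simp [modEightFun_apply]

theorem isMultiplicative_modEightFun (χ : MulChar (ZMod 8) ℤ) :
    (modEightFun χ).IsMultiplicative :=
  ⟨modEightFun_one χ, fun _ => modEightFun_mul χ _ _⟩

/-- The arithmetic function with Dirichlet series `∏ (1 - p ^ (-2 * s))` over odd `p`. -/
def oddSqMoebius : ArithmeticFunction ℤ :=
  ⟨fun n => if Odd n ∧ IsSquare n then moebius (Nat.sqrt n) else 0, by simp⟩

theorem oddSqMoebius_apply (n : ℕ) :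
    oddSqMoebius n = if Odd n ∧ IsSquare n then moebius (Nat.sqrt n) else 0 := rfl

theorem isSquare_left_of_coprime {m n : ℕ} (hmn : m.Coprime n) (h : IsSquare (m * n)) :
    IsSquare m := by
  obtain ⟨c, hc⟩ := h
  rw [← sq] at hc
  obtain ⟨d, rfl⟩ := exists_eq_pow_of_mul_eq_pow (by rw [Nat.isUnit_iff]; exact hmn) hc
  exact ⟨d, sq d⟩

theorem isMultiplicative_oddSqMoebius : oddSqMoebius.IsMultiplicative := by
  refine ⟨by simp [oddSqMoebius_apply], fun {m n} hmn => ?_⟩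
  simp only [oddSqMoebius_apply]
  have hiff : (Odd (m * n) ∧ IsSquare (m * n)) ↔
      (Odd m ∧ IsSquare m) ∧ (Odd n ∧ IsSquare n) := by
    rw [Nat.odd_mul]
    constructor
    · rintro ⟨⟨h1, h2⟩, h⟩
      exact ⟨⟨h1, isSquare_left_of_coprime hmn h⟩, h2,
        isSquare_left_of_coprime hmn.symm (mul_comm m n ▸ h)⟩
    · rintro ⟨⟨h1, h2⟩, h3, h4⟩
      exact ⟨⟨h1, h3⟩, h2.mul h4⟩
  by_cases h : (Odd m ∧ IsSquare m) ∧ (Odd n ∧ IsSquare n)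
  · rw [if_pos (hiff.mpr h), if_pos h.1, if_pos h.2]
    obtain ⟨⟨-, a, rfl⟩, -, b, rfl⟩ := h
    rw [mul_mul_mul_comm, Nat.sqrt_eq, Nat.sqrt_eq, Nat.sqrt_eq]
    exact isMultiplicative_moebius.map_mul_of_coprime
      (Nat.Coprime.coprime_mul_left_right (Nat.Coprime.coprime_mul_left hmn))
  · rw [if_neg (mt hiff.mp h)]
    rcases not_and_or.mp h with h | h <;> simp [h]

/-- The local power series of an arithmetic function at `p`. -/
noncomputable def localSeries (p : ℕ) (F : ArithmeticFunction ℤ) : PowerSeries ℤ :=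
  PowerSeries.mk fun k => F (p ^ k)

theorem localSeries_mul {p : ℕ} (hp : p.Prime) (F G : ArithmeticFunction ℤ) :
    localSeries p (F * G) = localSeries p F * localSeries p G := by
  ext k
  simp only [localSeries, PowerSeries.coeff_mk, PowerSeries.coeff_mul, mul_apply]
  rw [Nat.sum_divisorsAntidiagonal (fun a b => F a * G b), Nat.divisors_prime_pow hp,
    Finset.sum_map,
      Finset.Nat.sum_antidiagonal_eq_sum_range_succ (fun i j => F (p ^ i) * G (p ^ j))]
  refine Finset.sum_congr rfl fun i hi => ?_
  have : i ≤ k := by simpa [Nat.lt_succ_iff] using hi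
  simp [Nat.pow_div this hp.pos]

theorem localSeries_modEightFun (p : ℕ) (χ : MulChar (ZMod 8) ℤ) :
    (1 - PowerSeries.C (χ p) * PowerSeries.X) * localSeries p (modEightFun χ) = 1 := by
  rw [sub_mul, one_mul, mul_assoc]
  ext k
  rw [map_sub, PowerSeries.coeff_C_mul]
  rcases k with _ | k
  · simp [localSeries, modEightFun_one]
  · simp [localSeries, PowerSeries.coeff_succ_X_mul, PowerSeries.coeff_one,
      pow_succ', modEightFun_apply]

theorem localSeries_oddSqMoebius {p : ℕ} (hp : p.Prime) (hp2 : p ≠ 2) :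
    localSeries p oddSqMoebius = 1 - PowerSeries.X ^ 2 := by
  have hodd := hp.odd_of_ne_two hp2
  ext k
  simp only [localSeries, PowerSeries.coeff_mk, oddSqMoebius_apply, map_sub,
    PowerSeries.coeff_one, PowerSeries.coeff_X_pow, hodd.pow, true_and]
  rcases Nat.even_or_odd k with h | h
  · obtain ⟨j, rfl⟩ := h
    have : p ^ (j + j) = p ^ j * p ^ j := pow_add _ _ _
    rw [this, if_pos ⟨_, rfl⟩, Nat.sqrt_eq]
    rcases j with _ | _ | j
    · simp
    · simp [moebius_apply_prime hp]
    · rw [moebius_apply_prime_pow hp (by omega), if_neg (by omega), if_neg (by omega),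
        if_neg (by omega), sub_zero]
  · rw [if_neg, if_neg (by rintro rfl; simp at h), if_neg (by rintro rfl; exact absurd h (by decide)),
      sub_zero]
    rintro ⟨a, ha⟩
    have := congrArg (padicValNat p) ha
    have hfact : Fact p.Prime := ⟨hp⟩
    have ha0 : a ≠ 0 := by rintro rfl; simp [hp.ne_zero] at ha
    rw [padicValNat.prime_pow, padicValNat.mul ha0 ha0] at this
    exact (Nat.not_even_iff_odd.mpr h) ⟨_, this⟩

/-- The product of the four characters modulo `8`, as a Dirichlet convolution. -/
noncomputable def modEightConv : ArithmeticFunction ℤ :=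
  modEightFun 1 * modEightFun ZMod.χ₈ * modEightFun ZMod.χ₈' * modEightFun (ZMod.χ₈ * ZMod.χ₈')

/-- The multiplicative function with local values `localSq`. -/
noncomputable def sqCoeff : ArithmeticFunction ℤ := modEightConv * oddSqMoebius

theorem isMultiplicative_sqCoeff : sqCoeff.IsMultiplicative :=
  ((((isMultiplicative_modEightFun _).mul (isMultiplicative_modEightFun _)).mul
    (isMultiplicative_modEightFun _)).mul (isMultiplicative_modEightFun _)).mul
    isMultiplicative_oddSqMoebius

theorem localSeries_sqCoeff {p : ℕ} (hp : p.Prime) :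
    (1 - PowerSeries.C ((1 : MulChar (ZMod 8) ℤ) p) * PowerSeries.X) *
    (1 - PowerSeries.C (ZMod.χ₈ p) * PowerSeries.X) *
    (1 - PowerSeries.C (ZMod.χ₈' p) * PowerSeries.X) *
    (1 - PowerSeries.C ((ZMod.χ₈ * ZMod.χ₈') p) * PowerSeries.X) * localSeries p sqCoeff =
    localSeries p oddSqMoebius := by
  simp only [sqCoeff, modEightConv, localSeries_mul hp]
  have h0 := localSeries_modEightFun p 1
  have h1 := localSeries_modEightFun p ZMod.χ₈
  have h2 := localSeries_modEightFun p ZMod.χ₈'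
  have h3 := localSeries_modEightFun p (ZMod.χ₈ * ZMod.χ₈')
  set a := localSeries p (modEightFun 1)
  set b := localSeries p (modEightFun ZMod.χ₈)
  set c := localSeries p (modEightFun ZMod.χ₈')
  set d := localSeries p (modEightFun (ZMod.χ₈ * ZMod.χ₈'))
  rw [show ∀ u v w z e : PowerSeries ℤ, u * v * w * z * (a * b * c * d * e) =
    (u * a) * (v * b) * (w * c) * (z * d) * e from fun _ _ _ _ _ => by ring, h0, h1, h2, h3]
  ring

theorem one_sub_X_pow_three_mul :
    (1 - PowerSeries.X : PowerSeries ℤ) ^ 3 * PowerSeries.mk (fun k : ℕ => ((k : ℤ) + 1) ^ 2) =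
      1 + PowerSeries.X := by
  have h1 : (1 - PowerSeries.X : PowerSeries ℤ) *
      PowerSeries.mk (fun k : ℕ => ((k : ℤ) + 1) ^ 2) =
      PowerSeries.mk (fun k : ℕ => 2 * (k : ℤ) + 1) := by
    ext k
    rw [sub_mul, one_mul]
    rcases k with _ | k
    · simp
    · simp [PowerSeries.coeff_succ_X_mul]; ring
  have h2 : (1 - PowerSeries.X : PowerSeries ℤ) * PowerSeries.mk (fun k : ℕ => 2 * (k : ℤ) + 1) =
      PowerSeries.mk (fun k : ℕ => if k = 0 then 1 else 2) := by
    ext k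
    rw [sub_mul, one_mul]
    rcases k with _ | k
    · simp
    · simp [PowerSeries.coeff_succ_X_mul]; ring
  have h3 : (1 - PowerSeries.X : PowerSeries ℤ) *
      PowerSeries.mk (fun k : ℕ => if k = 0 then (1 : ℤ) else 2) = 1 + PowerSeries.X := by
    ext k
    rw [sub_mul, one_mul]
    rcases k with _ | _ | k
    · simp
    · simp [PowerSeries.coeff_one, PowerSeries.coeff_succ_X_mul]
    · simp [PowerSeries.coeff_succ_X_mul, PowerSeries.coeff_one, PowerSeries.coeff_X]
  rw [← h3, ← h2, ← h1]; ring

theorem one_sub_X_sq_mul :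
    (1 - PowerSeries.X ^ 2 : PowerSeries ℤ) *
      PowerSeries.mk (fun k : ℕ => if Even k then (1 : ℤ) else 0) = 1 := by
  ext k
  rw [sub_mul, one_mul, sq, mul_assoc]
  rcases k with _ | _ | k
  · simp
  · simp [PowerSeries.coeff_one, PowerSeries.coeff_succ_X_mul]
  · simp [PowerSeries.coeff_succ_X_mul, PowerSeries.coeff_one, Nat.even_add_one]

theorem mulChar_values_of_odd {p : ℕ} (hp : p % 2 = 1) :
    (1 : MulChar (ZMod 8) ℤ) p = 1 ∧
    ((p % 8 = 1 ∧ ZMod.χ₈ p = 1 ∧ ZMod.χ₈' p = 1) ∨ (p % 8 = 3 ∧ ZMod.χ₈ p = -1 ∧ ZMod.χ₈' p = 1) ∨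
     (p % 8 = 5 ∧ ZMod.χ₈ p = -1 ∧ ZMod.χ₈' p = -1) ∨
     (p % 8 = 7 ∧ ZMod.χ₈ p = 1 ∧ ZMod.χ₈' p = -1)) := by
  have : p % 8 = 1 ∨ p % 8 = 3 ∨ p % 8 = 5 ∨ p % 8 = 7 := by omega
  rw [← ZMod.natCast_mod p 8]
  rcases this with h | h | h | h <;> rw [h] <;>
    exact ⟨by rw [MulChar.one_apply (by decide)], by decide⟩

theorem sqCoeff_prime_pow {p k : ℕ} (hp : p.Prime) : sqCoeff (p ^ k) = localSq p k := by
  have key := localSeries_sqCoeff hp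
  suffices h : localSeries p sqCoeff = PowerSeries.mk (localSq p) by
    have := congrArg (PowerSeries.coeff k) h
    simpa [localSeries] using this
  by_cases hp2 : p = 2
  · subst hp2
    have h0 : ∀ χ : MulChar (ZMod 8) ℤ, χ ((2 : ℕ) : ZMod 8) = 0 := fun χ =>
      χ.map_nonunit (by decide)
    simp only [h0, _root_.map_zero, zero_mul, sub_zero, one_mul] at key
    rw [key]
    ext k
    simp only [localSeries, localSq, PowerSeries.coeff_mk, oddSqMoebius_apply, if_true]
    rcases k with _ | k
    · simp
    · rw [if_neg, if_neg (by omega)]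
      rintro ⟨h, -⟩
      rw [pow_succ, Nat.odd_mul] at h
      exact absurd h.2 (by decide)
  · obtain ⟨h0, h⟩ := mulChar_values_of_odd ((hp.eq_two_or_odd).resolve_left hp2)
    have hX : ∀ a : ℤ, (1 - PowerSeries.C a * PowerSeries.X : PowerSeries ℤ) ≠ 0 := fun a h => by
      have := congrArg (PowerSeries.coeff 0) h
      simp at this
    rw [localSeries_oddSqMoebius hp hp2, MulChar.mul_apply, h0] at key
    have hne : (1 - PowerSeries.X : PowerSeries ℤ) ≠ 0 := by simpa using hX 1
    have hne' : (1 + PowerSeries.X : PowerSeries ℤ) ≠ 0 := by simpa using hX (-1)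
    have hloc : PowerSeries.mk (localSq p) = PowerSeries.mk fun k : ℕ =>
        if p % 8 = 1 then ((k : ℤ) + 1) ^ 2 else if Even k then (1 : ℤ) else 0 := by
      ext k; simp [localSq, hp2]
    rw [hloc]
    rcases h with ⟨h8, h1, h2⟩ | ⟨h8, h1, h2⟩ | ⟨h8, h1, h2⟩ | ⟨h8, h1, h2⟩ <;>
      rw [h1, h2] at key <;> simp only [h8] <;> norm_num at key ⊢
    · have h3 := one_sub_X_pow_three_mul
      refine mul_left_cancel₀ (pow_ne_zero 4 hne) ?_
      linear_combination key - (1 - PowerSeries.X) * h3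
    all_goals
      have h3 := one_sub_X_sq_mul
      refine mul_left_cancel₀ (pow_ne_zero 2 (mul_ne_zero hne hne')) ?_
      linear_combination key - (1 - PowerSeries.X ^ 2) * h3

theorem thetaCoeff_sq_eq_sqCoeff {n : ℕ} (hn : n ≠ 0) : thetaCoeff n ^ 2 = 4 * sqCoeff n :=
  thetaCoeff_sq_eq sqCoeff isMultiplicative_sqCoeff (fun _ _ hp => sqCoeff_prime_pow hp) n hn

end

section

open Finset

/-- Abel's inequality for sums over intervals of natural numbers. -/
theorem abs_sum_Ioc_mul_le {u g : ℕ → ℝ} {C : ℝ} {N : ℕ}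
    (hu : ∀ M, N ≤ M → |∑ n ∈ Ioc N M, u n| ≤ C)
    (hg : ∀ n, N < n → g (n + 1) ≤ g n) (hg0 : ∀ n, N < n → 0 ≤ g n) (M : ℕ) (hM : N ≤ M) :
    |∑ n ∈ Ioc N M, u n * g n| ≤ C * g (N + 1) := by
  have hC : 0 ≤ C := (abs_nonneg _).trans (hu N le_rfl)
  rcases hM.eq_or_lt with rfl | hM
  · simpa using mul_nonneg hC (hg0 _ (Nat.lt_succ_self _))
  have key : ∀ M, N + 1 ≤ M →
      |∑ n ∈ Ioc N M, u n * g n - (∑ n ∈ Ioc N M, u n) * g M| ≤ C * (g (N + 1) - g M) := by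
    intro M hM
    induction M, hM using Nat.le_induction with
    | base => simp
    | succ M hM ih =>
      rw [sum_Ioc_succ_top (by omega), sum_Ioc_succ_top (by omega)]
      have h1 : |(∑ n ∈ Ioc N M, u n) * (g M - g (M + 1))| ≤ C * (g M - g (M + 1)) := by
        rw [abs_mul, abs_of_nonneg (sub_nonneg.mpr (hg M (by omega)))]
        exact mul_le_mul_of_nonneg_right (hu M (by omega)) (sub_nonneg.mpr (hg M (by omega)))
      calc _ = |(∑ n ∈ Ioc N M, u n * g n - (∑ n ∈ Ioc N M, u n) * g M) +
            (∑ n ∈ Ioc N M, u n) * (g M - g (M + 1))| := by congr 1; ring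
        _ ≤ _ := (abs_add_le _ _).trans (by linarith)
  have h1 := key M hM
  have h2 : |(∑ n ∈ Ioc N M, u n) * g M| ≤ C * g M := by
    rw [abs_mul, abs_of_nonneg (hg0 M hM)]
    exact mul_le_mul_of_nonneg_right (hu M hM.le) (hg0 M hM)
  calc _ = |(∑ n ∈ Ioc N M, u n * g n - (∑ n ∈ Ioc N M, u n) * g M) +
            (∑ n ∈ Ioc N M, u n) * g M| := by congr 1; ring
    _ ≤ _ := (abs_add_le _ _).trans (by linarith)

theorem sum_Ioc_sub_sum_Ioc (f : ℕ → ℝ) {N M : ℕ} (h : N ≤ M) :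
    ∑ n ∈ Ioc 0 M, f n - ∑ n ∈ Ioc 0 N, f n = ∑ n ∈ Ioc N M, f n := by
  rw [← sum_Ioc_consecutive f (Nat.zero_le N) h]; ring

/-- Dirichlet's test, with a bound for the tail. -/
theorem exists_limit_sum_Ioc_mul {u g : ℕ → ℝ} {C : ℝ}
    (hu : ∀ N M, N ≤ M → |∑ n ∈ Ioc N M, u n| ≤ C)
    (hg : ∀ n, 0 < n → g (n + 1) ≤ g n) (hg0 : ∀ n, 0 < n → 0 ≤ g n)
    (hlim : Tendsto g atTop (nhds 0)) :
    ∃ l : ℝ, Tendsto (fun N => ∑ n ∈ Ioc 0 N, u n * g n) atTop (nhds l) ∧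
      ∀ N, |∑ n ∈ Ioc 0 N, u n * g n - l| ≤ C * g (N + 1) := by
  have hb : ∀ N M, N ≤ M → |∑ n ∈ Ioc N M, u n * g n| ≤ C * g (N + 1) := fun N M h =>
    abs_sum_Ioc_mul_le (hu N) (fun n hn => hg n (by omega)) (fun n hn => hg0 n (by omega)) M h
  have hlim' : Tendsto (fun N => C * g (N + 1)) atTop (nhds 0) := by
    simpa using (hlim.comp (tendsto_add_atTop_nat 1)).const_mul C
  have hc : CauchySeq (fun N => ∑ n ∈ Ioc 0 N, u n * g n) := by
    refine cauchySeq_of_le_tendsto_0' (fun N => C * g (N + 1)) (fun N M h => ?_) hlim'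
    rw [dist_comm, Real.dist_eq, sum_Ioc_sub_sum_Ioc _ h]
    exact hb N M h
  obtain ⟨l, hl⟩ := cauchySeq_tendsto_of_complete hc
  refine ⟨l, hl, fun N => ?_⟩
  rw [abs_sub_comm]
  refine le_of_tendsto ((hl.sub_const _).abs) ?_
  filter_upwards [eventually_ge_atTop N] with M hM
  rw [sum_Ioc_sub_sum_Ioc _ hM]
  exact hb N M hM

theorem sum_rpow_neg_le {β : ℝ} (h0 : 0 ≤ β) (h1 : β < 1) (y : ℕ) :
    ∑ d ∈ Ioc 0 y, (d : ℝ) ^ (-β) ≤ (y : ℝ) ^ (1 - β) / (1 - β) := by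
  have ht : 0 < 1 - β := by linarith
  induction y with
  | zero => simp [Real.zero_rpow ht.ne']
  | succ y ih =>
    rw [sum_Ioc_succ_top (Nat.zero_le y)]
    have hy : (0 : ℝ) < (y : ℝ) + 1 := by positivity
    have h2 := rpow_one_add_le_one_add_mul_self (s := -(1 / ((y : ℝ) + 1))) (p := 1 - β)
      (by rw [neg_le_neg_iff, div_le_one hy]; linarith [(Nat.cast_nonneg y : (0 : ℝ) ≤ y)])
      ht.le (by linarith)
    have h3 : (1 + -(1 / ((y : ℝ) + 1))) = y / (y + 1) := by field_simp; ring
    rw [h3, Real.div_rpow (by positivity) hy.le, div_le_iff₀ (by positivity)] at h2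
    have h4 : ((y : ℝ) + 1) ^ (1 - β) = (y + 1) * (y + 1 : ℝ) ^ (-β) := by
      rw [sub_eq_add_neg, Real.rpow_add hy, Real.rpow_one]
    have h5 : (1 + (1 - β) * -(1 / ((y : ℝ) + 1))) * ((y : ℝ) + 1) ^ (1 - β) =
        ((y : ℝ) + 1) ^ (1 - β) - (1 - β) * (y + 1 : ℝ) ^ (-β) := by
      rw [h4]; field_simp; ring
    rw [h5] at h2
    push_cast
    rw [le_div_iff₀ ht] at ih ⊢
    linarith

/-- `v` has mean value `c`, with a power saving error term. -/
def HasMeanWithSaving (v : ArithmeticFunction ℝ) (c : ℝ) : Prop :=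
  ∃ β C : ℝ, 0 ≤ β ∧ β < 1 ∧ 0 ≤ C ∧
    (∀ N : ℕ, 0 < N → |∑ n ∈ Ioc 0 N, v n - c * N| ≤ C * (N : ℝ) ^ β) ∧
    ∀ N : ℕ, ∑ n ∈ Ioc 0 N, |v n| ≤ C * (N : ℝ) ^ 2

theorem sum_abs_mul_le (χ v : ArithmeticFunction ℝ) (h1 : ∀ n, |χ n| ≤ 1) {C : ℝ}
    (hv : ∀ N : ℕ, ∑ n ∈ Ioc 0 N, |v n| ≤ C * (N : ℝ) ^ 2) (N : ℕ) :
    ∑ n ∈ Ioc 0 N, |(χ * v) n| ≤ 2 * C * (N : ℝ) ^ 2 := by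
  have hC : 0 ≤ C := by simpa using (sum_nonneg fun n _ => abs_nonneg (v n)).trans (hv 1)
  let a : ArithmeticFunction ℝ := ⟨fun n => |χ n|, by simp⟩
  let w : ArithmeticFunction ℝ := ⟨fun n => |v n|, by simp⟩
  calc ∑ n ∈ Ioc 0 N, |(χ * v) n| ≤ ∑ n ∈ Ioc 0 N, (a * w) n := by
        refine sum_le_sum fun n _ => ?_
        rw [ArithmeticFunction.mul_apply, ArithmeticFunction.mul_apply]
        refine (abs_sum_le_sum_abs _ _).trans (le_of_eq ?_)
        exact sum_congr rfl fun x _ => abs_mul _ _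
    _ = ∑ d ∈ Ioc 0 N, |χ d| * ∑ m ∈ Ioc 0 (N / d), |v m| :=
        ArithmeticFunction.sum_Ioc_mul_eq_sum_sum a w N
    _ ≤ ∑ d ∈ Ioc 0 N, C * (N : ℝ) ^ 2 * ((d : ℝ) ^ 2)⁻¹ := by
        refine sum_le_sum fun d hd => ?_
        calc |χ d| * ∑ m ∈ Ioc 0 (N / d), |v m| ≤ 1 * (C * ((N / d : ℕ) : ℝ) ^ 2) :=
              mul_le_mul (h1 d) (hv _) (sum_nonneg fun n _ => abs_nonneg _) zero_le_one
          _ ≤ 1 * (C * ((N : ℝ) / d) ^ 2) := by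
              gcongr
              exact Nat.cast_div_le
          _ = _ := by rw [div_pow]; ring
    _ = C * (N : ℝ) ^ 2 * ∑ d ∈ Ioo 0 (N + 1), ((d : ℝ) ^ 2)⁻¹ := by
        rw [← mul_sum]; rfl
    _ ≤ C * (N : ℝ) ^ 2 * 2 := by
        gcongr
        simpa using sum_Ioo_inv_sq_le (α := ℝ) 0 (N + 1)
    _ = _ := by ring

theorem sum_Ioc_mul_eq_add (χ v : ArithmeticFunction ℝ) {y N : ℕ} (hy : y ≤ N) :
    ∑ n ∈ Ioc 0 N, (χ * v) n = ∑ d ∈ Ioc 0 y, χ d * ∑ e ∈ Ioc 0 (N / d), v e +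
      ∑ e ∈ Ioc 0 (N / (y + 1)), v e * ∑ d ∈ Ioc y (N / e), χ d := by
  rw [ArithmeticFunction.sum_Ioc_mul_eq_sum_sum, ← sum_Ioc_consecutive _ (Nat.zero_le y) hy]
  congr 1
  simp_rw [mul_sum]
  rw [sum_comm' (t' := Ioc 0 (N / (y + 1))) (s' := fun e => Ioc y (N / e))]
  · exact sum_congr rfl fun _ _ => sum_congr rfl fun _ _ => mul_comm _ _
  · intro d e
    simp only [mem_Ioc]
    constructor
    · rintro ⟨⟨h1, h2⟩, h3, h4⟩
      rw [Nat.le_div_iff_mul_le (by omega)] at h4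
      refine ⟨⟨h1, ?_⟩, h3, ?_⟩
      · rw [Nat.le_div_iff_mul_le h3]; linarith [mul_comm d e]
      · rw [Nat.le_div_iff_mul_le (by omega)]; nlinarith
    · rintro ⟨⟨h1, h2⟩, h3, h4⟩
      rw [Nat.le_div_iff_mul_le h3] at h2
      refine ⟨⟨h1, by nlinarith⟩, h3, ?_⟩
      rw [Nat.le_div_iff_mul_le (by omega)]; linarith [mul_comm d e]

theorem HasMeanWithSaving.mul {χ v : ArithmeticFunction ℝ} {c l K : ℝ}
    (hv : HasMeanWithSaving v c) (h1 : ∀ n, |χ n| ≤ 1)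
    (hχ : ∀ N M, N ≤ M → |∑ n ∈ Ioc N M, χ n| ≤ K)
    (hl : ∀ N : ℕ, |∑ n ∈ Ioc 0 N, χ n * (n : ℝ)⁻¹ - l| ≤ K * ((N + 1 : ℕ) : ℝ)⁻¹) :
    HasMeanWithSaving (χ * v) (l * c) := by
  obtain ⟨β, C, h0, hβ, hC, hmean, habs⟩ := hv
  have hK : 0 ≤ K := (abs_nonneg _).trans (hχ 0 0 le_rfl)
  have hβ' : 0 < 1 - β := by linarith
  have hD : 0 ≤ 2 * |c| + |c| * K + C / (1 - β) + C * K := by positivity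
  refine ⟨3 / 4 + β / 4, 2 * C + (2 * |c| + |c| * K + C / (1 - β) + C * K), by linarith,
    by linarith, by positivity, fun N hN => ?_, fun N => ?_⟩
  swap
  · refine (sum_abs_mul_le χ v h1 habs N).trans ?_
    gcongr
    linarith
  have hN1 : (1 : ℝ) ≤ N := by exact_mod_cast hN
  have hN0 : (0 : ℝ) < N := by linarith
  set y : ℕ := ⌊(N : ℝ) ^ (3 / 4 : ℝ)⌋₊ with hy
  have hy1 : (y : ℝ) ≤ (N : ℝ) ^ (3 / 4 : ℝ) := Nat.floor_le (by positivity)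
  have hy2 : (N : ℝ) ^ (3 / 4 : ℝ) < y + 1 := Nat.lt_floor_add_one _
  have hyN : y ≤ N := by
    have : (N : ℝ) ^ (3 / 4 : ℝ) ≤ (N : ℝ) ^ (1 : ℝ) :=
      Real.rpow_le_rpow_of_exponent_le hN1 (by norm_num)
    rw [Real.rpow_one] at this
    exact_mod_cast hy1.trans this
  set B : ℝ := (N : ℝ) ^ (3 / 4 + β / 4) with hB
  have hexp : ∀ t : ℝ, t ≤ 3 / 4 → (N : ℝ) ^ t ≤ B := fun t ht =>
    Real.rpow_le_rpow_of_exponent_le hN1 (by linarith)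
  have hquot : (N : ℝ) / (y + 1) ≤ (N : ℝ) ^ (1 / 4 : ℝ) := by
    rw [div_le_iff₀ (by positivity)]
    calc (N : ℝ) = (N : ℝ) ^ (1 / 4 : ℝ) * (N : ℝ) ^ (3 / 4 : ℝ) := by
          rw [← Real.rpow_add hN0]; norm_num
      _ ≤ _ := by gcongr
  rw [sum_Ioc_mul_eq_add χ v hyN]
  have hfirst : |∑ d ∈ Ioc 0 y, χ d * ∑ e ∈ Ioc 0 (N / d), v e -
      c * N * ∑ d ∈ Ioc 0 y, χ d * (d : ℝ)⁻¹| ≤ |c| * B + C / (1 - β) * B := by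
    rw [mul_sum, ← sum_sub_distrib]
    calc |∑ d ∈ Ioc 0 y, (χ d * ∑ e ∈ Ioc 0 (N / d), v e - c * N * (χ d * (d : ℝ)⁻¹))|
        ≤ ∑ d ∈ Ioc 0 y, (|c| + C * (N : ℝ) ^ β * (d : ℝ) ^ (-β)) := by
          refine (abs_sum_le_sum_abs _ _).trans (sum_le_sum fun d hd => ?_)
          obtain ⟨hd0, hdy⟩ := mem_Ioc.mp hd
          have hd0' : (0 : ℝ) < d := by exact_mod_cast hd0
          have hNd : 0 < N / d := Nat.div_pos (hdy.trans hyN) hd0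
          have e1 := hmean (N / d) hNd
          have e2 : ((N / d : ℕ) : ℝ) ≤ N / d := Nat.cast_div_le
          have e3 : (N : ℝ) / d - 1 ≤ ((N / d : ℕ) : ℝ) := by
            have := Nat.lt_div_mul_add (a := N) hd0
            have : (N : ℝ) < ((N / d : ℕ) : ℝ) * d + d := by exact_mod_cast this
            rw [sub_le_iff_le_add, div_le_iff₀ hd0']
            linarith
          have e4 : |c * ((N / d : ℕ) : ℝ) - c * (N / d)| ≤ |c| := by
            rw [← mul_sub, abs_mul]
            refine mul_le_of_le_one_right (abs_nonneg c) ?_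
            rw [abs_le]; constructor <;> linarith
          have e5 : C * ((N / d : ℕ) : ℝ) ^ β ≤ C * (N : ℝ) ^ β * (d : ℝ) ^ (-β) := by
            rw [mul_assoc, Real.rpow_neg hd0'.le, ← div_eq_mul_inv,
              ← Real.div_rpow hN0.le hd0'.le]
            gcongr
          calc |χ d * ∑ e ∈ Ioc 0 (N / d), v e - c * N * (χ d * (d : ℝ)⁻¹)|
              = |χ d| * |∑ e ∈ Ioc 0 (N / d), v e - c * ((N / d : ℕ) : ℝ) +
                (c * ((N / d : ℕ) : ℝ) - c * (N / d))| := by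
                rw [← abs_mul]; congr 1; field_simp; ring
            _ ≤ 1 * |∑ e ∈ Ioc 0 (N / d), v e - c * ((N / d : ℕ) : ℝ) +
                (c * ((N / d : ℕ) : ℝ) - c * (N / d))| := by gcongr; exact h1 d
            _ ≤ _ := by
                rw [one_mul]
                refine (abs_add_le _ _).trans ?_
                linarith
      _ = |c| * y + C * (N : ℝ) ^ β * ∑ d ∈ Ioc 0 y, (d : ℝ) ^ (-β) := by
          rw [sum_add_distrib, ← mul_sum]; simp [mul_comm]
      _ ≤ |c| * B + C * (N : ℝ) ^ β * (((N : ℝ) ^ (3 / 4 : ℝ)) ^ (1 - β) / (1 - β)) := by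
          gcongr
          · exact hy1.trans (hexp _ le_rfl)
          · refine (sum_rpow_neg_le h0 hβ y).trans ?_
            gcongr
      _ = |c| * B + C / (1 - β) * B := by
          rw [← Real.rpow_mul hN0.le, hB,
            show (3 / 4 + β / 4 : ℝ) = β + 3 / 4 * (1 - β) by ring, Real.rpow_add hN0]
          ring
  have hmain : |c * N * ∑ d ∈ Ioc 0 y, χ d * (d : ℝ)⁻¹ - l * c * N| ≤ |c| * K * B := by
    calc _ = |c| * (N * |∑ d ∈ Ioc 0 y, χ d * (d : ℝ)⁻¹ - l|) := by
          rw [← abs_of_pos hN0, ← abs_mul, ← abs_mul, abs_of_pos hN0]; congr 1; ring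
      _ ≤ |c| * (N * (K * ((y + 1 : ℕ) : ℝ)⁻¹)) := by gcongr; exact hl y
      _ = |c| * K * (N / (y + 1)) := by push_cast; ring
      _ ≤ |c| * K * B := by
          gcongr
          exact hquot.trans (hexp _ (by norm_num))
  have hsecond : |∑ e ∈ Ioc 0 (N / (y + 1)), v e * ∑ d ∈ Ioc y (N / e), χ d| ≤ C * K * B := by
    calc _ ≤ ∑ e ∈ Ioc 0 (N / (y + 1)), |v e| * K := by
          refine (abs_sum_le_sum_abs _ _).trans (sum_le_sum fun e _ => ?_)
          rw [abs_mul]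
          refine mul_le_mul_of_nonneg_left ?_ (abs_nonneg _)
          rcases le_total y (N / e) with h | h
          · exact hχ _ _ h
          · rw [Ioc_eq_empty_of_le h]; simpa using hK
      _ ≤ C * ((N / (y + 1) : ℕ) : ℝ) ^ 2 * K := by
          rw [← sum_mul]; gcongr; exact habs _
      _ ≤ C * ((N : ℝ) ^ (1 / 4 : ℝ)) ^ 2 * K := by
          gcongr
          refine le_trans ?_ hquot
          exact_mod_cast (Nat.cast_div_le (α := ℝ) (m := N) (n := y + 1))
      _ ≤ C * B * K := by
          gcongr
          rw [← Real.rpow_natCast, ← Real.rpow_mul hN0.le]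
          exact hexp _ (by norm_num)
      _ = _ := by ring
  set S1 := ∑ d ∈ Ioc 0 y, χ d * ∑ e ∈ Ioc 0 (N / d), v e
  set S2 := ∑ e ∈ Ioc 0 (N / (y + 1)), v e * ∑ d ∈ Ioc y (N / e), χ d
  set S3 := c * N * ∑ d ∈ Ioc 0 y, χ d * (d : ℝ)⁻¹
  have hB0 : 0 ≤ B := by positivity
  calc |S1 + S2 - l * c * N| = |(S1 - S3) + (S3 - l * c * N) + S2| := by congr 1; ring
    _ ≤ |S1 - S3| + |S3 - l * c * N| + |S2| := abs_add_three _ _ _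
    _ ≤ (|c| * B + C / (1 - β) * B) + |c| * K * B + C * K * B := by gcongr
    _ ≤ _ := by nlinarith [mul_nonneg hC hB0, mul_nonneg (abs_nonneg c) hB0]

end

section

open Finset

theorem HasMeanWithSaving.tendsto {v : ArithmeticFunction ℝ} {c : ℝ}
    (hv : HasMeanWithSaving v c) :
    Tendsto (fun N : ℕ => (∑ n ∈ Ioc 0 N, v n) / N) atTop (nhds c) := by
  obtain ⟨β, C, h0, hβ, hC, hmean, -⟩ := hv
  have hlim : Tendsto (fun N : ℕ => C * (N : ℝ) ^ (-(1 - β))) atTop (nhds 0) := by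
    simpa using ((tendsto_rpow_neg_atTop (by linarith : 0 < 1 - β)).comp
      tendsto_natCast_atTop_atTop).const_mul C
  rw [tendsto_iff_dist_tendsto_zero]
  refine squeeze_zero' (Eventually.of_forall fun _ => dist_nonneg) ?_ hlim
  filter_upwards [eventually_gt_atTop 0] with N hN
  have hN0 : (0 : ℝ) < N := by exact_mod_cast hN
  rw [Real.dist_eq, div_sub' hN0.ne', abs_div, abs_of_pos hN0, div_le_iff₀ hN0,
    mul_comm (N : ℝ) c]
  refine (hmean N hN).trans (le_of_eq ?_)
  rw [mul_assoc, ← Real.rpow_add_one hN0.ne']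
  congr 2; ring

/-- The mean value of a convolution with a function of small support. -/
theorem tendsto_mean_mul {h v : ArithmeticFunction ℝ} {c : ℝ}
    (hv : Tendsto (fun N : ℕ => (∑ n ∈ Ioc 0 N, v n) / N) atTop (nhds c))
    (hh : Summable fun d : ℕ => |h d| / d) :
    Tendsto (fun N : ℕ => (∑ n ∈ Ioc 0 N, (h * v) n) / N) atTop
      (nhds (c * ∑' d : ℕ, h d / d)) := by
  obtain ⟨B, hB⟩ : ∃ B : ℝ, ∀ N : ℕ, |(∑ n ∈ Ioc 0 N, v n) / N| ≤ B := by
    obtain ⟨B, hB⟩ := hv.abs.bddAbove_range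
    exact ⟨B, fun N => hB ⟨N, rfl⟩⟩
  have hB' : ∀ N : ℕ, |∑ n ∈ Ioc 0 N, v n| ≤ B * N := fun N => by
    rcases N.eq_zero_or_pos with rfl | hN
    · simp
    · have hN0 : (0 : ℝ) < N := by exact_mod_cast hN
      have := hB N
      rwa [abs_div, abs_of_pos hN0, div_le_iff₀ hN0] at this
  have hB0 : 0 ≤ B := (abs_nonneg _).trans (hB 0)
  have hsum : ∀ N : ℕ, (∑ n ∈ Ioc 0 N, (h * v) n) / N =
      ∑' d : ℕ, h d * (∑ n ∈ Ioc 0 (N / d), v n) / N := by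
    intro N
    rw [ArithmeticFunction.sum_Ioc_mul_eq_sum_sum, sum_div, tsum_eq_sum]
    intro d hd
    rcases d.eq_zero_or_pos with rfl | hd0
    · simp
    · have : N < d := by simpa [hd0] using hd
      simp [Nat.div_eq_of_lt this]
  simp_rw [hsum, ← tsum_mul_left]
  refine tendsto_tsum_of_dominated_convergence (bound := fun d : ℕ => B * (|h d| / d))
    (hh.mul_left B) (fun d => ?_) ?_
  · rcases d.eq_zero_or_pos with rfl | hd0
    · simp
    have hd0' : (0 : ℝ) < d := by exact_mod_cast hd0
    have h1 : Tendsto (fun N : ℕ => N / d) atTop atTop := Nat.tendsto_div_const_atTop hd0.ne'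
    have h2 : Tendsto (fun N : ℕ => ((N / d : ℕ) : ℝ) / N) atTop (nhds (1 / d)) := by
      have := (tendsto_nat_floor_mul_div_atTop (R := ℝ) (a := 1 / d) (by positivity)).comp
        tendsto_natCast_atTop_atTop
      refine this.congr fun N => ?_
      simp only [Function.comp]
      congr 2
      rw [one_div, inv_mul_eq_div, Nat.floor_div_natCast, Nat.floor_natCast]
    have h3 := ((hv.comp h1).mul h2).const_mul (h d)
    refine (h3.congr fun N => ?_).trans (le_of_eq ?_)
    · simp only [Function.comp]
      rcases (N / d).eq_zero_or_pos with h0 | h0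
      · simp [h0]
      · have : ((N / d : ℕ) : ℝ) ≠ 0 := by exact_mod_cast h0.ne'
        field_simp
    · congr 1; ring
  · filter_upwards [eventually_gt_atTop 0] with N hN d
    have hN0 : (0 : ℝ) < N := by exact_mod_cast hN
    rw [Real.norm_eq_abs, abs_div, abs_mul, abs_of_pos hN0, div_le_iff₀ hN0]
    calc |h d| * |∑ n ∈ Ioc 0 (N / d), v n| ≤ |h d| * (B * (N / d)) := by
          gcongr
          refine (hB' _).trans ?_
          gcongr
          exact Nat.cast_div_le
      _ = _ := by ring

theorem abs_oddSqMoebius_le (n : ℕ) : |(oddSqMoebius n : ℝ)| ≤ 1 := by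
  rw [oddSqMoebius_apply]
  split_ifs
  · exact_mod_cast ArithmeticFunction.abs_moebius_le_one
  · simp

theorem summable_oddSqMoebius : Summable fun d : ℕ => |(oddSqMoebius d : ℝ)| / d := by
  have hinj : Function.Injective fun n : ℕ => n ^ 2 := Nat.pow_left_injective two_ne_zero
  rw [← hinj.summable_iff]
  · refine Summable.of_nonneg_of_le (fun n => div_nonneg (abs_nonneg _) (Nat.cast_nonneg _))
      (fun n => ?_)
      (Real.summable_nat_pow_inv (p := 2) |>.mpr one_lt_two)
    simp only [Function.comp, Nat.cast_pow]
    rw [div_eq_mul_inv]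
    exact mul_le_of_le_one_left (by positivity) (abs_oddSqMoebius_le _)
  · intro n hn
    rw [oddSqMoebius_apply, if_neg]
    · simp
    · rintro ⟨-, a, rfl⟩
      exact hn ⟨a, sq a⟩

theorem tsum_oddSqMoebius_prime_pow {p : ℕ} (hp : p.Prime) :
    ∑' e : ℕ, (oddSqMoebius (p ^ e) : ℝ) / (p ^ e : ℕ) =
      if p = 2 then 1 else 1 - ((p : ℝ) ^ 2)⁻¹ := by
  split_ifs with h2
  · subst h2
    rw [tsum_eq_single 0]
    · simp [oddSqMoebius_apply]
    · intro e he
      rw [oddSqMoebius_apply, if_neg]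
      · simp
      · rintro ⟨h, -⟩
        exact Nat.not_odd_iff_even.mpr (Nat.even_pow.mpr ⟨even_two, he⟩) h
  · have hval : ∀ e, oddSqMoebius (p ^ e) =
        (if e = 0 then 1 else 0) - (if e = 2 then 1 else 0) := fun e => by
      have := congrArg (PowerSeries.coeff e) (localSeries_oddSqMoebius hp h2)
      simpa [localSeries, PowerSeries.coeff_one, PowerSeries.coeff_X_pow] using this
    rw [tsum_eq_sum (s := range 3)]
    · simp [sum_range_succ, hval]; ring
    · intro e he
      rw [mem_range] at he
      rw [hval, if_neg (by omega), if_neg (by omega)]; simp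

theorem tendsto_prod_oddSqMoebius :
    Tendsto (fun n : ℕ => ∏ p ∈ n.primesBelow, if p = 2 then (1 : ℝ) else 1 - ((p : ℝ) ^ 2)⁻¹)
      atTop (nhds (∑' d : ℕ, (oddSqMoebius d : ℝ) / d)) := by
  have := EulerProduct.eulerProduct (f := fun d : ℕ => (oddSqMoebius d : ℝ) / d)
    (by simp [oddSqMoebius_apply]) (fun {m n} hmn => by
      rw [isMultiplicative_oddSqMoebius.map_mul_of_coprime hmn]; push_cast; ring)
    (by simpa [abs_div] using summable_oddSqMoebius) (by simp)
  refine this.congr fun n => prod_congr rfl fun p hp => ?_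
  exact tsum_oddSqMoebius_prime_pow (Nat.prime_of_mem_primesBelow hp)

theorem tsum_oddSqMoebius_pos : 0 < ∑' d : ℕ, (oddSqMoebius d : ℝ) / d := by
  have hstep : ∀ n : ℕ, 2 ≤ n → (n : ℝ) / (2 * (n - 1)) ≤
      ∏ p ∈ n.primesBelow, if p = 2 then (1 : ℝ) else 1 - ((p : ℝ) ^ 2)⁻¹ := by
    intro n hn
    induction n, hn using Nat.le_induction with
    | base =>
      have : Nat.primesBelow 2 = ∅ := by decide
      rw [this]; norm_num
    | succ n hn ih =>
      have hn' : (2 : ℝ) ≤ n := by exact_mod_cast hn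
      have h1 : (0 : ℝ) < n - 1 := by linarith
      have hpos : 0 ≤ (n : ℝ) / (2 * (n - 1)) := by positivity
      rw [Nat.primesBelow_succ]
      have hle : 1 - ((n : ℝ) ^ 2)⁻¹ ≤ 1 := by simp
      have hge : 0 ≤ 1 - ((n : ℝ) ^ 2)⁻¹ := by
        rw [sub_nonneg, inv_le_one₀ (by positivity)]
        nlinarith
      have hcalc : ((n + 1 : ℕ) : ℝ) / (2 * ((n + 1 : ℕ) - 1)) =
          (1 - ((n : ℝ) ^ 2)⁻¹) * ((n : ℝ) / (2 * (n - 1))) := by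
        have h2 : (n : ℝ) ≠ 0 := by positivity
        have h3 := h1.ne'
        push_cast; rw [add_sub_cancel_right]; field_simp; ring
      rw [hcalc]
      split_ifs with hp
      · rw [prod_insert (by simp [Nat.primesBelow])]
        refine mul_le_mul ?_ ih hpos ?_
        · split_ifs <;> simp
        · split_ifs <;> first | exact zero_le_one | exact hge
      · exact (mul_le_of_le_one_left hpos hle).trans ih
  have : (1 / 2 : ℝ) ≤ ∑' d : ℕ, (oddSqMoebius d : ℝ) / d := by
    refine ge_of_tendsto tendsto_prod_oddSqMoebius ?_
    filter_upwards [eventually_ge_atTop 2] with n hn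
    refine le_trans ?_ (hstep n hn)
    have hn' : (2 : ℝ) ≤ n := by exact_mod_cast hn
    rw [div_le_div_iff₀ (by norm_num) (by linarith)]
    linarith
  linarith

end

section

open Finset

/-- A completely multiplicative bounded function with bounded partial sums, such that
`∑ χ n / n = l > 0`. -/
structure IsOscillatingChar (χ : ArithmeticFunction ℝ) (K l : ℝ) : Prop where
  map_one : χ 1 = 1
  map_mul : ∀ m n, χ (m * n) = χ m * χ n
  abs_le_one : ∀ n, |χ n| ≤ 1
  abs_sum_le : ∀ N M, N ≤ M → |∑ n ∈ Ioc N M, χ n| ≤ K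
  abs_sum_inv_sub_le : ∀ N : ℕ,
    |∑ n ∈ Ioc 0 N, χ n * (n : ℝ)⁻¹ - l| ≤ K * ((N + 1 : ℕ) : ℝ)⁻¹
  pos : 0 < l

theorem sum_Ioc_add_eight (u : ℕ → ℝ) (a : ℕ) :
    ∑ n ∈ Ioc a (a + 8), u n = u (a + 1) + u (a + 2) + u (a + 3) + u (a + 4) + u (a + 5) +
      u (a + 6) + u (a + 7) + u (a + 8) := by
  rw [sum_Ioc_succ_top (by omega : a ≤ a + 7), sum_Ioc_succ_top (by omega : a ≤ a + 6),
    sum_Ioc_succ_top (by omega : a ≤ a + 5), sum_Ioc_succ_top (by omega : a ≤ a + 4),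
    sum_Ioc_succ_top (by omega : a ≤ a + 3), sum_Ioc_succ_top (by omega : a ≤ a + 2),
    sum_Ioc_succ_top (by omega : a ≤ a + 1), sum_Ioc_succ_top le_rfl, Ioc_self, sum_empty,
    zero_add]

/-- The real-valued arithmetic function attached to a character modulo `8`. -/
def realModEight (χ : MulChar (ZMod 8) ℤ) : ArithmeticFunction ℝ := (modEightFun χ)

theorem realModEight_apply (χ : MulChar (ZMod 8) ℤ) (n : ℕ) :
    realModEight χ n = ((χ n : ℤ) : ℝ) := rfl

theorem realModEight_add (χ : MulChar (ZMod 8) ℤ) (q r : ℕ) :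
    realModEight χ (8 * q + r) = ((χ r : ℤ) : ℝ) := by
  have : ((8 * q + r : ℕ) : ZMod 8) = r := by
    push_cast
    rw [show (8 : ZMod 8) = 0 from rfl, zero_mul, zero_add]
  rw [realModEight_apply, this]

theorem abs_sum_Ioc_le_of_period {u : ℕ → ℝ} (h1 : ∀ n, |u n| ≤ 1)
    (h0 : ∀ q, ∑ n ∈ Ioc (8 * q) (8 * q + 8), u n = 0) {N M : ℕ} (hNM : N ≤ M) :
    |∑ n ∈ Ioc N M, u n| ≤ 16 := by
  have hz : ∀ q, ∑ n ∈ Ioc 0 (8 * q), u n = 0 := fun q => by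
    induction q with
    | zero => simp
    | succ q ih =>
      rw [← sum_Ioc_consecutive u (Nat.zero_le (8 * q)) (by omega : 8 * q ≤ 8 * (q + 1)), ih]
      simpa [mul_add] using h0 q
  have hb : ∀ N, |∑ n ∈ Ioc 0 N, u n| ≤ 8 := fun N => by
    rw [← sum_Ioc_consecutive u (Nat.zero_le (8 * (N / 8))) (by omega : 8 * (N / 8) ≤ N), hz,
      zero_add]
    refine (abs_sum_le_sum_abs _ _).trans ((sum_le_sum fun n _ => h1 n).trans ?_)
    have : N - 8 * (N / 8) ≤ 8 := by omega
    simpa using (by exact_mod_cast this : ((N - 8 * (N / 8) : ℕ) : ℝ) ≤ 8)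
  rw [← sum_Ioc_sub_sum_Ioc u hNM]
  exact (abs_sub _ _).trans (by linarith [hb N, hb M])

theorem isOscillatingChar_realModEight {χ : MulChar (ZMod 8) ℤ} (h1 : ∀ a, |χ a| ≤ 1)
    (h0 : χ 1 + χ 2 + χ 3 + χ 4 + χ 5 + χ 6 + χ 7 + χ 8 = 0)
    (hpos : ∀ q : ℕ, 0 < ∑ n ∈ Ioc (8 * q) (8 * q + 8), realModEight χ n * (n : ℝ)⁻¹) :
    ∃ l, IsOscillatingChar (realModEight χ) 16 l := by
  have habs : ∀ n, |realModEight χ n| ≤ 1 := fun n => by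
    rw [realModEight_apply]; exact_mod_cast h1 n
  have hsum : ∀ N M, N ≤ M → |∑ n ∈ Ioc N M, realModEight χ n| ≤ 16 := fun N M h =>
    abs_sum_Ioc_le_of_period habs (fun q => by
      rw [sum_Ioc_add_eight]
      simp only [realModEight_add]
      exact_mod_cast h0) h
  obtain ⟨l, hl, hb⟩ := exists_limit_sum_Ioc_mul (g := fun n => (n : ℝ)⁻¹) hsum
    (fun n hn => by
      have : (0 : ℝ) < n := by exact_mod_cast hn
      gcongr; simp) (fun n _ => by positivity) tendsto_inv_atTop_nhds_zero_nat
  refine ⟨l, by simp [realModEight_apply], fun m n => by simp [realModEight_apply], habs, hsum,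
    hb, ?_⟩
  have hmono : StrictMono fun q : ℕ => ∑ n ∈ Ioc 0 (8 * q), realModEight χ n * (n : ℝ)⁻¹ := by
    refine strictMono_nat_of_lt_succ fun q => ?_
    rw [← sub_pos, sum_Ioc_sub_sum_Ioc _ (by omega : 8 * q ≤ 8 * (q + 1))]
    exact hpos q
  have hl' := hl.comp (tendsto_id.const_mul_atTop' (by norm_num : 0 < 8))
  have h01 := hmono (zero_lt_one)
  have := hmono.monotone.ge_of_tendsto hl' 1
  simp only [mul_zero, Ioc_self, sum_empty] at h01
  exact h01.trans_le this

theorem exists_isOscillatingChar_eight : ∃ l, IsOscillatingChar (realModEight ZMod.χ₈) 16 l := by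
  refine isOscillatingChar_realModEight (by decide) (by decide) fun q => ?_
  rw [sum_Ioc_add_eight]
  simp only [realModEight_add]
  have e : ZMod.χ₈ (1 : ℕ) = 1 ∧ ZMod.χ₈ (2 : ℕ) = 0 ∧ ZMod.χ₈ (3 : ℕ) = -1 ∧
    ZMod.χ₈ (4 : ℕ) = 0 ∧ ZMod.χ₈ (5 : ℕ) = -1 ∧ ZMod.χ₈ (6 : ℕ) = 0 ∧ ZMod.χ₈ (7 : ℕ) = 1 ∧
    ZMod.χ₈ (8 : ℕ) = 0 := by decide
  obtain ⟨e1, e2, e3, e4, e5, e6, e7, e8⟩ := e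
  rw [e1, e2, e3, e4, e5, e6, e7, e8]
  push_cast
  have h : (0 : ℝ) ≤ q := Nat.cast_nonneg q
  have : (1 : ℝ) * (8 * q + 1 : ℝ)⁻¹ + 0 * (8 * q + 2 : ℝ)⁻¹ + -1 * (8 * q + 3 : ℝ)⁻¹ +
      0 * (8 * q + 4 : ℝ)⁻¹ + -1 * (8 * q + 5 : ℝ)⁻¹ + 0 * (8 * q + 6 : ℝ)⁻¹ +
      1 * (8 * q + 7 : ℝ)⁻¹ + 0 * (8 * q + 8 : ℝ)⁻¹ =
      (64 * q + 32) * 2 / ((8 * q + 1) * (8 * q + 3) * (8 * q + 5) * (8 * q + 7)) := by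
    field_simp; ring
  rw [this]
  positivity

theorem inv_sub_inv_pos {a b : ℝ} (ha : 0 < a) (hab : a < b) : 0 < a⁻¹ - b⁻¹ :=
  sub_pos.mpr (inv_strictAnti₀ ha hab)

theorem exists_isOscillatingChar_eight' :
    ∃ l, IsOscillatingChar (realModEight ZMod.χ₈') 16 l := by
  refine isOscillatingChar_realModEight (by decide) (by decide) fun q => ?_
  rw [sum_Ioc_add_eight]
  simp only [realModEight_add]
  have e : ZMod.χ₈' (1 : ℕ) = 1 ∧ ZMod.χ₈' (2 : ℕ) = 0 ∧ ZMod.χ₈' (3 : ℕ) = 1 ∧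
    ZMod.χ₈' (4 : ℕ) = 0 ∧ ZMod.χ₈' (5 : ℕ) = -1 ∧ ZMod.χ₈' (6 : ℕ) = 0 ∧ ZMod.χ₈' (7 : ℕ) = -1 ∧
    ZMod.χ₈' (8 : ℕ) = 0 := by decide
  obtain ⟨e1, e2, e3, e4, e5, e6, e7, e8⟩ := e
  rw [e1, e2, e3, e4, e5, e6, e7, e8]
  push_cast
  have h : (0 : ℝ) ≤ q := Nat.cast_nonneg q
  linarith [inv_sub_inv_pos (a := 8 * (q : ℝ) + 1) (b := 8 * q + 5) (by positivity) (by linarith),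
    inv_sub_inv_pos (a := 8 * (q : ℝ) + 3) (b := 8 * q + 7) (by positivity) (by linarith)]

theorem exists_isOscillatingChar_eight_mul :
    ∃ l, IsOscillatingChar (realModEight (ZMod.χ₈ * ZMod.χ₈')) 16 l := by
  refine isOscillatingChar_realModEight (by simp only [MulChar.mul_apply]; decide)
    (by simp only [MulChar.mul_apply]; decide) fun q => ?_
  rw [sum_Ioc_add_eight]
  simp only [realModEight_add]
  have e : (ZMod.χ₈ * ZMod.χ₈') (1 : ℕ) = 1 ∧ (ZMod.χ₈ * ZMod.χ₈') (2 : ℕ) = 0 ∧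
    (ZMod.χ₈ * ZMod.χ₈') (3 : ℕ) = -1 ∧ (ZMod.χ₈ * ZMod.χ₈') (4 : ℕ) = 0 ∧
    (ZMod.χ₈ * ZMod.χ₈') (5 : ℕ) = 1 ∧ (ZMod.χ₈ * ZMod.χ₈') (6 : ℕ) = 0 ∧
    (ZMod.χ₈ * ZMod.χ₈') (7 : ℕ) = -1 ∧ (ZMod.χ₈ * ZMod.χ₈') (8 : ℕ) = 0 := by
    simp only [MulChar.mul_apply]; decide
  obtain ⟨e1, e2, e3, e4, e5, e6, e7, e8⟩ := e
  rw [e1, e2, e3, e4, e5, e6, e7, e8]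
  push_cast
  have h : (0 : ℝ) ≤ q := Nat.cast_nonneg q
  linarith [inv_sub_inv_pos (a := 8 * (q : ℝ) + 1) (b := 8 * q + 3) (by positivity) (by linarith),
    inv_sub_inv_pos (a := 8 * (q : ℝ) + 5) (b := 8 * q + 7) (by positivity) (by linarith)]

theorem realModEight_one_apply (n : ℕ) : realModEight 1 n = if n % 2 = 1 then 1 else 0 := by
  rw [realModEight_apply]
  split_ifs with h
  · rw [(mulChar_values_of_odd h).1, Int.cast_one]
  · rw [MulChar.map_nonunit, Int.cast_zero]
    rw [ZMod.isUnit_iff_coprime]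
    intro hc
    have : Nat.Coprime n 2 := Nat.Coprime.coprime_dvd_right (by norm_num) hc
    rw [Nat.coprime_two_right, Nat.odd_iff] at this
    exact h this

theorem hasMeanWithSaving_realModEight_one : HasMeanWithSaving (realModEight 1) (1 / 2) := by
  refine ⟨0, 1, le_rfl, one_pos, zero_le_one, fun N hN => ?_, fun N => ?_⟩
  · have : ∑ n ∈ Ioc 0 N, realModEight 1 n = ((N + 1) / 2 : ℕ) := by
      clear hN
      induction N with
      | zero => simp
      | succ N ih =>
        rw [sum_Ioc_succ_top (Nat.zero_le N), ih, realModEight_one_apply]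
        split_ifs with h
        · rw [show (N + 1 + 1) / 2 = (N + 1) / 2 + 1 by omega]; push_cast; ring
        · rw [show (N + 1 + 1) / 2 = (N + 1) / 2 by omega, add_zero]
    rw [this, Real.rpow_zero, mul_one, abs_le]
    have h1 : (((N + 1) / 2 : ℕ) : ℝ) * 2 ≤ N + 1 := by
      exact_mod_cast Nat.div_mul_le_self (N + 1) 2
    have h2 : (N : ℝ) ≤ (((N + 1) / 2 : ℕ) : ℝ) * 2 := by
      exact_mod_cast (by omega : N ≤ (N + 1) / 2 * 2)
    constructor <;> linarith
  · calc ∑ n ∈ Ioc 0 N, |realModEight 1 n| ≤ ∑ n ∈ Ioc 0 N, (1 : ℝ) := by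
          refine sum_le_sum fun n _ => ?_
          rw [realModEight_one_apply]; split_ifs <;> simp
      _ = N := by simp
      _ ≤ 1 * (N : ℝ) ^ 2 := by
          rw [one_mul]
          exact_mod_cast Nat.le_self_pow two_ne_zero N

theorem tendsto_mean_sqCoeff {l₁ l₂ l₃ : ℝ} (h1 : IsOscillatingChar (realModEight ZMod.χ₈) 16 l₁)
    (h2 : IsOscillatingChar (realModEight ZMod.χ₈') 16 l₂)
    (h3 : IsOscillatingChar (realModEight (ZMod.χ₈ * ZMod.χ₈')) 16 l₃) :
    Tendsto (fun N : ℕ => (∑ n ∈ Ioc 0 N, (sqCoeff n : ℝ)) / N) atTop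
      (nhds (l₃ * (l₂ * (l₁ * (1 / 2))) * ∑' d : ℕ, (oddSqMoebius d : ℝ) / d)) := by
  have hm := ((hasMeanWithSaving_realModEight_one.mul h1.abs_le_one h1.abs_sum_le
    h1.abs_sum_inv_sub_le).mul h2.abs_le_one h2.abs_sum_le h2.abs_sum_inv_sub_le).mul
    h3.abs_le_one h3.abs_sum_le h3.abs_sum_inv_sub_le
  have ht := tendsto_mean_mul (h := (oddSqMoebius : ArithmeticFunction ℝ)) hm.tendsto
    summable_oddSqMoebius
  refine ht.congr fun N => ?_
  congr 1
  refine sum_congr rfl fun n _ => ?_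
  have : (oddSqMoebius : ArithmeticFunction ℝ) * (realModEight (ZMod.χ₈ * ZMod.χ₈') *
      (realModEight ZMod.χ₈' * (realModEight ZMod.χ₈ * realModEight 1))) =
      ((sqCoeff : ArithmeticFunction ℤ) : ArithmeticFunction ℝ) := by
    simp only [realModEight, sqCoeff, modEightConv, ArithmeticFunction.intCoe_mul]
    ring
  rw [this]
  rfl

end

section

open Finset

namespace IsOscillatingChar

variable {χ : ArithmeticFunction ℝ} {K l : ℝ}

theorem bound_nonneg (h : IsOscillatingChar χ K l) : 0 ≤ K := by
  simpa using h.abs_sum_le 0 0 le_rfl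

theorem exists_abs_sum_log_div_le (h : IsOscillatingChar χ K l) :
    ∃ C, ∀ M, |∑ n ∈ Ioc 0 M, χ n * (Real.log n / n)| ≤ C := by
  have hK := h.bound_nonneg
  refine ⟨|χ 2 * (Real.log 2 / 2)| + K * (Real.log (2 + 1 : ℕ) / (2 + 1 : ℕ)), fun M => ?_⟩
  have h3 : 0 ≤ K * (Real.log (2 + 1 : ℕ) / (2 + 1 : ℕ)) := by positivity
  rcases Nat.lt_or_ge M 2 with hM | hM
  · interval_cases M
    · simp only [Ioc_self, sum_empty, abs_zero]; positivity
    · rw [sum_Ioc_succ_top le_rfl, Ioc_self, sum_empty]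
      simp only [zero_add, Nat.cast_one, Real.log_one, zero_div, mul_zero, abs_zero]
      positivity
  · rw [← sum_Ioc_consecutive _ (Nat.zero_le 2) hM, sum_Ioc_succ_top (Nat.zero_le 1),
      sum_Ioc_succ_top le_rfl, Ioc_self, sum_empty]
    simp only [zero_add, Nat.cast_one, Real.log_one, zero_div, mul_zero, Nat.reduceAdd,
      Nat.cast_ofNat]
    refine (abs_add_le _ _).trans (add_le_add_right ?_ _)
    have := abs_sum_Ioc_mul_le (u := χ) (g := fun n : ℕ => Real.log n / n) (N := 2) (C := K)
      (fun M hM => h.abs_sum_le 2 M hM) (fun n hn => ?_) (fun n _ => by positivity) M hM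
    · simpa using this
    · have hn' : Real.exp 1 ≤ n := by
        have : (3 : ℝ) ≤ n := by exact_mod_cast hn
        linarith [Real.exp_one_lt_d9]
      exact Real.log_div_self_antitoneOn hn' (by simp; linarith) (by simp)

theorem exists_abs_sum_vonMangoldt_div_le (h : IsOscillatingChar χ K l) :
    ∃ C, ∀ M, |∑ n ∈ Ioc 0 M, χ n * ArithmeticFunction.vonMangoldt n / n| ≤ C := by
  obtain ⟨C, hC⟩ := h.exists_abs_sum_log_div_le
  have hK := h.bound_nonneg
  refine ⟨(C + K * (Real.log 4 + 4)) / l, fun N => ?_⟩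
  let a : ArithmeticFunction ℝ := ⟨fun n => χ n * ArithmeticFunction.vonMangoldt n / n, by simp⟩
  let w : ArithmeticFunction ℝ := ⟨fun n => χ n * (n : ℝ)⁻¹, by simp⟩
  have hconv : ∀ n, (a * w) n = χ n * (Real.log n / n) := fun n => by
    rw [ArithmeticFunction.mul_apply, ← ArithmeticFunction.vonMangoldt_sum,
      ← Nat.sum_divisorsAntidiagonal (fun i _ => ArithmeticFunction.vonMangoldt i), sum_div,
      mul_sum]
    refine sum_congr rfl fun x hx => ?_
    obtain ⟨hx1, hx0⟩ := Nat.mem_divisorsAntidiagonal.mp hx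
    rw [← hx1, h.map_mul]
    simp only [a, w, ArithmeticFunction.coe_mk]
    push_cast
    rw [div_eq_mul_inv, div_eq_mul_inv, mul_inv]
    ring
  have hs := ArithmeticFunction.sum_Ioc_mul_eq_sum_sum a w N
  simp only [hconv] at hs
  have hdiff : |∑ n ∈ Ioc 0 N, χ n * (Real.log n / n) - (∑ n ∈ Ioc 0 N, a n) * l| ≤
      K * (Real.log 4 + 4) := by
    rcases Nat.eq_zero_or_pos N with rfl | hN
    · simp; positivity
    have hN' : (0 : ℝ) < N := by exact_mod_cast hN
    rw [hs, sum_mul, ← sum_sub_distrib]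
    calc |∑ n ∈ Ioc 0 N, (a n * ∑ m ∈ Ioc 0 (N / n), w m - a n * l)|
        ≤ ∑ n ∈ Ioc 0 N, K * ArithmeticFunction.vonMangoldt n / N := by
          refine (abs_sum_le_sum_abs _ _).trans (sum_le_sum fun n hn => ?_)
          have hn0 : 0 < n := (mem_Ioc.mp hn).1
          have hn' : (0 : ℝ) < n := by exact_mod_cast hn0
          rw [← mul_sub, abs_mul]
          have h1 : |a n| ≤ ArithmeticFunction.vonMangoldt n / n := by
            simp only [a, ArithmeticFunction.coe_mk]
            rw [abs_div, abs_mul, abs_of_pos hn',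
              abs_of_nonneg ArithmeticFunction.vonMangoldt_nonneg]
            gcongr
            exact mul_le_of_le_one_left ArithmeticFunction.vonMangoldt_nonneg (h.abs_le_one n)
          have h2 : |∑ m ∈ Ioc 0 (N / n), w m - l| ≤ K * (n / N) := by
            refine (h.abs_sum_inv_sub_le (N / n)).trans ?_
            gcongr
            rw [inv_le_comm₀ (by positivity) (by positivity), inv_div, div_le_iff₀ hn']
            have := Nat.lt_mul_div_succ N hn0
            rw [mul_comm]
            exact_mod_cast this.le
          calc |a n| * |∑ m ∈ Ioc 0 (N / n), w m - l|
              ≤ (ArithmeticFunction.vonMangoldt n / n) * (K * (n / N)) := by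
                gcongr
            _ = K * ArithmeticFunction.vonMangoldt n / N := by field_simp
      _ = K * (Chebyshev.psi N / N) := by
          rw [Chebyshev.psi, Nat.floor_natCast, sum_div, mul_sum]
          exact sum_congr rfl fun n _ => by ring
      _ ≤ K * (Real.log 4 + 4) := by
          gcongr
          rw [div_le_iff₀ hN']
          exact Chebyshev.psi_le_const_mul_self hN'.le
  rw [le_div_iff₀ h.pos, ← abs_of_pos h.pos, ← abs_mul]
  change |(∑ n ∈ Ioc 0 N, a n) * l| ≤ _
  have := abs_sub_abs_le_abs_sub ((∑ n ∈ Ioc 0 N, a n) * l)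
    (∑ n ∈ Ioc 0 N, χ n * (Real.log n / n))
  rw [abs_sub_comm] at this
  linarith [hC N]

theorem exists_abs_sum_prime_log_div_le (h : IsOscillatingChar χ K l) :
    ∃ C, ∀ M, |∑ n ∈ Ioc 0 M, if n.Prime then χ n * Real.log n / n else 0| ≤ C := by
  obtain ⟨C, hC⟩ := h.exists_abs_sum_vonMangoldt_div_le
  have hsum := ArithmeticFunction.vonMangoldt.summable_residueClass_non_primes_div (0 : ZMod 1)
  set r : ℕ → ℝ := fun n : ℕ => (if n.Prime then 0 else
    ArithmeticFunction.vonMangoldt.residueClass (0 : ZMod 1) n) / n with hr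
  have hr0 : ∀ n, r n = if n.Prime then 0 else ArithmeticFunction.vonMangoldt n / n := fun n => by
    have : ArithmeticFunction.vonMangoldt.residueClass (0 : ZMod 1) n =
        ArithmeticFunction.vonMangoldt n := by
      simp [ArithmeticFunction.vonMangoldt.residueClass, Subsingleton.elim _ (0 : ZMod 1)]
    simp only [hr, this]; split_ifs <;> simp
  have hrn : ∀ n, 0 ≤ r n := fun n => by
    rw [hr0]; split_ifs
    · rfl
    · have := ArithmeticFunction.vonMangoldt_nonneg (n := n)
      positivity
  refine ⟨C + ∑' n, r n, fun M => ?_⟩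
  have : ∑ n ∈ Ioc 0 M, (if n.Prime then χ n * Real.log n / n else 0) =
      ∑ n ∈ Ioc 0 M, χ n * ArithmeticFunction.vonMangoldt n / n - ∑ n ∈ Ioc 0 M, χ n * r n := by
    rw [← sum_sub_distrib]
    refine sum_congr rfl fun n _ => ?_
    rw [hr0]
    split_ifs with hp
    · rw [ArithmeticFunction.vonMangoldt_apply_prime hp]; ring
    · ring
  rw [this]
  refine (abs_sub _ _).trans (add_le_add (hC M) ?_)
  refine (abs_sum_le_sum_abs _ _).trans ?_
  calc ∑ n ∈ Ioc 0 M, |χ n * r n| ≤ ∑ n ∈ Ioc 0 M, r n := by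
        refine sum_le_sum fun n _ => ?_
        rw [abs_mul, abs_of_nonneg (hrn n)]
        exact mul_le_of_le_one_left (hrn n) (h.abs_le_one n)
    _ ≤ ∑' n, r n := hsum.sum_le_tsum _ fun n _ => hrn n

theorem exists_tendsto_sum_prime_div (h : IsOscillatingChar χ K l) :
    ∃ T, Tendsto (fun N => ∑ n ∈ Ioc 0 N, if n.Prime then χ n / n else 0) atTop (nhds T) := by
  obtain ⟨C, hC⟩ := h.exists_abs_sum_prime_log_div_le
  have hlog : ∀ n : ℕ, 0 < Real.log (max n 2 : ℕ) := fun n =>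
    Real.log_pos (by exact_mod_cast (by omega : 1 < max n 2))
  obtain ⟨T, hT, -⟩ := exists_limit_sum_Ioc_mul (C := C + C)
    (u := fun n : ℕ => if n.Prime then χ n * Real.log n / n else 0)
    (g := fun n : ℕ => (Real.log (max n 2 : ℕ))⁻¹)
    (fun N M hNM => by
      rw [← sum_Ioc_sub_sum_Ioc _ hNM]
      exact (abs_sub _ _).trans (add_le_add (hC M) (hC N)))
    (fun n _ => by
      have := hlog n
      have h2 : 0 < max n 2 := by omega
      gcongr
      omega)
    (fun n _ => (inv_pos.mpr (hlog n)).le)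
    (tendsto_inv_atTop_zero.comp (Real.tendsto_log_atTop.comp
      (tendsto_natCast_atTop_atTop.comp
        (tendsto_atTop_mono (fun n => le_max_left n 2) tendsto_id))))
  refine ⟨T, hT.congr fun N => sum_congr rfl fun n _ => ?_⟩
  split_ifs with hp
  · have := hlog n
    rw [max_eq_left hp.two_le] at this ⊢
    field_simp
  · rw [zero_mul]

end IsOscillatingChar

end

section

open Finset

theorem sum_range_succ_eq_sum_Ioc {a : ℕ → ℝ} (h0 : a 0 = 0) (N : ℕ) :
    ∑ n ∈ range (N + 1), a n = ∑ n ∈ Ioc 0 N, a n := by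
  induction N with
  | zero => simp [h0]
  | succ N ih => rw [sum_range_succ, ih, sum_Ioc_succ_top (Nat.zero_le N)]

theorem tendsto_sum_range_iff_Ioc {a : ℕ → ℝ} (h0 : a 0 = 0) {A : ℝ} :
    Tendsto (fun N => ∑ n ∈ range N, a n) atTop (nhds A) ↔
      Tendsto (fun N => ∑ n ∈ Ioc 0 N, a n) atTop (nhds A) := by
  rw [← tendsto_add_atTop_iff_nat 1]
  simp only [sum_range_succ_eq_sum_Ioc h0]

theorem tendsto_natCast_rpow_neg {n : ℕ} (hn : n ≠ 0) :
    Tendsto (fun ε : ℝ => (n : ℝ) ^ (-ε)) (nhdsWithin 0 (Set.Ioi 0)) (nhds 1) := by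
  have hc : Continuous fun ε : ℝ => (n : ℝ) ^ (-ε) :=
    continuous_const.rpow continuous_neg fun ε => Or.inl (by exact_mod_cast hn)
  have := hc.tendsto 0
  simp only [neg_zero, Real.rpow_zero] at this
  exact this.mono_left nhdsWithin_le_nhds

/-- **Abel's limit theorem** for Dirichlet series. -/
theorem tendsto_tsum_mul_rpow_neg {a : ℕ → ℝ} (h0 : a 0 = 0) {A : ℝ}
    (hA : Tendsto (fun N => ∑ n ∈ Ioc 0 N, a n) atTop (nhds A))
    (hs : ∀ ε : ℝ, 0 < ε → Summable fun n : ℕ => a n * (n : ℝ) ^ (-ε)) :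
    Tendsto (fun ε : ℝ => ∑' n : ℕ, a n * (n : ℝ) ^ (-ε)) (nhdsWithin 0 (Set.Ioi 0)) (nhds A) := by
  rw [Metric.tendsto_nhds]
  intro δ hδ
  obtain ⟨N, hN⟩ := Metric.tendsto_atTop.mp hA (δ / 5) (by positivity)
  have hfin : Tendsto (fun ε : ℝ => ∑ n ∈ Ioc 0 N, a n * (n : ℝ) ^ (-ε))
      (nhdsWithin 0 (Set.Ioi 0)) (nhds (∑ n ∈ Ioc 0 N, a n * 1)) :=
    tendsto_finsetSum _ fun n hn =>
      (tendsto_natCast_rpow_neg (by have := (mem_Ioc.mp hn).1; omega)).const_mul _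
  simp only [mul_one] at hfin
  filter_upwards [Metric.tendsto_nhds.mp hfin (δ / 5) (by positivity), self_mem_nhdsWithin]
    with ε h1 hε
  have hε : 0 < ε := hε
  have htail : ∀ M, N ≤ M → |∑ n ∈ Ioc N M, a n * (n : ℝ) ^ (-ε)| ≤ 2 * (δ / 5) := fun M hM => by
    refine (abs_sum_Ioc_mul_le (u := a) (g := fun n : ℕ => (n : ℝ) ^ (-ε)) (N := N)
      (C := 2 * (δ / 5)) (fun M hM => ?_) (fun n hn => ?_) (fun n _ => by positivity) M hM).trans ?_
    · rw [← sum_Ioc_sub_sum_Ioc a hM]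
      have e1 := hN M hM
      have e2 := hN N le_rfl
      rw [Real.dist_eq] at e1 e2
      rw [abs_lt] at e1 e2
      rw [abs_le]
      constructor <;> linarith [e1.1, e1.2, e2.1, e2.2]
    · have : (0 : ℝ) < n := by exact_mod_cast (by omega : 0 < n)
      exact Real.rpow_le_rpow_of_nonpos this (by push_cast; linarith) (by linarith)
    · refine mul_le_of_le_one_right (by positivity) ?_
      exact Real.rpow_le_one_of_one_le_of_nonpos
        (by push_cast; linarith [Nat.cast_nonneg (α := ℝ) N])
        (by linarith)
  have hlim := (tendsto_sum_range_iff_Ioc (a := fun n : ℕ => a n * (n : ℝ) ^ (-ε))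
    (by simp [h0])).mp (hs ε hε).hasSum.tendsto_sum_nat
  have h2 : |∑' n : ℕ, a n * (n : ℝ) ^ (-ε) - ∑ n ∈ Ioc 0 N, a n * (n : ℝ) ^ (-ε)| ≤
      2 * (δ / 5) := by
    refine le_of_tendsto (hlim.sub_const _).abs ?_
    filter_upwards [eventually_ge_atTop N] with M hM
    rw [sum_Ioc_sub_sum_Ioc _ hM]
    exact htail M hM
  have h3 := hN N le_rfl
  rw [Real.dist_eq, abs_lt] at *
  rw [abs_le] at h2
  constructor <;> linarith [h1.1, h1.2, h2.1, h2.2, h3.1, h3.2]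

/-- The part of `-log (1 - x)` of order at least two. -/
noncomputable def logRemainder (x : ℝ) : ℝ := -Real.log (1 - x) - x

theorem abs_logRemainder_le {x : ℝ} (hx : |x| ≤ 1 / 2) : |logRemainder x| ≤ 2 * x ^ 2 := by
  have h := Real.abs_log_sub_add_sum_range_le (x := x) (by linarith) 1
  simp only [sum_range_one, zero_add, pow_one, Nat.cast_zero, div_one, Nat.reduceAdd] at h
  have e : logRemainder x = -(x + Real.log (1 - x)) := by rw [logRemainder]; ring
  rw [e, abs_neg]
  refine h.trans ?_
  rw [sq_abs, div_le_iff₀ (by linarith)]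
  nlinarith [sq_nonneg x]

theorem exp_add_logRemainder {x : ℝ} (hx : x < 1) :
    Real.exp (x + logRemainder x) = (1 - x)⁻¹ := by
  rw [logRemainder, add_sub_cancel, Real.exp_neg, Real.exp_log (by linarith)]

theorem tendsto_logRemainder {α : Type*} {f : Filter α} {y : α → ℝ} {x : ℝ} (hx : x < 1)
    (hy : Tendsto y f (nhds x)) :
    Tendsto (fun i => logRemainder (y i)) f (nhds (logRemainder x)) :=
  ((hy.const_sub 1).log (by linarith)).neg.sub hy

theorem prod_primesBelow_inv_eq_exp {y : ℕ → ℝ} (hy : ∀ n : ℕ, n.Prime → y n < 1) (n : ℕ) :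
    ∏ p ∈ n.primesBelow, (1 - y p)⁻¹ =
      Real.exp (∑ k ∈ range n, (if k.Prime then y k else 0) +
        ∑ k ∈ range n, (if k.Prime then logRemainder (y k) else 0)) := by
  rw [← sum_add_distrib, Real.exp_sum, Nat.primesBelow, prod_filter]
  refine prod_congr rfl fun k _ => ?_
  split_ifs with hk
  · rw [exp_add_logRemainder (hy k hk)]
  · rw [add_zero, Real.exp_zero]

section Remainder

variable {y : ℕ → ℝ}

theorem abs_le_half_of_prime (hy : ∀ n : ℕ, |y n| ≤ (n : ℝ)⁻¹) {n : ℕ} (hn : n.Prime) :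
    |y n| ≤ 1 / 2 := by
  refine (hy n).trans ?_
  rw [one_div]
  have : (2 : ℝ) ≤ n := by exact_mod_cast hn.two_le
  gcongr

theorem abs_primeRemainder_le (hy : ∀ n : ℕ, |y n| ≤ (n : ℝ)⁻¹) (n : ℕ) :
    |if n.Prime then logRemainder (y n) else 0| ≤ 2 * ((n : ℝ) ^ 2)⁻¹ := by
  split_ifs with hn
  · refine (abs_logRemainder_le (abs_le_half_of_prime hy hn)).trans ?_
    rw [← inv_pow, ← sq_abs]
    gcongr
    exact hy n
  · rw [abs_zero]; positivity

theorem summable_two_mul_inv_sq : Summable fun n : ℕ => 2 * ((n : ℝ) ^ 2)⁻¹ :=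
  (Real.summable_nat_pow_inv.mpr one_lt_two).mul_left 2

theorem summable_primeRemainder (hy : ∀ n : ℕ, |y n| ≤ (n : ℝ)⁻¹) :
    Summable fun n : ℕ => if n.Prime then logRemainder (y n) else 0 :=
  summable_two_mul_inv_sq.of_norm_bounded (abs_primeRemainder_le hy)

end Remainder

namespace IsOscillatingChar

variable {χ : ArithmeticFunction ℝ} {K l : ℝ}

theorem abs_div_le (h : IsOscillatingChar χ K l) (n : ℕ) : |χ n / n| ≤ (n : ℝ)⁻¹ := by
  rw [abs_div, Nat.abs_cast, div_eq_mul_inv]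
  exact mul_le_of_le_one_left (by positivity) (h.abs_le_one n)

theorem abs_div_mul_rpow_le (h : IsOscillatingChar χ K l) {ε : ℝ} (hε : 0 < ε) (n : ℕ) :
    |χ n / n * (n : ℝ) ^ (-ε)| ≤ (n : ℝ)⁻¹ := by
  rcases Nat.eq_zero_or_pos n with rfl | hn
  · simp
  rw [abs_mul, abs_of_nonneg (a := (n : ℝ) ^ (-ε)) (by positivity)]
  refine (mul_le_of_le_one_right (abs_nonneg _) ?_).trans (h.abs_div_le n)
  exact Real.rpow_le_one_of_one_le_of_nonpos (by exact_mod_cast hn) (by linarith)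

theorem summable_abs_div_mul_rpow (h : IsOscillatingChar χ K l) {ε : ℝ} (hε : 0 < ε) :
    Summable fun n : ℕ => |χ n / n * (n : ℝ) ^ (-ε)| := by
  refine Summable.of_nonneg_of_le (fun n => abs_nonneg _) (fun n => ?_)
    (Real.summable_nat_rpow_inv.mpr (by linarith : 1 < 1 + ε))
  rcases Nat.eq_zero_or_pos n with rfl | hn
  · simp; positivity
  have hn' : (0 : ℝ) < n := by exact_mod_cast hn
  rw [abs_mul, abs_of_nonneg (a := (n : ℝ) ^ (-ε)) (by positivity), Real.rpow_add hn',
    Real.rpow_one, mul_inv, Real.rpow_neg hn'.le]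
  gcongr
  exact h.abs_div_le n

/-- The Euler product of the Dirichlet series of `χ` at `1 + ε`. -/
theorem tsum_eq_exp (h : IsOscillatingChar χ K l) {ε : ℝ} (hε : 0 < ε) :
    ∑' n : ℕ, χ n / n * (n : ℝ) ^ (-ε) =
      Real.exp (∑' n : ℕ, (if n.Prime then χ n / n else 0) * (n : ℝ) ^ (-ε) +
        ∑' n : ℕ, if n.Prime then logRemainder (χ n / n * (n : ℝ) ^ (-ε)) else 0) := by
  let f : ℕ →*₀ ℝ :=
    { toFun := fun n => χ n / n * (n : ℝ) ^ (-ε)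
      map_zero' := by simp
      map_one' := by simp [h.map_one]
      map_mul' := fun m n => by
        rw [h.map_mul, Nat.cast_mul, Real.mul_rpow (by positivity) (by positivity)]
        ring }
  have hf := EulerProduct.eulerProduct_completely_multiplicative (f := f)
    (h.summable_abs_div_mul_rpow hε)
  have hy := h.abs_div_mul_rpow_le hε
  refine tendsto_nhds_unique hf ?_
  have hs1 : Summable fun n : ℕ => (if n.Prime then χ n / n else 0) * (n : ℝ) ^ (-ε) := by
    refine (h.summable_abs_div_mul_rpow hε).of_norm_bounded fun n => ?_
    split_ifs
    · rfl
    · rw [zero_mul, norm_zero]; exact abs_nonneg _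
  refine ((Real.continuous_exp.tendsto _).comp
    (hs1.hasSum.tendsto_sum_nat.add (summable_primeRemainder hy).hasSum.tendsto_sum_nat)).congr
    fun n => ?_
  have := prod_primesBelow_inv_eq_exp (y := f)
    (fun k hk => (le_abs_self _).trans_lt (lt_of_le_of_lt (abs_le_half_of_prime hy hk)
      (by norm_num))) n
  rw [this]
  simp only [Function.comp_apply, ite_mul, zero_mul]
  rfl

theorem tendsto_eulerProduct (h : IsOscillatingChar χ K l) :
    Tendsto (fun n : ℕ => ∏ p ∈ n.primesBelow, (1 - χ p / p)⁻¹) atTop (nhds l) := by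
  obtain ⟨T, hT⟩ := h.exists_tendsto_sum_prime_div
  have hl : Tendsto (fun N : ℕ => ∑ n ∈ Ioc 0 N, χ n / n) atTop (nhds l) := by
    rw [tendsto_iff_norm_sub_tendsto_zero]
    refine squeeze_zero (fun _ => norm_nonneg _) (fun N => h.abs_sum_inv_sub_le N) ?_
    simpa using
      ((tendsto_inv_atTop_nhds_zero_nat (𝕜 := ℝ)).comp (tendsto_add_atTop_nat 1)).const_mul K
  have h1 := tendsto_tsum_mul_rpow_neg (a := fun n : ℕ => χ n / n) (by simp) hl
    fun ε hε => (h.summable_abs_div_mul_rpow hε).of_abs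
  have h2 := tendsto_tsum_mul_rpow_neg (a := fun n : ℕ => if n.Prime then χ n / n else 0)
    (by simp) hT fun ε hε => by
      refine (h.summable_abs_div_mul_rpow hε).of_norm_bounded fun n => ?_
      split_ifs
      · rfl
      · rw [zero_mul, norm_zero]; exact abs_nonneg _
  have h3 : Tendsto (fun ε : ℝ =>
      ∑' n : ℕ, if n.Prime then logRemainder (χ n / n * (n : ℝ) ^ (-ε)) else 0)
      (nhdsWithin 0 (Set.Ioi 0))
      (nhds (∑' n : ℕ, if n.Prime then logRemainder (χ n / n) else 0)) := by
    refine tendsto_tsum_of_dominated_convergence summable_two_mul_inv_sq (fun n => ?_) ?_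
    · split_ifs with hn
      · refine tendsto_logRemainder ((le_abs_self _).trans_lt
          (lt_of_le_of_lt (abs_le_half_of_prime h.abs_div_le hn) (by norm_num))) ?_
        simpa using (tendsto_natCast_rpow_neg hn.ne_zero).const_mul (χ n / n)
      · exact tendsto_const_nhds
    · filter_upwards [self_mem_nhdsWithin] with ε hε n
      exact abs_primeRemainder_le (h.abs_div_mul_rpow_le hε) n
  have h4 := (Real.continuous_exp.tendsto _).comp (h2.add h3)
  have hlim : l = Real.exp (T + ∑' n : ℕ, if n.Prime then logRemainder (χ n / n) else 0) := by
    refine tendsto_nhds_unique h1 (h4.congr' ?_)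
    filter_upwards [self_mem_nhdsWithin] with ε hε
    exact (h.tsum_eq_exp hε).symm
  rw [hlim]
  have hT' := (tendsto_sum_range_iff_Ioc (a := fun n : ℕ => if n.Prime then χ n / n else 0)
    (by simp)).mpr hT
  refine ((Real.continuous_exp.tendsto _).comp
    (hT'.add (summable_primeRemainder h.abs_div_le).hasSum.tendsto_sum_nat)).congr fun n => ?_
  rw [prod_primesBelow_inv_eq_exp (y := fun n : ℕ => χ n / n) fun k hk => (le_abs_self _).trans_lt
    (lt_of_le_of_lt (abs_le_half_of_prime h.abs_div_le hk) (by norm_num))]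
  rfl

end IsOscillatingChar

end

section

open Finset

theorem sqCoeff_eq_zero {n : ℕ} (hn : n ≠ 0) (h8 : n % 8 ≠ 1) : sqCoeff n = 0 := by
  have h := thetaCoeff_sq_eq_sqCoeff hn
  rw [thetaCoeff_eq_zero (by omega), zero_pow two_ne_zero] at h
  have h' : ((4 * sqCoeff n : ℤ) : GaussianInt) = ((0 : ℤ) : GaussianInt) := by
    push_cast; exact h.symm
  have := Int.cast_injective h'
  omega

theorem sqCoeff_eight_mul_add_one (b : ℕ → ℤ)
    (hb : ∀ n N : ℕ, n ≤ N →
      b n = ((∏ m ∈ Finset.Icc 1 N,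
        (((1 : Polynomial ℤ) - Polynomial.X ^ m) *
          ((1 : Polynomial ℤ) - Polynomial.X ^ (2 * m)))).coeff n)) (n : ℕ) :
    sqCoeff (8 * n + 1) = b n ^ 2 := by
  have h := thetaCoeff_sq_eq_sqCoeff (n := 8 * n + 1) (by omega)
  push_cast at h
  rw [thetaCoeff_eq_two_mul b hb] at h
  have h' : ((4 * sqCoeff (8 * n + 1) : ℤ) : GaussianInt) = ((4 * b n ^ 2 : ℤ) : GaussianInt) := by
    push_cast; rw [← h]; ring
  have := Int.cast_injective h'
  omega

theorem sum_sq_eq_sum_sqCoeff (b : ℕ → ℤ)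
    (hb : ∀ n N : ℕ, n ≤ N →
      b n = ((∏ m ∈ Finset.Icc 1 N,
        (((1 : Polynomial ℤ) - Polynomial.X ^ m) *
          ((1 : Polynomial ℤ) - Polynomial.X ^ (2 * m)))).coeff n)) (N : ℕ) :
    ∑ n ∈ range (N + 1), (b n : ℝ) ^ 2 = ∑ m ∈ Ioc 0 (8 * N + 1), (sqCoeff m : ℝ) := by
  induction N with
  | zero =>
    have := sqCoeff_eight_mul_add_one b hb 0
    simp only [mul_zero, zero_add] at this
    simp [this]
  | succ N ih =>
    rw [sum_range_succ, ih,
      ← sum_Ioc_consecutive _ (Nat.zero_le (8 * N + 1)) (by omega : 8 * N + 1 ≤ 8 * (N + 1) + 1)]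
    congr 1
    rw [show 8 * (N + 1) + 1 = 8 * N + 1 + 8 by ring, sum_Ioc_add_eight]
    have h8 := sqCoeff_eight_mul_add_one b hb (N + 1)
    rw [show 8 * (N + 1) + 1 = 8 * N + 1 + 8 by ring] at h8
    rw [h8, sqCoeff_eq_zero (n := 8 * N + 1 + 1) (by omega) (by omega),
      sqCoeff_eq_zero (n := 8 * N + 1 + 2) (by omega) (by omega),
      sqCoeff_eq_zero (n := 8 * N + 1 + 3) (by omega) (by omega),
      sqCoeff_eq_zero (n := 8 * N + 1 + 4) (by omega) (by omega),
      sqCoeff_eq_zero (n := 8 * N + 1 + 5) (by omega) (by omega),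
      sqCoeff_eq_zero (n := 8 * N + 1 + 6) (by omega) (by omega),
      sqCoeff_eq_zero (n := 8 * N + 1 + 7) (by omega) (by omega)]
    push_cast
    ring

/-- The local factor of the Euler product for the mean of `sqCoeff`. -/
theorem eulerFactor_eq {p : ℕ} (hp : p.Prime) :
    (if p % 8 = 3 ∨ p % 8 = 5 ∨ p % 8 = 7 then (1 + (p : ℝ)⁻¹)⁻¹
      else if p % 8 = 1 then (1 + (p : ℝ)⁻¹) * ((1 - (p : ℝ)⁻¹)⁻¹) ^ 2 else 1) =
    (1 - realModEight ZMod.χ₈ p / p)⁻¹ * (1 - realModEight ZMod.χ₈' p / p)⁻¹ *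
      (1 - realModEight (ZMod.χ₈ * ZMod.χ₈') p / p)⁻¹ *
      (if p = 2 then (1 : ℝ) else 1 - ((p : ℝ) ^ 2)⁻¹) := by
  simp only [realModEight_apply, MulChar.mul_apply]
  rcases hp.eq_two_or_odd with rfl | hodd
  · have h1 : ZMod.χ₈ (2 : ℕ) = 0 := by decide
    have h2 : ZMod.χ₈' (2 : ℕ) = 0 := by decide
    rw [h1, h2]
    norm_num
  · have hp2 : p ≠ 2 := by rintro rfl; omega
    have h1 : (1 : ℝ) < p := by exact_mod_cast hp.one_lt
    have hs : (1 : ℝ) - ((p : ℝ) ^ 2)⁻¹ = (1 - (p : ℝ)⁻¹) * (1 + (p : ℝ)⁻¹) := by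
      rw [← inv_pow]; ring
    have ha : (1 : ℝ) - (p : ℝ)⁻¹ ≠ 0 := by
      have := inv_lt_one_of_one_lt₀ h1; linarith
    have hb : (1 : ℝ) + (p : ℝ)⁻¹ ≠ 0 := by positivity
    rw [if_neg hp2, hs]
    simp only [div_eq_mul_inv]
    generalize (p : ℝ)⁻¹ = t at *
    rcases (mulChar_values_of_odd hodd).2 with ⟨h8, e1, e2⟩ | ⟨h8, e1, e2⟩ | ⟨h8, e1, e2⟩ |
      ⟨h8, e1, e2⟩ <;> rw [h8, e1, e2] <;> norm_num <;> field_simp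

theorem tendsto_eulerFactor_prod {l₁ l₂ l₃ : ℝ}
    (h1 : IsOscillatingChar (realModEight ZMod.χ₈) 16 l₁)
    (h2 : IsOscillatingChar (realModEight ZMod.χ₈') 16 l₂)
    (h3 : IsOscillatingChar (realModEight (ZMod.χ₈ * ZMod.χ₈')) 16 l₃) :
    Tendsto
      (fun x : ℕ => ∏ p ∈ (Finset.range (x + 1)).filter Nat.Prime,
        (if p % 8 = 3 ∨ p % 8 = 5 ∨ p % 8 = 7 then (1 + (p : ℝ)⁻¹)⁻¹
        else if p % 8 = 1 then (1 + (p : ℝ)⁻¹) * ((1 - (p : ℝ)⁻¹)⁻¹) ^ 2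
        else 1))
      atTop (nhds (l₁ * l₂ * l₃ * ∑' d : ℕ, (oddSqMoebius d : ℝ) / d)) := by
  have := (((h1.tendsto_eulerProduct.mul h2.tendsto_eulerProduct).mul
    h3.tendsto_eulerProduct).mul tendsto_prod_oddSqMoebius).comp (tendsto_add_atTop_nat 1)
  refine this.congr fun x => ?_
  simp only [Function.comp_apply, Nat.primesBelow, ← prod_mul_distrib]
  exact prod_congr rfl fun p hp => (eulerFactor_eq (mem_filter.mp hp).2).symm

theorem tendsto_sum_sq_div {A : ℝ} (b : ℕ → ℤ)
    (hb : ∀ n N : ℕ, n ≤ N →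
      b n = ((∏ m ∈ Finset.Icc 1 N,
        (((1 : Polynomial ℤ) - Polynomial.X ^ m) *
          ((1 : Polynomial ℤ) - Polynomial.X ^ (2 * m)))).coeff n))
    (hA : Tendsto (fun N : ℕ => (∑ n ∈ Ioc 0 N, (sqCoeff n : ℝ)) / N) atTop (nhds A)) :
    Tendsto (fun N : ℕ => (∑ n ∈ range (N + 1), (b n : ℝ) ^ 2) / N) atTop (nhds (A * 8)) := by
  have hlin : Tendsto (fun N : ℕ => 8 * N + 1) atTop atTop :=
    tendsto_atTop_mono (fun N => by simp only [id]; omega) tendsto_id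
  have hratio : Tendsto (fun N : ℕ => 8 + (N : ℝ)⁻¹) atTop (nhds (8 + 0)) :=
    tendsto_inv_atTop_nhds_zero_nat.const_add 8
  rw [add_zero] at hratio
  refine ((hA.comp hlin).mul hratio).congr' ?_
  filter_upwards [eventually_gt_atTop 0] with N hN
  have hN' : (0 : ℝ) < N := by exact_mod_cast hN
  rw [sum_sq_eq_sum_sqCoeff b hb, Function.comp_apply]
  push_cast
  field_simp

end

/-- With `b n` the coefficient of `q^n` in `∏ (1 - q^m)(1 - q^{2m})`, there is
`E > 0` with `∑_{n ≤ N} b_n^2 ~ E N`, where `E = 4 L` and `L` is the limit of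
the stated partial Euler products. -/
theorem stmt_7 (b : ℕ → ℤ)
    (hb : ∀ n N : ℕ, n ≤ N →
      b n = ((∏ m ∈ Finset.Icc 1 N,
        (((1 : Polynomial ℤ) - Polynomial.X ^ m) *
          ((1 : Polynomial ℤ) - Polynomial.X ^ (2 * m)))).coeff n)) :
    ∃ E L : ℝ, 0 < E ∧ 0 < L ∧
      Tendsto
        (fun x : ℕ => ∏ p ∈ (Finset.range (x + 1)).filter Nat.Prime,
          (if p % 8 = 3 ∨ p % 8 = 5 ∨ p % 8 = 7 then (1 + (p : ℝ)⁻¹)⁻¹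
          else if p % 8 = 1 then (1 + (p : ℝ)⁻¹) * ((1 - (p : ℝ)⁻¹)⁻¹) ^ 2
          else 1))
        atTop (nhds L) ∧
      E = 4 * L ∧
      Tendsto
        (fun N : ℕ => (∑ n ∈ Finset.range (N + 1), ((b n : ℝ)) ^ 2) / (E * N))
        atTop (nhds 1) := by
  obtain ⟨l₁, h1⟩ := exists_isOscillatingChar_eight
  obtain ⟨l₂, h2⟩ := exists_isOscillatingChar_eight'
  obtain ⟨l₃, h3⟩ := exists_isOscillatingChar_eight_mul
  have hL : 0 < l₁ * l₂ * l₃ * ∑' d : ℕ, (oddSqMoebius d : ℝ) / d :=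
    mul_pos (mul_pos (mul_pos h1.pos h2.pos) h3.pos) tsum_oddSqMoebius_pos
  refine ⟨4 * (l₁ * l₂ * l₃ * ∑' d : ℕ, (oddSqMoebius d : ℝ) / d), _, by positivity, hL,
    tendsto_eulerFactor_prod h1 h2 h3, rfl, ?_⟩
  have h := (tendsto_sum_sq_div b hb (tendsto_mean_sqCoeff h1 h2 h3)).div_const
    (4 * (l₁ * l₂ * l₃ * ∑' d : ℕ, (oddSqMoebius d : ℝ) / d))
  rw [show l₃ * (l₂ * (l₁ * (1 / 2))) * (∑' d : ℕ, (oddSqMoebius d : ℝ) / d) * 8 =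
    4 * (l₁ * l₂ * l₃ * ∑' d : ℕ, (oddSqMoebius d : ℝ) / d) by ring,
    div_self (by positivity)] at h
  exact h.congr fun N => by rw [div_div, mul_comm (N : ℝ)]
end

section
/- Let c_n be the coefficient of q^n in ∏_{m=1}^∞ (1 - q^m)(1 - q^{3m}). Let h : ℕ → ℤ be the multiplicative arithmetic function determined on prime powers p^r (r ≥ 1) by: h(p^r) = 1 if p ≡ 5 (mod 6) and r is even; h(p^r) = r + 1 if p ≡ 1 (mod 6) and 2^{(p-1)/3} ≡ 1 (mod p); h(p^r) = 1 if p ≡ 1 (mod 6), 2^{(p-1)/3} ≢ 1 (mod p), and r ≡ 0 (mod 3); h(p^r) = -1 if p ≡ 1 (mod 6), 2^{(p-1)/3} ≢ 1 (mod p), and r ≡ 1 (mod 3); and h(p^r) = 0 otherwise. Then c_n = h(6n + 1) for all n ≥ 0. -/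
/-- The Eisenstein integers `ℤ[ω]`, where `ω ^ 2 = -1 - ω`. -/
abbrev EisensteinInt := QuadraticAlgebra ℤ (-1) (-1)

namespace EisensteinInt

open Finset QuadraticAlgebra

/-- The norm of an Eisenstein integer in coordinates. -/
theorem norm_eq (z : EisensteinInt) :
    norm z = z.re ^ 2 - z.re * z.im + z.im ^ 2 := by
  rw [norm_def]; ring

theorem four_mul_norm (z : EisensteinInt) :
    4 * norm z = (2 * z.re - z.im) ^ 2 + 3 * z.im ^ 2 := by
  rw [norm_eq]; ring

theorem four_mul_norm_symm (z : EisensteinInt) :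
    4 * norm z = (2 * z.im - z.re) ^ 2 + 3 * z.re ^ 2 := by
  rw [norm_eq]; ring

theorem norm_nonneg (z : EisensteinInt) : 0 ≤ norm z := by
  nlinarith [four_mul_norm z, sq_nonneg (2 * z.re - z.im), sq_nonneg z.im]

theorem norm_eq_zero_iff {z : EisensteinInt} : norm z = 0 ↔ z = 0 := by
  refine ⟨fun h ↦ ?_, fun h ↦ by simp [h]⟩
  have h₁ : z.im ^ 2 = 0 := by
    nlinarith [four_mul_norm z, sq_nonneg (2 * z.re - z.im), sq_nonneg z.im]
  have h₂ : z.re ^ 2 = 0 := by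
    nlinarith [four_mul_norm_symm z, sq_nonneg (2 * z.im - z.re), sq_nonneg z.re]
  ext <;> simp_all

theorem norm_pos {z : EisensteinInt} (hz : z ≠ 0) : 0 < norm z :=
  lt_of_le_of_ne z.norm_nonneg fun h ↦ hz (norm_eq_zero_iff.mp h.symm)

theorem mul_star_eq_norm (z : EisensteinInt) : z * star z = ((norm z : ℤ) : EisensteinInt) := by
  rw [← algebraMap_norm_eq_mul_star]; rfl

instance : IsDomain EisensteinInt :=
  have : NoZeroDivisors EisensteinInt :=
    ⟨fun {a b} h ↦ by
      have := congrArg QuadraticAlgebra.norm h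
      rw [map_mul, QuadraticAlgebra.norm_zero, mul_eq_zero] at this
      simpa only [norm_eq_zero_iff] using this⟩
  NoZeroDivisors.to_isDomain _

/-- Rounded division of integers: the error is at most half the divisor. -/
theorem exists_two_mul_abs_sub_mul_le (a : ℤ) {n : ℤ} (hn : 0 < n) :
    ∃ q : ℤ, 2 * |a - n * q| ≤ n := by
  refine ⟨(2 * a + n) / (2 * n), ?_⟩
  have h₁ := Int.mul_ediv_add_emod (2 * a + n) (2 * n)
  have h₂ := Int.emod_nonneg (2 * a + n) (b := 2 * n) (by lia)
  have h₃ := Int.emod_lt_of_pos (2 * a + n) (b := 2 * n) (by lia)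
  have h₄ : 2 * |a - n * ((2 * a + n) / (2 * n))|
      = |2 * a - 2 * n * ((2 * a + n) / (2 * n))| := by
    rw [show 2 * a - 2 * n * ((2 * a + n) / (2 * n))
      = 2 * (a - n * ((2 * a + n) / (2 * n))) by ring, abs_mul, abs_two]
  rw [h₄, abs_le]
  constructor <;> linarith

theorem exists_norm_sub_mul_lt (x : EisensteinInt) {y : EisensteinInt} (hy : y ≠ 0) :
    ∃ q, norm (x - y * q) < norm y := by
  have hn := norm_pos hy
  obtain ⟨s, hs⟩ := exists_two_mul_abs_sub_mul_le (x * star y).re hn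
  obtain ⟨t, ht⟩ := exists_two_mul_abs_sub_mul_le (x * star y).im hn
  refine ⟨⟨s, t⟩, ?_⟩
  have key : norm (x - y * ⟨s, t⟩) * norm y =
      norm (⟨(x * star y).re - norm y * s, (x * star y).im - norm y * t⟩ : EisensteinInt) := by
    rw [← QuadraticAlgebra.norm_star y, ← map_mul]
    congr 1
    have : y * star y = ((norm y : ℤ) : EisensteinInt) := mul_star_eq_norm y
    rw [sub_mul, mul_right_comm, this]
    ext <;> simp
  generalize (x * star y).re - norm y * s = e at *
  generalize (x * star y).im - norm y * t = f at *
  have he := abs_le.mp (show |2 * e| ≤ norm y by rwa [abs_mul, abs_two])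
  have hf := abs_le.mp (show |2 * f| ≤ norm y by rwa [abs_mul, abs_two])
  have h₁ : (2 * e) ^ 2 ≤ norm y ^ 2 := sq_le_sq' he.1 he.2
  have h₂ : (2 * f) ^ 2 ≤ norm y ^ 2 := sq_le_sq' hf.1 hf.2
  have h₃ : -(2 * e) * (2 * f) ≤ norm y ^ 2 := by nlinarith [sq_nonneg (e + f)]
  refine lt_of_mul_lt_mul_right (a := norm y) ?_ hn.le
  rw [key, norm_eq]
  nlinarith

noncomputable instance : EuclideanDomain EisensteinInt :=
  open Classical in
  { (inferInstance : CommRing EisensteinInt), (inferInstance : Nontrivial EisensteinInt) with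
    quotient x y := if hy : y = 0 then 0 else (exists_norm_sub_mul_lt x hy).choose
    remainder x y :=
      x - y * if hy : y = 0 then 0 else (exists_norm_sub_mul_lt x hy).choose
    quotient_zero x := by simp
    quotient_mul_add_remainder_eq x y := by ring
    r := InvImage (· < ·) fun z ↦ (norm z).natAbs
    r_wellFounded := (measure fun z : EisensteinInt ↦ (norm z).natAbs).wf
    remainder_lt x y hy := by
      have := (exists_norm_sub_mul_lt x hy).choose_spec
      simp only [InvImage, dif_neg hy]
      have h₁ := norm_nonneg (x - y * (exists_norm_sub_mul_lt x hy).choose)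
      lia
    mul_left_not_lt x y hy := by
      have h₁ := norm_nonneg x
      have h₂ := norm_pos hy
      simp only [InvImage, map_mul, Int.natAbs_mul, not_lt]
      exact Nat.le_mul_of_pos_right _ (by lia) }

/-- An Eisenstein integer is primary if it is congruent to `1` modulo `3`. -/
def Primary (z : EisensteinInt) : Prop := 3 ∣ z - 1

theorem intCast_dvd_iff {n : ℤ} {z : EisensteinInt} :
    (n : EisensteinInt) ∣ z ↔ n ∣ z.re ∧ n ∣ z.im :=
  algebraMap_dvd_iff

theorem primary_iff {z : EisensteinInt} : Primary z ↔ 3 ∣ z.re - 1 ∧ 3 ∣ z.im := by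
  have := intCast_dvd_iff (n := 3) (z := z - 1)
  simpa [Primary] using this

theorem primary_one : Primary 1 := by simp [Primary]

theorem Primary.mul {x y : EisensteinInt} (hx : Primary x) (hy : Primary y) :
    Primary (x * y) := by
  have : x * y - 1 = (x - 1) * y + (y - 1) := by ring
  rw [Primary, this]
  exact dvd_add (hx.mul_right _) hy

theorem Primary.of_mul {x y : EisensteinInt} (hx : Primary x) (hxy : Primary (x * y)) :
    Primary y := by
  have : y - 1 = (x * y - 1) - (x - 1) * y := by ring
  rw [Primary, this]
  exact dvd_sub hxy (hx.mul_right _)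

theorem Primary.pow {x : EisensteinInt} (hx : Primary x) (n : ℕ) : Primary (x ^ n) := by
  induction n with
  | zero => simpa using primary_one
  | succ n ih => rw [pow_succ]; exact ih.mul hx

theorem Primary.star {x : EisensteinInt} (hx : Primary x) : Primary (star x) := by
  rw [primary_iff] at *
  simp only [re_star, im_star]
  lia

theorem Primary.eq_one_of_norm {x : EisensteinInt} (hx : Primary x)
    (h : norm x = 1) : x = 1 := by
  obtain ⟨⟨s, hs⟩, t, ht⟩ := primary_iff.mp hx
  have h₁ := four_mul_norm x
  have h₂ := norm_eq x
  have ht₀ : t = 0 := by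
    have : t ^ 2 < 1 := by
      rw [h, ht] at h₁
      nlinarith [sq_nonneg (2 * x.re - 3 * t)]
    nlinarith
  have him : x.im = 0 := by lia
  rw [him, h] at h₂
  have hre : x.re = 1 := by
    rcases sq_eq_one_iff.mp (show x.re ^ 2 = 1 by linarith) with h | h <;> lia
  ext <;> simp [him, hre]

theorem norm_eq_one_of_isUnit {u : EisensteinInt} (hu : IsUnit u) : norm u = 1 := by
  rcases Int.isUnit_iff.mp (isUnit_iff_norm_isUnit.mp hu) with h | h
  · exact h
  · have := norm_nonneg u
    lia

theorem Primary.eq_of_dvd {x y : EisensteinInt} (hx : Primary x) (hy : Primary y)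
    (hxy : x ∣ y) (h₀ : norm x ≠ 0) (h : norm x = norm y) : x = y := by
  obtain ⟨u, rfl⟩ := hxy
  have hu : norm u = 1 := by
    rw [map_mul] at h
    exact mul_left_cancel₀ h₀ (by rw [← h, mul_one])
  rw [(hx.of_mul hy).eq_one_of_norm hu, mul_one]

theorem exists_isUnit_mul_primary {z : EisensteinInt} (hz : ¬ 3 ∣ norm z) :
    ∃ u, IsUnit u ∧ Primary (u * z) := by
  have hmod : ¬ 3 ∣ z.re + z.im := by
    rintro ⟨k, hk⟩
    refine hz ⟨3 * k ^ 2 - z.re * z.im, ?_⟩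
    rw [norm_eq]
    linear_combination (z.re + z.im + 3 * k) * hk
  simp only [primary_iff, isUnit_iff_norm_isUnit, Int.isUnit_iff, norm_eq, re_mul, im_mul]
  have h : ∀ a b : ℤ, a ^ 2 - a * b + b ^ 2 = 1 →
      3 ∣ a * z.re - b * z.im - 1 → 3 ∣ a * z.im + b * z.re - b * z.im →
      ∃ u : EisensteinInt, (u.re ^ 2 - u.re * u.im + u.im ^ 2 = 1 ∨
        u.re ^ 2 - u.re * u.im + u.im ^ 2 = -1) ∧
        3 ∣ u.re * z.re + -1 * u.im * z.im - 1 ∧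
        3 ∣ u.re * z.im + u.im * z.re + -1 * u.im * z.im := fun a b h₁ h₂ h₃ ↦
    ⟨⟨a, b⟩, Or.inl h₁, by convert h₂ using 2; ring, by convert h₃ using 1; ring⟩
  have hcases : (z.re % 3 = 1 ∧ z.im % 3 = 0) ∨ (z.re % 3 = 2 ∧ z.im % 3 = 0) ∨
      (z.re % 3 = 0 ∧ z.im % 3 = 1) ∨ (z.re % 3 = 0 ∧ z.im % 3 = 2) ∨
      (z.re % 3 = 1 ∧ z.im % 3 = 1) ∨ (z.re % 3 = 2 ∧ z.im % 3 = 2) := by lia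
  rcases hcases with h' | h' | h' | h' | h' | h'
  · exact h 1 0 (by norm_num) (by lia) (by lia)
  · exact h (-1) 0 (by norm_num) (by lia) (by lia)
  · exact h (-1) (-1) (by norm_num) (by lia) (by lia)
  · exact h 1 1 (by norm_num) (by lia) (by lia)
  · exact h 0 (-1) (by norm_num) (by lia) (by lia)
  · exact h 0 1 (by norm_num) (by lia) (by lia)

/-- The cubic residue character modulo the inert prime `2`. -/
def cubicTwo (z : EisensteinInt) : EisensteinInt :=
  if Even z.re then if Even z.im then 0 else ⟨0, 1⟩
  else if Even z.im then 1 else ⟨-1, -1⟩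

theorem cubicTwo_one : cubicTwo 1 = 1 := by
  simp [cubicTwo]

theorem cubicTwo_mul (x y : EisensteinInt) :
    cubicTwo (x * y) = cubicTwo x * cubicTwo y := by
  by_cases h₁ : Even x.re <;> by_cases h₂ : Even x.im <;> by_cases h₃ : Even y.re <;>
    by_cases h₄ : Even y.im <;>
    simp [cubicTwo, h₁, h₂, h₃, h₄, Int.even_add, Int.even_mul] <;>
    rfl

theorem cubicTwo_pow (x : EisensteinInt) (n : ℕ) : cubicTwo (x ^ n) = cubicTwo x ^ n := by
  induction n with
  | zero => simp [cubicTwo_one]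
  | succ n ih => rw [pow_succ, pow_succ, cubicTwo_mul, ih]

theorem finite_setOf_norm_eq (n : ℕ) : {z : EisensteinInt | Primary z ∧ norm z = n}.Finite := by
  refine Set.Finite.subset (((Set.finite_Icc (-(n + 1) : ℤ) (n + 1)).prod
    (Set.finite_Icc (-(n + 1) : ℤ) (n + 1))).preimage (equivProd (-1 : ℤ) (-1)).injective.injOn) ?_
  rintro z ⟨-, hz⟩
  have h₁ := four_mul_norm z
  have h₂ := four_mul_norm_symm z
  rw [hz] at h₁ h₂
  simp only [Set.mem_preimage, Set.mem_prod, Set.mem_Icc, equivProd, Equiv.coe_fn_mk, ← abs_le]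
  constructor <;> refine abs_le_of_sq_le_sq (a := _) ?_ (by positivity) <;>
    nlinarith [sq_nonneg (2 * z.re - z.im), sq_nonneg (2 * z.im - z.re)]

/-- The primary Eisenstein integers of norm `n`. -/
noncomputable def primaryOfNorm (n : ℕ) : Finset EisensteinInt :=
  (finite_setOf_norm_eq n).toFinset

@[simp]
theorem mem_primaryOfNorm {n : ℕ} {z : EisensteinInt} :
    z ∈ primaryOfNorm n ↔ Primary z ∧ norm z = n := by
  simp [primaryOfNorm]

/-- The sum of the cubic residue character modulo `2` over the primary Eisenstein integers of
norm `n`. -/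
noncomputable def cubicSum (n : ℕ) : EisensteinInt := ∑ z ∈ primaryOfNorm n, cubicTwo z

theorem cubicSum_one : cubicSum 1 = 1 := by
  have : primaryOfNorm 1 = {1} := by
    ext z
    simp only [mem_primaryOfNorm, mem_singleton, Nat.cast_one]
    exact ⟨fun h ↦ h.1.eq_one_of_norm h.2, fun h ↦ by simp [h, primary_one]⟩
  simp [cubicSum, this, cubicTwo_one]

theorem isCoprime_of_norm {x y : EisensteinInt} (h : IsCoprime (norm x) (norm y)) :
    IsCoprime x y := by
  have h' := h.map (Int.castRingHom EisensteinInt)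
  simp only [eq_intCast, ← mul_star_eq_norm] at h'
  exact h'.of_mul_left_left.of_mul_right_left

theorem norm_eq_of_dvd_of_mul {a b : EisensteinInt} {m n : ℕ} (hmn : m.Coprime n)
    (ha : a ∣ m) (hb : b ∣ n) (h : norm a * norm b = m * n) : norm a = m := by
  have ha' : norm a ∣ (m : ℤ) ^ 2 := by
    simpa using map_dvd QuadraticAlgebra.norm ha
  have hb' : norm b ∣ (n : ℤ) ^ 2 := by
    simpa using map_dvd QuadraticAlgebra.norm hb
  have hc : IsCoprime (m : ℤ) n := Nat.isCoprime_iff_coprime.mpr hmn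
  have h₁ : norm a ∣ m := by
    have : IsCoprime (norm a) n := (hc.pow_left (m := 2)).of_isCoprime_of_dvd_left ha'
    exact this.dvd_of_dvd_mul_right ⟨_, h.symm⟩
  have h₂ : (m : ℤ) ∣ norm a := by
    have : IsCoprime (m : ℤ) (norm b) := (hc.pow_right (n := 2)).of_isCoprime_of_dvd_right hb'
    exact this.dvd_of_dvd_mul_right ⟨_, h⟩
  exact Int.dvd_antisymm (norm_nonneg a) (by positivity) h₁ h₂

theorem exists_primary_mul_eq {m n : ℕ} (hmn : m.Coprime n) (hm : ¬ 3 ∣ m) (hn : ¬ 3 ∣ n)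
    {z : EisensteinInt} (hz : Primary z) (h : norm z = m * n) :
    ∃ x y, (Primary x ∧ norm x = m) ∧ (Primary y ∧ norm y = n) ∧ x * y = z := by
  have hdvd : z ∣ (m : EisensteinInt) * n := ⟨star z, by rw [mul_star_eq_norm, h]; push_cast; rfl⟩
  obtain ⟨a, b, ha, hb, rfl⟩ := exists_dvd_and_dvd_of_dvd_mul hdvd
  rw [map_mul] at h
  have hna := norm_eq_of_dvd_of_mul hmn ha hb h
  have hnb := norm_eq_of_dvd_of_mul hmn.symm hb ha (by rw [mul_comm, h, mul_comm])
  obtain ⟨u, hu, hua⟩ := exists_isUnit_mul_primary (z := a) (by rw [hna]; exact_mod_cast hm)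
  obtain ⟨v, hv, hvb⟩ := exists_isUnit_mul_primary (z := b) (by rw [hnb]; exact_mod_cast hn)
  refine ⟨u * a, v * b, ⟨hua, ?_⟩, ⟨hvb, ?_⟩, ?_⟩
  · rw [map_mul, norm_eq_one_of_isUnit hu, hna, one_mul]
  · rw [map_mul, norm_eq_one_of_isUnit hv, hnb, one_mul]
  · have huv : u * v = 1 := by
      refine Primary.eq_one_of_norm (hz.of_mul ?_) (norm_eq_one_of_isUnit (hu.mul hv))
      convert hua.mul hvb using 1
      ring
    linear_combination a * b * huv

theorem cubicSum_mul {m n : ℕ} (hmn : m.Coprime n) (hm : ¬ 3 ∣ m) (hn : ¬ 3 ∣ n) :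
    cubicSum (m * n) = cubicSum m * cubicSum n := by
  rw [cubicSum, cubicSum, cubicSum, sum_mul_sum, ← sum_product']
  symm
  refine sum_nbij (fun p ↦ p.1 * p.2) ?_ ?_ ?_ fun p _ ↦ (cubicTwo_mul _ _).symm
  · rintro ⟨x, y⟩ hxy
    simp only [mem_product, mem_primaryOfNorm] at hxy ⊢
    exact ⟨hxy.1.1.mul hxy.2.1, by simp [hxy.1.2, hxy.2.2]⟩
  · rintro ⟨x, y⟩ hxy ⟨x', y'⟩ hxy' h
    simp only [coe_product, Set.mem_prod, mem_coe, mem_primaryOfNorm] at hxy hxy' h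
    have hc : IsCoprime x y' := isCoprime_of_norm (by
      rw [hxy.1.2, hxy'.2.2]; exact Nat.isCoprime_iff_coprime.mpr hmn)
    have hm₀ : norm x ≠ 0 := by
      rw [hxy.1.2]
      rintro h₀
      exact hm (by simp_all)
    have hx : x = x' := hxy.1.1.eq_of_dvd hxy'.1.1
      (hc.dvd_of_dvd_mul_right (h ▸ dvd_mul_right x y)) hm₀ (by rw [hxy.1.2, hxy'.1.2])
    subst hx
    have hx₀ : x ≠ 0 := fun h₀ ↦ hm₀ (by simp [h₀])
    rw [mul_left_cancel₀ hx₀ h]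
  · intro z hz
    simp only [mem_coe, mem_primaryOfNorm, Nat.cast_mul] at hz
    obtain ⟨x, y, hx, hy, hxy⟩ := exists_primary_mul_eq hmn hm hn hz.1 hz.2
    exact ⟨(x, y), by simp [hx, hy], hxy⟩

theorem natCast_zmod_ne_zero {n p : ℕ} (hn : 0 < n) (hnp : n < p) : (n : ZMod p) ≠ 0 :=
  fun h ↦ hnp.not_ge (Nat.le_of_dvd hn ((ZMod.natCast_eq_zero_iff n p).mp h))

theorem ne_sq_sub_self_add_one_of_mod {p : ℕ} [Fact p.Prime] (hp : p % 6 = 5) (x : ZMod p) :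
    x ^ 2 - x + 1 ≠ 0 := by
  intro h
  have hx₀ : x ≠ 0 := by
    rintro rfl
    simp at h
  have h₃ : x ^ 3 = -1 := by linear_combination (x + 1) * h
  have hF := ZMod.pow_card_sub_one_eq_one hx₀
  have hp3 : (3 : ZMod p) ≠ 0 := natCast_zmod_ne_zero (n := 3) three_pos (by lia)
  obtain ⟨k, hk⟩ : ∃ k, p - 1 = 3 * k + 1 := ⟨(p - 2) / 3, by lia⟩
  rw [hk, pow_add, pow_mul, h₃, pow_one] at hF
  rcases neg_one_pow_eq_or (ZMod p) k with h' | h' <;> rw [h'] at hF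
  · have : x = 1 := by simpa using hF
    subst this
    norm_num at h
  · have : x = -1 := by linear_combination -hF
    subst this
    exact hp3 (by linear_combination h)

theorem natCast_dvd_of_dvd_norm {p : ℕ} (hp : p.Prime) (hp6 : p % 6 = 5) {z : EisensteinInt}
    (h : (p : ℤ) ∣ norm z) : (p : EisensteinInt) ∣ z := by
  have : Fact p.Prime := ⟨hp⟩
  rw [norm_eq, ← ZMod.intCast_zmod_eq_zero_iff_dvd] at h
  push_cast at h
  have him : (z.im : ZMod p) = 0 := by
    by_contra hne
    refine ne_sq_sub_self_add_one_of_mod hp6 (z.re / z.im : ZMod p) ?_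
    field_simp
    linear_combination h
  have hre : (z.re : ZMod p) = 0 := by simpa [him] using h
  have := intCast_dvd_iff (n := p) (z := z)
  push_cast at this
  rw [this, ← ZMod.intCast_zmod_eq_zero_iff_dvd, ← ZMod.intCast_zmod_eq_zero_iff_dvd]
  exact ⟨hre, him⟩

theorem cubicSum_inert {p : ℕ} (hp : p.Prime) (hp6 : p % 6 = 5) : cubicSum p = 0 := by
  refine sum_eq_zero fun z hz ↦ ?_
  rw [mem_primaryOfNorm] at hz
  obtain ⟨w, rfl⟩ := natCast_dvd_of_dvd_norm hp hp6 (z := z) (by rw [hz.2])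
  have h := hz.2
  have hp₀ : (p : ℤ) ≠ 0 := by exact_mod_cast hp.ne_zero
  rw [map_mul, QuadraticAlgebra.norm_natCast] at h
  have h₁ : (p : ℤ) * norm w = 1 := mul_left_cancel₀ hp₀ (by linear_combination h)
  have := Int.eq_one_or_neg_one_of_mul_eq_one h₁
  have := hp.two_le
  lia

theorem cubicSum_inert_pow_add_two {p : ℕ} (hp : p.Prime) (hp6 : p % 6 = 5) (r : ℕ) :
    cubicSum (p ^ (r + 2)) = cubicSum (p ^ r) := by
  have hp₀ : (p : EisensteinInt) ≠ 0 := by exact_mod_cast hp.ne_zero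
  have hp₁ : (p : ℤ) ^ 2 ≠ 0 := pow_ne_zero _ (by exact_mod_cast hp.ne_zero)
  have hprim : Primary (-(p : EisensteinInt)) := by
    rw [primary_iff]
    simp only [re_neg, im_neg, re_natCast, im_natCast]
    lia
  have hcub : cubicTwo (-(p : EisensteinInt)) = 1 := by
    have : ¬ Even p := by rw [Nat.even_iff]; lia
    simp [cubicTwo, this]
  symm
  refine sum_nbij (fun w ↦ -(p : EisensteinInt) * w) ?_ ?_ ?_ ?_
  · intro w hw
    rw [mem_primaryOfNorm] at hw ⊢
    refine ⟨hprim.mul hw.1, ?_⟩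
    rw [map_mul, QuadraticAlgebra.norm_neg, QuadraticAlgebra.norm_natCast, hw.2]
    push_cast
    ring
  · exact (mul_right_injective₀ (neg_ne_zero.mpr hp₀)).injOn
  · intro z hz
    rw [mem_coe, mem_primaryOfNorm] at hz
    obtain ⟨w, rfl⟩ := natCast_dvd_of_dvd_norm hp hp6 (z := z)
      (by rw [hz.2]; push_cast; exact dvd_pow_self _ (by lia))
    have hw : (p : EisensteinInt) * w = -(p : EisensteinInt) * -w := by ring
    refine ⟨-w, ?_, hw.symm⟩
    rw [mem_coe, mem_primaryOfNorm]
    refine ⟨hprim.of_mul (hw ▸ hz.1), mul_left_cancel₀ hp₁ ?_⟩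
    have := hz.2
    rw [map_mul, QuadraticAlgebra.norm_natCast] at this
    rw [QuadraticAlgebra.norm_neg, this]
    push_cast
    ring
  · intro w _
    rw [cubicTwo_mul, hcub, one_mul]

theorem cubicSum_inert_pow {p : ℕ} (hp : p.Prime) (hp6 : p % 6 = 5) (r : ℕ) :
    cubicSum (p ^ r) = if Even r then 1 else 0 := by
  induction r using Nat.twoStepInduction with
  | zero => simp [cubicSum_one]
  | one => simp [cubicSum_inert hp hp6]
  | more r ih _ => simpa [cubicSum_inert_pow_add_two hp hp6, Nat.even_add] using ih

theorem prime_of_norm_prime {p : ℕ} (hp : p.Prime) {x : EisensteinInt} (hx : norm x = p) :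
    Prime x := by
  refine Irreducible.prime ⟨fun h ↦ ?_, fun a b hab ↦ ?_⟩
  · have := norm_eq_one_of_isUnit h
    have := hp.two_le
    lia
  · rw [isUnit_iff_norm_isUnit, isUnit_iff_norm_isUnit]
    have hpp := (Nat.prime_iff_prime_int.mp hp).irreducible
    rw [← hx, hab, map_mul] at hpp
    exact hpp.isUnit_or_isUnit rfl

theorem exists_eq_pow_mul_star_pow {p : ℕ} (hp : p.Prime) {x : EisensteinInt} (hx : Primary x)
    (hxp : norm x = p) (r : ℕ) {z : EisensteinInt} (hz : Primary z) (hzp : norm z = p ^ r) :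
    ∃ i ≤ r, z = x ^ i * star x ^ (r - i) := by
  have hp₀ : (p : ℤ) ≠ 0 := by exact_mod_cast hp.ne_zero
  induction r generalizing z with
  | zero => exact ⟨0, le_rfl, by simpa using hz.eq_one_of_norm (by simpa using hzp)⟩
  | succ r ih =>
    have hdvd : x ∣ z * star z := by
      rw [mul_star_eq_norm, hzp, pow_succ']
      push_cast
      refine Dvd.dvd.mul_right ⟨star x, ?_⟩ _
      rw [mul_star_eq_norm, hxp]
      rfl
    rcases (prime_of_norm_prime hp hxp).dvd_or_dvd hdvd with ⟨w, rfl⟩ | ⟨w, hw⟩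
    · rw [map_mul, hxp, pow_succ'] at hzp
      obtain ⟨i, hi, rfl⟩ := ih (hx.of_mul hz) (mul_left_cancel₀ hp₀ hzp)
      exact ⟨i + 1, by lia, by rw [Nat.add_sub_add_right]; ring⟩
    · obtain rfl : z = star x * star w := by
        rw [← star_star z, hw, star_mul, mul_comm]
      rw [map_mul, QuadraticAlgebra.norm_star x, hxp, pow_succ'] at hzp
      obtain ⟨i, hi, hi'⟩ := ih (hx.star.of_mul hz) (mul_left_cancel₀ hp₀ hzp)
      exact ⟨i, by lia, by rw [hi', Nat.sub_add_comm hi]; ring⟩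

theorem not_dvd_star_of_norm_prime {p : ℕ} (hp : p.Prime) {x : EisensteinInt} (hx : Primary x)
    (hxp : norm x = p) : ¬ x ∣ star x := by
  intro h
  have hp₀ : (p : ℤ) ≠ 0 := by exact_mod_cast hp.ne_zero
  have heq := hx.eq_of_dvd hx.star h (by rwa [hxp]) (by simp)
  have him : x.im = 0 := by
    have := congrArg QuadraticAlgebra.im heq
    rw [im_star] at this
    lia
  have hn := norm_eq x
  rw [him, hxp] at hn
  refine (Nat.prime_iff_prime_int.mp hp).irreducible.not_isSquare ⟨x.re, ?_⟩
  linear_combination hn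

theorem injOn_pow_mul_star_pow {p : ℕ} (hp : p.Prime) {x : EisensteinInt} (hx : Primary x)
    (hxp : norm x = p) (r : ℕ) :
    Set.InjOn (fun i ↦ x ^ i * star x ^ (r - i)) (range (r + 1)) := by
  have hprime := prime_of_norm_prime hp hxp
  have hstar : star x ≠ 0 := star_ne_zero.mpr hprime.ne_zero
  have key : ∀ i j, i < j → j ≤ r → x ^ i * star x ^ (r - i) ≠ x ^ j * star x ^ (r - j) := by
    intro i j hij hj h
    obtain ⟨k, rfl⟩ := Nat.exists_eq_add_of_lt hij
    obtain ⟨m, rfl⟩ := Nat.exists_eq_add_of_le hj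
    rw [Nat.add_sub_cancel_left, show i + k + 1 + m - i = m + (k + 1) by lia] at h
    have h₁ : star x ^ (k + 1) = x ^ (k + 1) := by
      refine mul_left_cancel₀ (mul_ne_zero (pow_ne_zero i hprime.ne_zero)
        (pow_ne_zero m hstar)) ?_
      linear_combination h
    exact not_dvd_star_of_norm_prime hp hx hxp
      (hprime.dvd_of_dvd_pow (h₁ ▸ dvd_pow_self x k.succ_ne_zero))
  intro i hi j hj h
  simp only [coe_range, Set.mem_Iio] at hi hj
  rcases lt_trichotomy i j with hij | hij | hij
  · exact absurd h (key i j hij (by lia))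
  · exact hij
  · exact absurd h.symm (key j i hij (by lia))

theorem cubicSum_split_pow {p : ℕ} (hp : p.Prime) {x : EisensteinInt} (hx : Primary x)
    (hxp : norm x = p) (r : ℕ) :
    cubicSum (p ^ r) = ∑ i ∈ range (r + 1), cubicTwo x ^ i * cubicTwo (star x) ^ (r - i) := by
  symm
  refine sum_nbij (fun i ↦ x ^ i * star x ^ (r - i)) ?_ (injOn_pow_mul_star_pow hp hx hxp r) ?_ ?_
  · intro i hi
    rw [mem_range] at hi
    rw [mem_primaryOfNorm]
    refine ⟨(hx.pow i).mul (hx.star.pow _), ?_⟩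
    rw [map_mul, map_pow, map_pow, QuadraticAlgebra.norm_star, hxp, ← pow_add]
    push_cast
    congr 1
    lia
  · intro z hz
    rw [mem_coe, mem_primaryOfNorm] at hz
    obtain ⟨i, hi, rfl⟩ := exists_eq_pow_mul_star_pow hp hx hxp r hz.1 (by simpa using hz.2)
    exact ⟨i, by simpa using Nat.lt_succ_of_le hi, rfl⟩
  · intro i _
    rw [cubicTwo_mul, cubicTwo_pow, cubicTwo_pow]

theorem cubicTwo_star (x : EisensteinInt) : cubicTwo (star x) = cubicTwo x ^ 2 := by
  by_cases h₁ : Even x.re <;> by_cases h₂ : Even x.im <;>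
    simp [cubicTwo, h₁, h₂, Int.even_add, sq]

theorem cubicTwo_sq_add_self {x : EisensteinInt} (hx : ¬ Even (norm x)) (h : cubicTwo x ≠ 1) :
    cubicTwo x ^ 2 + cubicTwo x + 1 = 0 := by
  rw [norm_eq] at hx
  by_cases h₁ : Even x.re <;> by_cases h₂ : Even x.im <;>
    simp [cubicTwo, h₁, h₂, Int.even_add, Int.even_sub, sq] at hx h ⊢ <;> rfl

theorem sum_pow_mul_sq_pow {R : Type*} [CommRing R] {u : R} (hu : u ^ 2 + u + 1 = 0) (r : ℕ) :
    ∑ i ∈ range (r + 1), u ^ i * (u ^ 2) ^ (r - i) =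
      if r % 3 = 0 then 1 else if r % 3 = 1 then -1 else 0 := by
  have hu₃ : u ^ 3 = 1 := by linear_combination (u - 1) * hu
  have hstep : ∀ r, ∑ i ∈ range (r + 2), u ^ i * (u ^ 2) ^ (r + 1 - i) =
      u ^ (r + 1) + u ^ 2 * ∑ i ∈ range (r + 1), u ^ i * (u ^ 2) ^ (r - i) := by
    intro r
    rw [sum_range_succ, Nat.sub_self, pow_zero, mul_one, add_comm, mul_sum]
    congr 1
    refine sum_congr rfl fun i hi ↦ ?_
    rw [mem_range] at hi
    rw [Nat.sub_add_comm (by lia)]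
    ring
  have hperiod : ∀ r, ∑ i ∈ range (r + 3 + 1), u ^ i * (u ^ 2) ^ (r + 3 - i) =
      ∑ i ∈ range (r + 1), u ^ i * (u ^ 2) ^ (r - i) := by
    intro r
    rw [hstep (r + 2), hstep (r + 1), hstep r]
    linear_combination u ^ (r + 3) * hu +
      (u ^ 3 + 1) * (∑ i ∈ range (r + 1), u ^ i * (u ^ 2) ^ (r - i)) * hu₃
  induction r using Nat.strong_induction_on with
  | _ r ih =>
    match r, ih with
    | 0, _ => simp
    | 1, _ => simp [sum_range_succ]; linear_combination hu
    | 2, _ => simp [sum_range_succ]; linear_combination u ^ 2 * hu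
    | r + 3, ih => rw [hperiod, ih r (by lia), Nat.add_mod_right]

theorem two_lt_of_mod_six {p : ℕ} [Fact p.Prime] (hp : p % 6 = 1) : 2 < p := by
  have := (Fact.out : p.Prime).two_le
  lia

theorem isPrimitiveRoot_omega : IsPrimitiveRoot (⟨0, 1⟩ : EisensteinInt) 3 := by
  rw [IsPrimitiveRoot.iff_def]
  have h₃ : (⟨0, 1⟩ : EisensteinInt) ^ 3 = 1 := by rfl
  refine ⟨h₃, fun l hl ↦ ?_⟩
  obtain ⟨q, s, hs, rfl⟩ : ∃ q s, s < 3 ∧ l = 3 * q + s :=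
    ⟨l / 3, l % 3, Nat.mod_lt _ (by norm_num), (Nat.div_add_mod l 3).symm⟩
  rw [pow_add, pow_mul, h₃, one_pow, one_mul] at hl
  interval_cases s
  · exact dvd_mul_right 3 q
  · simp [QuadraticAlgebra.ext_iff] at hl
  · simp [QuadraticAlgebra.ext_iff, sq] at hl

theorem exists_cubic_mulChar {p : ℕ} [Fact p.Prime] (hp : p % 6 = 1) :
    ∃ χ : MulChar (ZMod p) EisensteinInt, χ ^ 3 = 1 ∧ χ ≠ 1 ∧
      (χ 2 = 1 ↔ (2 : ZMod p) ^ ((p - 1) / 3) = 1) := by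
  obtain ⟨g, hg⟩ := IsCyclic.exists_generator (α := (ZMod p)ˣ)
  have hcard : Fintype.card (ZMod p)ˣ = p - 1 := ZMod.card_units p
  have hω := isPrimitiveRoot_omega
  set ζ : EisensteinIntˣ := (hω.isUnit (by norm_num)).unit with hζ
  have hζω : (ζ : EisensteinInt) = ⟨0, 1⟩ := rfl
  have hroot : ζ ∈ rootsOfUnity (Fintype.card (ZMod p)ˣ) EisensteinInt := by
    rw [mem_rootsOfUnity, Units.ext_iff]
    push_cast
    rw [hζω, hω.pow_eq_one_iff_dvd, hcard]
    lia
  set χ := MulChar.ofRootOfUnity hroot hg with hχ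
  have hχg : χ g = ⟨0, 1⟩ := by rw [hχ, MulChar.ofRootOfUnity_spec, hζω]
  have hpow : ∀ a : (ZMod p)ˣ, ∃ k : ℕ, a = g ^ k := fun a ↦ by
    obtain ⟨k, hk⟩ := (mem_powers_iff_mem_zpowers (x := g)).mpr (hg a)
    exact ⟨k, hk.symm⟩
  have hχpow : ∀ k : ℕ, χ ((g ^ k : (ZMod p)ˣ) : ZMod p) = ⟨0, 1⟩ ^ k := fun k ↦ by
    rw [Units.val_pow_eq_pow_val, map_pow, hχg]
  refine ⟨χ, ?_, ?_, ?_⟩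
  · ext1 a
    obtain ⟨k, rfl⟩ := hpow a
    rw [MulChar.pow_apply_coe, hχpow, MulChar.one_apply_coe, ← pow_mul, mul_comm, pow_mul,
      hω.pow_eq_one, one_pow]
  · rw [MulChar.ne_one_iff]
    exact ⟨g, by rw [hχg]; exact hω.ne_one (by norm_num)⟩
  · have h2 : (2 : ZMod p) ≠ 0 := natCast_zmod_ne_zero (n := 2) two_pos (two_lt_of_mod_six hp)
    obtain ⟨k, hk⟩ := hpow (Units.mk0 2 h2)
    have hk' : (2 : ZMod p) = ((g ^ k : (ZMod p)ˣ) : ZMod p) := by rw [← hk, Units.val_mk0]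
    have horder : orderOf g = p - 1 := by
      rw [orderOf_eq_card_of_forall_mem_zpowers hg, Nat.card_eq_fintype_card, hcard]
    rw [hk', hχpow, hω.pow_eq_one_iff_dvd, ← Units.val_pow_eq_pow_val, Units.val_eq_one, ← pow_mul,
      ← orderOf_dvd_iff_pow_eq_one, horder]
    obtain ⟨q, hq⟩ : 3 ∣ p - 1 := by lia
    have := (Fact.out : p.Prime).two_le
    rw [hq, Nat.mul_div_cancel_left q (by norm_num), Nat.mul_dvd_mul_iff_right (by lia)]

theorem star_eq_sq_of_pow_three {u : EisensteinInt} (hu : u ^ 3 = 1) : star u = u ^ 2 := by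
  have h₀ : u ≠ 0 := by
    rintro rfl
    simp at hu
  refine mul_left_cancel₀ h₀ ?_
  rw [mul_star_eq_norm, norm_eq_one_of_isUnit (IsUnit.of_pow_eq_one hu (by norm_num))]
  push_cast
  linear_combination -hu

theorem apply_pow_three {F : Type*} [Field F] {χ : MulChar F EisensteinInt} (hχ : χ ^ 3 = 1)
    {a : F} (ha : a ≠ 0) : χ a ^ 3 = 1 := by
  rw [← MulChar.pow_apply' χ (by norm_num), hχ, MulChar.one_apply ha.isUnit]

theorem star_mulChar_apply {F : Type*} [Field F] {χ : MulChar F EisensteinInt} (hχ : χ ^ 3 = 1)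
    (a : F) : star (χ a) = χ⁻¹ a := by
  have hinv : χ⁻¹ = χ ^ 2 := by
    rw [inv_eq_iff_mul_eq_one, ← pow_succ', hχ]
  rw [hinv, MulChar.pow_apply' χ (by norm_num)]
  rcases eq_or_ne a 0 with rfl | ha
  · rw [MulChar.map_zero, star_zero, zero_pow two_ne_zero]
  · exact star_eq_sq_of_pow_three (apply_pow_three hχ ha)

theorem norm_jacobiSum {p : ℕ} [Fact p.Prime] {χ : MulChar (ZMod p) EisensteinInt}
    (hχ : χ ^ 3 = 1) (hχ₁ : χ ≠ 1) : norm (jacobiSum χ χ) = p := by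
  have hstar : star (jacobiSum χ χ) = jacobiSum χ⁻¹ χ⁻¹ := by
    simp only [jacobiSum, star_sum, star_mul', star_mulChar_apply hχ]
  set f := algebraMap EisensteinInt (FractionRing EisensteinInt) with hf
  have hinj : Function.Injective f := IsFractionRing.injective _ _
  have hχ₁' : χ.ringHomComp f ≠ 1 := (MulChar.ringHomComp_ne_one_iff hinj).mpr hχ₁
  have hχ₂' : χ.ringHomComp f * χ.ringHomComp f ≠ 1 := by
    rw [← MulChar.ringHomComp_mul, MulChar.ringHomComp_ne_one_iff hinj]
    intro h
    exact hχ₁ (by rw [← hχ, pow_succ, sq, h, one_mul])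
  have hchar : ringChar (FractionRing EisensteinInt) ≠ ringChar (ZMod p) := by
    have : CharZero (FractionRing EisensteinInt) :=
      charZero_of_injective_algebraMap (R := EisensteinInt) hinj
    rw [ringChar.eq_zero, ZMod.ringChar_zmod_n]
    exact (Fact.out : p.Prime).ne_zero.symm
  have h := jacobiSum_mul_jacobiSum_inv hchar hχ₁' hχ₁' hχ₂'
  rw [MulChar.ringHomComp_inv, jacobiSum_ringHomComp, jacobiSum_ringHomComp, ← map_mul, ← hstar,
    mul_star_eq_norm, ZMod.card, ← map_natCast f] at h
  exact_mod_cast hinj h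

theorem primary_neg_jacobiSum {p : ℕ} [Fact p.Prime] (hp : p % 6 = 1)
    {χ : MulChar (ZMod p) EisensteinInt} (hχ : χ ^ 3 = 1) : Primary (-jacobiSum χ χ) := by
  obtain ⟨z, -, hz⟩ := exists_jacobiSum_eq_neg_one_add (by norm_num) hχ hχ
    (by rw [ZMod.card]; lia) isPrimitiveRoot_omega
  have hω : ((⟨0, 1⟩ : EisensteinInt) - 1) ^ 2 = 3 * ⟨0, -1⟩ := by rfl
  refine ⟨z * ⟨0, 1⟩, ?_⟩
  rw [hz, hω]
  have : (⟨0, -1⟩ : EisensteinInt) = -⟨0, 1⟩ := by rfl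
  rw [this]
  ring

theorem two_dvd_jacobiSum_sub {p : ℕ} [Fact p.Prime] (hp : p % 6 = 1)
    {χ : MulChar (ZMod p) EisensteinInt} (hχ : χ ^ 3 = 1) : 2 ∣ jacobiSum χ χ - χ 2 := by
  have h2 : (2 : ZMod p) ≠ 0 := natCast_zmod_ne_zero (n := 2) two_pos (two_lt_of_mod_six hp)
  have hhalf : χ 2⁻¹ * χ (1 - 2⁻¹) = χ 2 := by
    have h₁ : (1 - 2⁻¹ : ZMod p) = 2⁻¹ := by field_simp; norm_num
    have h₃ := apply_pow_three hχ h2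
    have h₄ : χ 2 * χ 2⁻¹ = 1 := by rw [← map_mul, mul_inv_cancel₀ h2, map_one]
    rw [h₁]
    linear_combination (-χ 2⁻¹ ^ 2) * h₃ + (χ 2 ^ 2 * χ 2⁻¹ + χ 2) * h₄
  rw [jacobiSum, ← add_sum_erase _ _ (mem_univ (2⁻¹ : ZMod p)), hhalf, add_sub_cancel_left,
    ← Ideal.mem_span_singleton, ← Ideal.Quotient.eq_zero_iff_mem, map_sum]
  refine sum_involution (fun x _ ↦ 1 - x) ?_ ?_ ?_ ?_
  · intro x _
    rw [sub_sub_cancel, ← map_add, Ideal.Quotient.eq_zero_iff_mem, Ideal.mem_span_singleton]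
    exact ⟨χ x * χ (1 - x), by ring⟩
  · intro x hx _ h
    refine (mem_erase.mp hx).1 ?_
    field_simp
    linear_combination -h
  · intro x hx
    refine mem_erase.mpr ⟨fun h ↦ (mem_erase.mp hx).1 ?_, mem_univ _⟩
    have : x = 1 - 2⁻¹ := by linear_combination -h
    rw [this]
    field_simp
    norm_num
  · intro x _
    ring

theorem cubicTwo_eq_one_iff {x : EisensteinInt} : cubicTwo x = 1 ↔ 2 ∣ x - 1 := by
  have h := intCast_dvd_iff (n := 2) (z := x - 1)
  push_cast at h
  rw [h, re_sub, im_sub, re_one, im_one, sub_zero, ← even_iff_two_dvd, ← even_iff_two_dvd]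
  by_cases h₁ : Even x.re <;> by_cases h₂ : Even x.im <;>
    simp [cubicTwo, h₁, h₂, QuadraticAlgebra.ext_iff, ← Int.not_even_iff_odd]

theorem two_dvd_sub_one_iff {u : EisensteinInt} (hu : u ^ 3 = 1) : 2 ∣ u - 1 ↔ u = 1 := by
  refine ⟨fun h ↦ ?_, fun h ↦ by simp [h]⟩
  have hmul : (u - 1) * (u ^ 2 + u + 1) = 0 := by linear_combination hu
  rcases mul_eq_zero.mp hmul with h' | h'
  · exact sub_eq_zero.mp h'
  · exfalso
    have h₃ : (2 : EisensteinInt) ∣ 3 := by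
      have : (3 : EisensteinInt) = -((u - 1) * (u + 2)) := by linear_combination h'
      rw [this]
      exact (h.mul_right _).neg_right
    have := intCast_dvd_iff (n := 2) (z := 3)
    push_cast at this
    have := (this.mp h₃).1
    norm_num at this

theorem exists_primary_norm_eq_prime {p : ℕ} (hp : p.Prime) (hp6 : p % 6 = 1) :
    ∃ x : EisensteinInt, Primary x ∧ norm x = p ∧
      (cubicTwo x = 1 ↔ (p : ℤ) ∣ 2 ^ ((p - 1) / 3) - 1) := by
  have : Fact p.Prime := ⟨hp⟩
  obtain ⟨χ, hχ, hχ₁, hχ₂⟩ := exists_cubic_mulChar hp6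
  refine ⟨-jacobiSum χ χ, primary_neg_jacobiSum hp6 hχ, ?_, ?_⟩
  · rw [QuadraticAlgebra.norm_neg, norm_jacobiSum hχ hχ₁]
  have h2 : (2 : ZMod p) ≠ 0 := natCast_zmod_ne_zero (n := 2) two_pos (two_lt_of_mod_six hp6)
  have hdiff : 2 ∣ (-jacobiSum χ χ - 1) - (χ 2 - 1) := by
    have : (-jacobiSum χ χ - 1) - (χ 2 - 1) = -(jacobiSum χ χ - χ 2) - 2 * χ 2 := by ring
    rw [this]
    exact dvd_sub (two_dvd_jacobiSum_sub hp6 hχ).neg_right (dvd_mul_right _ _)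
  rw [cubicTwo_eq_one_iff, dvd_iff_dvd_of_dvd_sub hdiff,
    two_dvd_sub_one_iff (apply_pow_three hχ h2), hχ₂, ← ZMod.intCast_zmod_eq_zero_iff_dvd]
  push_cast
  rw [sub_eq_zero]

theorem star_mem_primaryOfNorm {n : ℕ} {z : EisensteinInt} (hz : z ∈ primaryOfNorm n) :
    star z ∈ primaryOfNorm n := by
  rw [mem_primaryOfNorm] at *
  exact ⟨hz.1.star, by rw [QuadraticAlgebra.norm_star, hz.2]⟩

theorem sum_star_primaryOfNorm {M : Type*} [AddCommMonoid M] (n : ℕ) (f : EisensteinInt → M) :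
    ∑ z ∈ primaryOfNorm n, f (star z) = ∑ z ∈ primaryOfNorm n, f z :=
  sum_nbij' star star (fun _ ↦ star_mem_primaryOfNorm)
    (fun _ ↦ star_mem_primaryOfNorm) (fun z _ ↦ star_star z) (fun z _ ↦ star_star z)
    fun _ _ ↦ rfl

/-- The parity character of the imaginary part, supported on elements of odd real part. -/
def paritySign (z : EisensteinInt) : ℤ := if Even z.re then 0 else z.im.negOnePow

theorem cubicTwo_add_star (z : EisensteinInt) :
    cubicTwo z + cubicTwo (star z) = ((paritySign z + paritySign (star z) : ℤ) : EisensteinInt) := by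
  have hodd : ∀ {k : ℤ}, ¬ Even k → k.negOnePow = -1 := fun hk ↦
    Int.negOnePow_odd _ (Int.not_even_iff_odd.mp hk)
  by_cases h₁ : Even z.re <;> by_cases h₂ : Even z.im <;>
    simp [cubicTwo, paritySign, h₁, h₂, Int.even_add, Int.negOnePow_even, hodd] <;> rfl

theorem cubicSum_eq_sum_paritySign (n : ℕ) :
    cubicSum n = ((∑ z ∈ primaryOfNorm n, paritySign z : ℤ) : EisensteinInt) := by
  have h2 : (2 : EisensteinInt) ≠ 0 := two_ne_zero
  refine mul_left_cancel₀ h2 ?_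
  have h₁ : 2 * cubicSum n = ∑ z ∈ primaryOfNorm n, (cubicTwo z + cubicTwo (star z)) := by
    rw [sum_add_distrib, sum_star_primaryOfNorm n cubicTwo, cubicSum, two_mul]
  have h₂ : 2 * ∑ z ∈ primaryOfNorm n, paritySign z =
      ∑ z ∈ primaryOfNorm n, (paritySign z + paritySign (star z)) := by
    rw [sum_add_distrib, sum_star_primaryOfNorm n paritySign, two_mul]
  rw [h₁, sum_congr rfl fun z _ ↦ cubicTwo_add_star z, ← Int.cast_sum, ← h₂]
  push_cast
  rfl

/-- The coefficients of `∏ (1 - X ^ m) * (1 - X ^ (3 * m))` through pentagonal numbers. -/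
theorem coeff_prod_eq_sum_antidiagonal (c : ℕ → ℤ)
    (hc : ∀ n N : ℕ, n ≤ N →
      c n = ((∏ m ∈ Finset.Icc 1 N,
        (((1 : Polynomial ℤ) - Polynomial.X ^ m) *
          ((1 : Polynomial ℤ) - Polynomial.X ^ (3 * m)))).coeff n)) (n : ℕ) :
    c n = ∑ ij ∈ antidiagonal n, (PowerSeries.pentagonalSeries ℤ).coeff ij.1 *
      if 3 ∣ ij.2 then (PowerSeries.pentagonalSeries ℤ).coeff (ij.2 / 3) else 0 := by
  have hev : ∀ᶠ N in Filter.atTop, ∀ i ∈ range (n + 1),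
      (∏ m ∈ range N, (1 - PowerSeries.X ^ (m + 1) : PowerSeries ℤ)).coeff i =
        (PowerSeries.pentagonalSeries ℤ).coeff i :=
    (Filter.eventually_all_finset _).mpr fun i _ ↦ Filter.tendsto_finset_range.eventually
      (PowerSeries.coeff_prod_one_sub_X_pow_eventually_eq ℤ i)
  obtain ⟨N, hN, hnN⟩ := (hev.and (Filter.eventually_ge_atTop n)).exists
  set f : Polynomial ℤ := ∏ m ∈ range N, (1 - Polynomial.X ^ (m + 1)) with hf
  have hcoeff : ∀ i ≤ n, f.coeff i = (PowerSeries.pentagonalSeries ℤ).coeff i := by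
    intro i hi
    rw [← hN i (mem_range.mpr (by lia)), ← Polynomial.coeff_coe]
    congr 1
    rw [hf, ← Polynomial.coeToPowerSeries.ringHom_apply, map_prod]
    simp
  have hprod : ∏ m ∈ Finset.Icc 1 N, (((1 : Polynomial ℤ) - Polynomial.X ^ m) *
      ((1 : Polynomial ℤ) - Polynomial.X ^ (3 * m))) = f * Polynomial.expand ℤ 3 f := by
    rw [hf, map_prod, ← prod_mul_distrib, range_eq_Ico,
      prod_Ico_add' (fun m ↦ (1 - Polynomial.X ^ m : Polynomial ℤ) *
        Polynomial.expand ℤ 3 (1 - Polynomial.X ^ m)) 0 N 1, zero_add]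
    exact prod_congr (by ext; simp) fun m _ ↦ by simp [pow_mul]
  rw [hc n N hnN, hprod, Polynomial.coeff_mul]
  refine sum_congr rfl fun ij hij ↦ ?_
  rw [HasAntidiagonal.mem_antidiagonal] at hij
  rw [hcoeff _ (by lia), Polynomial.coeff_expand three_pos]
  split_ifs
  · rw [hcoeff _ (by lia)]
  · rfl

theorem sum_antidiagonal_pentagonal (n : ℕ) :
    ∑ ij ∈ antidiagonal n, (PowerSeries.pentagonalSeries ℤ).coeff ij.1 *
      (if 3 ∣ ij.2 then (PowerSeries.pentagonalSeries ℤ).coeff (ij.2 / 3) else 0) =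
    ∑ z ∈ primaryOfNorm (6 * n + 1), paritySign z := by
  have hdesc : ∀ z ∈ {z ∈ primaryOfNorm (6 * n + 1) | ¬ Even z.re},
      ∃ k l : ℤ, z = ⟨1 - 6 * l, 3 * (k - l)⟩ := by
    intro z hmem
    rw [mem_filter, mem_primaryOfNorm] at hmem
    obtain ⟨⟨hz, -⟩, hre⟩ := hmem
    obtain ⟨h₁, t, ht⟩ := primary_iff.mp hz
    obtain ⟨l, hl⟩ : 6 ∣ z.re - 1 := by
      rw [Int.even_iff] at hre
      lia
    refine ⟨t - l, -l, ?_⟩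
    ext
    · simp only; lia
    · simp only; lia
  have hnorm : ∀ k l : ℤ, norm (⟨1 - 6 * l, 3 * (k - l)⟩ : EisensteinInt) =
      6 * (pentagonal k + 3 * pentagonal l) + 1 := by
    intro k l
    rw [norm_eq]
    linear_combination -3 * two_mul_natCast_pentagonal k - 9 * two_mul_natCast_pentagonal l
  have hsum : ∑ z ∈ primaryOfNorm (6 * n + 1), paritySign z =
      ∑ z ∈ primaryOfNorm (6 * n + 1) with ¬ Even z.re, (z.im.negOnePow : ℤ) := by
    rw [sum_filter]
    exact sum_congr rfl fun z _ ↦ by rw [paritySign, ite_not]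
  rw [hsum]
  symm
  set e : EisensteinInt → ℕ × ℕ := fun z ↦
    (pentagonal ((1 - z.re) / 6 + z.im / 3), 3 * pentagonal ((1 - z.re) / 6)) with he
  have hmap : ∀ k l : ℤ, e ⟨1 - 6 * l, 3 * (k - l)⟩ = (pentagonal k, 3 * pentagonal l) := by
    intro k l
    have h₁ : (1 - (1 - 6 * l)) / 6 = l := by lia
    have h₂ : 3 * (k - l) / 3 = k - l := by lia
    simp only [he, h₁, h₂, add_sub_cancel]
  have hmem : ∀ k l : ℤ, (⟨1 - 6 * l, 3 * (k - l)⟩ : EisensteinInt) ∈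
      {z ∈ primaryOfNorm (6 * n + 1) | ¬ Even z.re} ↔ pentagonal k + 3 * pentagonal l = n := by
    intro k l
    rw [mem_filter, mem_primaryOfNorm, hnorm, Int.even_iff, primary_iff]
    constructor
    · rintro ⟨⟨-, hN⟩, -⟩
      push_cast at hN
      lia
    · rintro rfl
      refine ⟨⟨⟨?_, ?_⟩, ?_⟩, ?_⟩
      · simp only; lia
      · exact ⟨_, rfl⟩
      · push_cast; rfl
      · simp only; lia
  refine sum_of_injOn e ?_ ?_ ?_ ?_
  · intro z hz w hw hzw
    obtain ⟨k, l, rfl⟩ := hdesc z hz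
    obtain ⟨k', l', rfl⟩ := hdesc w hw
    rw [hmap, hmap, Prod.mk.injEq, Nat.mul_right_inj three_ne_zero, pentagonal_inj,
      pentagonal_inj] at hzw
    rw [hzw.1, hzw.2]
  · intro z hz
    obtain ⟨k, l, rfl⟩ := hdesc z hz
    rw [hmap]
    exact HasAntidiagonal.mem_antidiagonal.mpr ((hmem k l).mp hz)
  · rintro ⟨i, j⟩ hij hnot
    rw [HasAntidiagonal.mem_antidiagonal] at hij
    by_cases hi : i ∈ Set.range pentagonal
    · obtain ⟨k, rfl⟩ := hi
      split_ifs with hj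
      · obtain ⟨j, rfl⟩ := hj
        by_cases hj : j ∈ Set.range pentagonal
        · obtain ⟨l, rfl⟩ := hj
          exact absurd ⟨_, (hmem k l).mpr hij, hmap k l⟩ hnot
        · simp only [Nat.mul_div_cancel_left j three_pos,
            PowerSeries.coeff_pentagonalSeries_eq_zero ℤ hj, mul_zero]
      · rw [mul_zero]
    · simp only [PowerSeries.coeff_pentagonalSeries_eq_zero ℤ hi, zero_mul]
  · intro z hz
    obtain ⟨k, l, rfl⟩ := hdesc z hz
    have hodd : (3 * (k - l)).negOnePow = k.negOnePow * l.negOnePow := by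
      rw [← Int.negOnePow_add, Int.negOnePow_eq_iff]
      exact ⟨k - 2 * l, by ring⟩
    rw [hmap]
    simp only [dvd_mul_right, if_true, Nat.mul_div_cancel_left _ three_pos,
      PowerSeries.coeff_pentagonalSeries_pentagonal, hodd, Int.cast_id, Units.val_mul]

theorem intCast_eq_cubicSum (h : ℕ → ℤ)
    (hh1 : h 1 = 1)
    (hhmul : ∀ m n : ℕ, Nat.Coprime m n → h (m * n) = h m * h n)
    (hha : ∀ p r : ℕ, p.Prime → 1 ≤ r → p % 6 = 5 → Even r →
      h (p ^ r) = 1)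
    (hhb : ∀ p r : ℕ, p.Prime → 1 ≤ r → p % 6 = 1 →
      (p : ℤ) ∣ ((2 : ℤ) ^ ((p - 1) / 3) - 1) →
      h (p ^ r) = r + 1)
    (hhc : ∀ p r : ℕ, p.Prime → 1 ≤ r → p % 6 = 1 →
      ¬((p : ℤ) ∣ ((2 : ℤ) ^ ((p - 1) / 3) - 1)) → r % 3 = 0 →
      h (p ^ r) = 1)
    (hhd : ∀ p r : ℕ, p.Prime → 1 ≤ r → p % 6 = 1 →
      ¬((p : ℤ) ∣ ((2 : ℤ) ^ ((p - 1) / 3) - 1)) → r % 3 = 1 →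
      h (p ^ r) = -1)
    (hh0 : ∀ p r : ℕ, p.Prime → 1 ≤ r →
      ¬((p % 6 = 5 ∧ Even r) ∨
        (p % 6 = 1 ∧ (p : ℤ) ∣ ((2 : ℤ) ^ ((p - 1) / 3) - 1)) ∨
        (p % 6 = 1 ∧ ¬((p : ℤ) ∣ ((2 : ℤ) ^ ((p - 1) / 3) - 1)) ∧
          (r % 3 = 0 ∨ r % 3 = 1))) →
      h (p ^ r) = 0) {n : ℕ} (hn : n.Coprime 6) : (h n : EisensteinInt) = cubicSum n := by
  induction n using Nat.recOnPosPrimePosCoprime with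
  | zero => norm_num at hn
  | one => simp [hh1, cubicSum_one]
  | coprime a b ha hb hab iha ihb =>
    have ha6 := hn.coprime_mul_right
    have hb6 := hn.coprime_mul_left
    have h3 : ∀ {k : ℕ}, k.Coprime 6 → ¬ 3 ∣ k := fun hk h3 ↦ by
      have := Nat.dvd_gcd h3 (by norm_num : 3 ∣ 6)
      rw [hk] at this
      norm_num at this
    rw [hhmul a b hab, Int.cast_mul, iha ha6, ihb hb6, cubicSum_mul hab (h3 ha6) (h3 hb6)]
  | prime_pow p r hp hr =>
    have hp6 : p.Coprime 6 := (Nat.coprime_pow_left_iff hr p 6).mp hn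
    have hmod : p % 6 = 1 ∨ p % 6 = 5 := by
      have h2 : ¬ 2 ∣ p := fun h2 ↦ by
        have := Nat.dvd_gcd h2 (by norm_num : 2 ∣ 6)
        rw [hp6] at this
        norm_num at this
      have h3 : ¬ 3 ∣ p := fun h3 ↦ by
        have := Nat.dvd_gcd h3 (by norm_num : 3 ∣ 6)
        rw [hp6] at this
        norm_num at this
      lia
    rcases hmod with hmod | hmod
    · obtain ⟨x, hx, hxp, hx2⟩ := exists_primary_norm_eq_prime hp hmod
      rw [cubicSum_split_pow hp hx hxp, cubicTwo_star]
      by_cases h2 : cubicTwo x = 1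
      · rw [hhb p r hp hr hmod (hx2.mp h2), h2]
        simp
      · have hodd : ¬ Even (norm x) := by
          rw [hxp, Int.even_coe_nat, Nat.even_iff]
          lia
        have hnd : ¬ (p : ℤ) ∣ 2 ^ ((p - 1) / 3) - 1 := fun hd ↦ h2 (hx2.mpr hd)
        rw [sum_pow_mul_sq_pow (cubicTwo_sq_add_self hodd h2)]
        split_ifs with h₀ h₁
        · simp [hhc p r hp hr hmod hnd h₀]
        · simp [hhd p r hp hr hmod hnd h₁]
        · rw [hh0 p r hp hr (by simp [hmod, hnd, h₀, h₁]), Int.cast_zero]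
    · rw [cubicSum_inert_pow hp hmod]
      split_ifs with hr2
      · simp [hha p r hp hr hmod hr2]
      · rw [hh0 p r hp hr (by simp [hmod, hr2]), Int.cast_zero]

end EisensteinInt

/-- With `c n` the coefficient of `q^n` in `∏ (1 - q^m)(1 - q^{3m})`, and `h`
the multiplicative function with the stated values on prime powers, we have
`c n = h (6 n + 1)` for all `n`. -/
theorem stmt_8 (c : ℕ → ℤ)
    (hc : ∀ n N : ℕ, n ≤ N →
      c n = ((∏ m ∈ Finset.Icc 1 N,
        (((1 : Polynomial ℤ) - Polynomial.X ^ m) *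
          ((1 : Polynomial ℤ) - Polynomial.X ^ (3 * m)))).coeff n))
    (h : ℕ → ℤ)
    (hh1 : h 1 = 1)
    (hhmul : ∀ m n : ℕ, Nat.Coprime m n → h (m * n) = h m * h n)
    (hha : ∀ p r : ℕ, p.Prime → 1 ≤ r → p % 6 = 5 → Even r →
      h (p ^ r) = 1)
    (hhb : ∀ p r : ℕ, p.Prime → 1 ≤ r → p % 6 = 1 →
      (p : ℤ) ∣ ((2 : ℤ) ^ ((p - 1) / 3) - 1) →
      h (p ^ r) = r + 1)
    (hhc : ∀ p r : ℕ, p.Prime → 1 ≤ r → p % 6 = 1 →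
      ¬((p : ℤ) ∣ ((2 : ℤ) ^ ((p - 1) / 3) - 1)) → r % 3 = 0 →
      h (p ^ r) = 1)
    (hhd : ∀ p r : ℕ, p.Prime → 1 ≤ r → p % 6 = 1 →
      ¬((p : ℤ) ∣ ((2 : ℤ) ^ ((p - 1) / 3) - 1)) → r % 3 = 1 →
      h (p ^ r) = -1)
    (hh0 : ∀ p r : ℕ, p.Prime → 1 ≤ r →
      ¬((p % 6 = 5 ∧ Even r) ∨
        (p % 6 = 1 ∧ (p : ℤ) ∣ ((2 : ℤ) ^ ((p - 1) / 3) - 1)) ∨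
        (p % 6 = 1 ∧ ¬((p : ℤ) ∣ ((2 : ℤ) ^ ((p - 1) / 3) - 1)) ∧
          (r % 3 = 0 ∨ r % 3 = 1))) →
      h (p ^ r) = 0) :
    ∀ n : ℕ, c n = h (6 * n + 1) := by
  intro n
  have hcop : (6 * n + 1).Coprime 6 := by simp
  have hsum := EisensteinInt.intCast_eq_cubicSum h hh1 hhmul hha hhb hhc hhd hh0 hcop
  rw [EisensteinInt.cubicSum_eq_sum_paritySign] at hsum
  rw [EisensteinInt.coeff_prod_eq_sum_antidiagonal c hc n,
    EisensteinInt.sum_antidiagonal_pentagonal n, Int.cast_injective hsum]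
end

section
/- For every n ≥ 0, the coefficient a_n of q^n in the expansion of ∏_{m=1}^∞ (1 - q^m)^3 satisfies: a_n = (-1)^k (2k + 1) if there exists an integer k ≥ 0 with 8n + 1 = (2k + 1)^2 (such a k is unique), and a_n = 0 if no such k exists. -/
open Finset Polynomial

section FiniteIdentity

variable {R : Type*} [CommRing R] (q : R)

/-- The finite Euler product `∏_{m=1}^N (1 - q^m)`. -/
def eulerProd (N : ℕ) : R := ∏ m ∈ Icc 1 N, (1 - q ^ m)

/-- The signed triangular power `(-1)^k q^(k(k+1)/2)`. -/
def signedTriangular (k : ℕ) : R := ∏ i ∈ range k, (-q ^ (i + 1))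

/-- The coefficients of the finite Jacobi triple product
`(1 - z) ∏_{i=1}^N (1 - z q^i) (1 - z⁻¹ q^i)` at the powers `z^{-k}`, `k ≥ 0`. -/
def tripleCoeff : ℕ → ℕ → R
  | 0, 0 => 1
  | 0, _ + 1 => 0
  | N + 1, 0 => (1 + q ^ (2 * N + 2)) * tripleCoeff N 0
      - q ^ (N + 1) * (tripleCoeff N 1 - tripleCoeff N 0)
  | N + 1, k + 1 => (1 + q ^ (2 * N + 2)) * tripleCoeff N (k + 1)
      - q ^ (N + 1) * (tripleCoeff N k + tripleCoeff N (k + 2))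

@[simp] lemma eulerProd_zero : eulerProd q 0 = 1 := by simp [eulerProd]

lemma eulerProd_succ (N : ℕ) : eulerProd q (N + 1) = eulerProd q N * (1 - q ^ (N + 1)) := by
  simp [eulerProd, prod_Icc_succ_top]

@[simp] lemma signedTriangular_zero : signedTriangular q 0 = 1 := by simp [signedTriangular]

lemma signedTriangular_succ (k : ℕ) :
    signedTriangular q (k + 1) = signedTriangular q k * (-q ^ (k + 1)) := by
  simp [signedTriangular, prod_range_succ]

lemma two_mul_add_one_sq_eq_eight_mul_sum (k : ℕ) :
    8 * (∑ i ∈ range k, (i + 1)) + 1 = (2 * k + 1) ^ 2 := by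
  induction k with
  | zero => simp
  | succ k ih => rw [sum_range_succ, mul_add]; linarith

lemma signedTriangular_eq (k : ℕ) :
    signedTriangular q k = (-1) ^ k * q ^ (∑ i ∈ range k, (i + 1)) := by
  induction k with
  | zero => simp
  | succ k ih => rw [signedTriangular_succ, ih, sum_range_succ]; ring

lemma pow_dvd_signedTriangular {m k : ℕ} (h : m ≤ k) : q ^ m ∣ signedTriangular q k := by
  cases k with
  | zero => simp [Nat.le_zero.mp h]
  | succ k =>
    rw [signedTriangular_succ]
    exact ((pow_dvd_pow q h).neg_right).mul_left _

lemma tripleCoeff_eq_zero {N k : ℕ} (h : N < k) : tripleCoeff q N k = 0 := by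
  induction N generalizing k with
  | zero => cases k with
    | zero => omega
    | succ k => rfl
  | succ N ih => cases k with
    | zero => omega
    | succ k =>
      rw [tripleCoeff, ih (by omega), ih (by omega), ih (by omega)]
      ring

lemma tripleCoeff_mul (N k m : ℕ) (h : N = k + m) :
    tripleCoeff q N k * eulerProd q m * eulerProd q (N + k + 1) =
      signedTriangular q k * eulerProd q (2 * N + 1) := by
  induction N generalizing k m with
  | zero =>
    obtain ⟨rfl, rfl⟩ : k = 0 ∧ m = 0 := by omega
    simp [tripleCoeff]
  | succ N ih =>
    have hP : eulerProd q (2 * (N + 1) + 1) =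
        eulerProd q (2 * N + 1) * (1 - q ^ (2 * N + 2)) * (1 - q ^ (2 * N + 3)) := by
      rw [← eulerProd_succ, ← eulerProd_succ]; rfl
    rcases k with _ | k
    · obtain rfl : m = N + 1 := by omega
      have h0 := ih 0 N (by omega)
      have h1 : tripleCoeff q N 1 * eulerProd q N * eulerProd q (N + 2) =
          -q * eulerProd q (2 * N + 1) * (1 - q ^ N) := by
        rcases N with _ | N
        · simp [tripleCoeff]
        · have := ih 1 N (by omega)
          simp only [signedTriangular_succ, signedTriangular_zero] at this
          rw [eulerProd_succ q N]
          linear_combination (1 - q ^ (N + 1)) * this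
      rw [hP, tripleCoeff]
      simp only [signedTriangular_zero, eulerProd_succ q N, eulerProd_succ q (N + 1),
        add_zero] at h0 h1 ⊢
      linear_combination (1 + q ^ (2 * N + 2) + q ^ (N + 1)) * (1 - q ^ (N + 1)) *
        (1 - q ^ (N + 2)) * h0 - q ^ (N + 1) * (1 - q ^ (N + 1)) * h1
    · obtain rfl : N = k + m := by omega
      have h0 := ih k m rfl
      rw [hP, tripleCoeff, signedTriangular_succ,
        show k + m + 1 + (k + 1) + 1 = k + m + k + 1 + 1 + 1 by ring,
        eulerProd_succ q (k + m + k + 1 + 1), eulerProd_succ q (k + m + k + 1)]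
      rcases m with _ | m
      · rw [tripleCoeff_eq_zero q (show k + 0 < k + 1 by omega),
          tripleCoeff_eq_zero q (show k + 0 < k + 2 by omega)]
        simp only [add_zero] at h0 ⊢
        linear_combination -q ^ (k + 1) * (1 - q ^ (k + k + 2)) * (1 - q ^ (k + k + 3)) * h0
      · have h1 := ih (k + 1) m (by omega)
        have h2 : tripleCoeff q (k + (m + 1)) (k + 2) * eulerProd q m *
            eulerProd q (k + (m + 1) + k + 1 + 1 + 1) =
            signedTriangular q (k + 2) * eulerProd q (2 * (k + (m + 1)) + 1) * (1 - q ^ m) := by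
          rcases m with _ | m
          · rw [tripleCoeff_eq_zero q (show k + (0 + 1) < k + 2 by omega)]
            simp
          · have := ih (k + 2) m (by omega)
            rw [show k + (m + 1 + 1) + (k + 2) + 1 = k + (m + 1 + 1) + k + 1 + 1 + 1 by ring]
              at this
            rw [eulerProd_succ q m]
            linear_combination (1 - q ^ (m + 1)) * this
        rw [show k + (m + 1) + (k + 1) + 1 = k + (m + 1) + k + 1 + 1 by ring] at h1
        simp only [signedTriangular_succ, eulerProd_succ q m,
          eulerProd_succ q (k + (m + 1) + k + 1 + 1),
          eulerProd_succ q (k + (m + 1) + k + 1)] at h0 h1 h2 ⊢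
        linear_combination (1 + q ^ (2 * (k + (m + 1)) + 2)) * (1 - q ^ (m + 1)) *
            (1 - q ^ (k + (m + 1) + k + 3)) * h1
          - q ^ (k + (m + 1) + 1) * (1 - q ^ (k + (m + 1) + k + 2)) *
            (1 - q ^ (k + (m + 1) + k + 3)) * h0
          - q ^ (k + (m + 1) + 1) * (1 - q ^ (m + 1)) * h2

lemma sum_range_tripleCoeff_succ (N M : ℕ) :
    ∑ k ∈ range (M + 1), (2 * k + 1 : R) * tripleCoeff q (N + 1) k =
      (1 - q ^ (N + 1)) ^ 2 * ∑ k ∈ range (M + 1), (2 * k + 1 : R) * tripleCoeff q N k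
      - q ^ (N + 1) * ((2 * M + 1) * tripleCoeff q N (M + 1)
        - (2 * M + 3) * tripleCoeff q N M) := by
  induction M with
  | zero => simp [tripleCoeff]; ring
  | succ M ih =>
    rw [sum_range_succ, ih, sum_range_succ _ (M + 1), tripleCoeff]
    push_cast
    ring

/-- A finite form of Jacobi's identity. -/
lemma sum_range_tripleCoeff (N : ℕ) :
    ∑ k ∈ range (N + 1), (2 * k + 1 : R) * tripleCoeff q N k = eulerProd q N ^ 2 := by
  induction N with
  | zero => simp [tripleCoeff]
  | succ N ih =>
    rw [sum_range_tripleCoeff_succ, sum_range_succ, ih,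
      tripleCoeff_eq_zero q (show N < N + 1 by omega),
      tripleCoeff_eq_zero q (show N < N + 1 + 1 by omega), eulerProd_succ]
    ring

lemma isCoprime_eulerProd_pow (N j : ℕ) : IsCoprime (q ^ j) (eulerProd q N) := by
  refine IsCoprime.pow_left (IsCoprime.prod_right fun m hm => ?_)
  obtain ⟨m, rfl⟩ := Nat.exists_eq_add_of_le' (mem_Icc.mp hm).1
  exact ⟨q ^ m, 1, by ring⟩

lemma pow_dvd_eulerProd_sub (n j : ℕ) :
    q ^ (n + 1) ∣ eulerProd q (n + j) - eulerProd q n := by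
  induction j with
  | zero => simp
  | succ j ih =>
    rw [← add_assoc, eulerProd_succ, mul_one_sub, sub_right_comm]
    exact dvd_sub ih ((pow_dvd_pow q (by omega)).mul_left _)

lemma pow_dvd_tripleCoeff_mul_sub {n N k : ℕ} (hN : 2 * n ≤ N) (hk : k ≤ N) :
    q ^ (n + 1) ∣ tripleCoeff q N k * eulerProd q N - signedTriangular q k := by
  obtain ⟨m, rfl⟩ := Nat.exists_eq_add_of_le hk
  have h := tripleCoeff_mul q (k + m) k m rfl
  rcases lt_or_ge n k with hnk | hnk
  · have hs := pow_dvd_signedTriangular q (Nat.succ_le_of_lt hnk)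
    refine dvd_sub (Dvd.dvd.mul_right ?_ _) hs
    refine (isCoprime_eulerProd_pow q m _).dvd_of_dvd_mul_right
      ((isCoprime_eulerProd_pow q (k + m + k + 1) _).dvd_of_dvd_mul_right ?_)
    rw [h]
    exact hs.mul_right _
  · have key (j : ℕ) (hj : n ≤ j) : ∃ c, eulerProd q j = eulerProd q n + q ^ (n + 1) * c := by
      obtain ⟨i, rfl⟩ := Nat.exists_eq_add_of_le hj
      obtain ⟨c, hc⟩ := pow_dvd_eulerProd_sub q n i
      exact ⟨c, by rw [← hc]; ring⟩
    obtain ⟨a, ha⟩ := key m (by omega)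
    obtain ⟨b, hb⟩ := key (k + m + k + 1) (by omega)
    obtain ⟨c, hc⟩ := key (2 * (k + m) + 1) (by omega)
    obtain ⟨d, hd⟩ := key (k + m) (by omega)
    rw [ha, hb, hc] at h
    rw [hd]
    refine (isCoprime_eulerProd_pow q n _).dvd_of_dvd_mul_right
      ⟨signedTriangular q k * c + tripleCoeff q (k + m) k * (d * eulerProd q n
        - a * eulerProd q n - b * eulerProd q n - q ^ (n + 1) * a * b), ?_⟩
    linear_combination h

/-- Jacobi's identity for the cube of the Euler product, modulo `q^(n+1)`. -/
lemma pow_dvd_eulerProd_cube_sub {n N : ℕ} (hN : 2 * n ≤ N) :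
    q ^ (n + 1) ∣ eulerProd q N ^ 3 -
      ∑ k ∈ range (N + 1), (2 * k + 1 : R) * signedTriangular q k := by
  rw [pow_succ (eulerProd q N), ← sum_range_tripleCoeff, sum_mul, ← sum_sub_distrib]
  refine dvd_sum fun k hk => ?_
  rw [mul_assoc, ← mul_sub]
  exact (pow_dvd_tripleCoeff_mul_sub q hN (by simpa [Nat.lt_succ_iff] using hk)).mul_left _

end FiniteIdentity

lemma coeff_eulerProd_cube {n N : ℕ} (hN : 2 * n ≤ N) :
    (eulerProd (X : ℤ[X]) N ^ 3).coeff n =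
      ∑ k ∈ range (N + 1), if 8 * n + 1 = (2 * k + 1) ^ 2 then (-1) ^ k * (2 * k + 1 : ℤ) else 0 := by
  have h := X_pow_dvd_iff.mp (pow_dvd_eulerProd_cube_sub (X : ℤ[X]) hN) n n.lt_succ_self
  rw [coeff_sub, sub_eq_zero] at h
  rw [h, finsetSum_coeff]
  refine sum_congr rfl fun k _ => ?_
  have hC : (2 * k + 1 : ℤ[X]) * signedTriangular X k =
      C ((-1) ^ k * (2 * k + 1 : ℤ)) * X ^ (∑ i ∈ range k, (i + 1)) := by
    rw [signedTriangular_eq]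
    simp
    ring
  rw [hC, coeff_C_mul_X_pow]
  have hT := two_mul_add_one_sq_eq_eight_mul_sum k
  exact if_congr (by omega) rfl rfl

/-- Jacobi: the coefficient `a n` of `q^n` in `∏ (1 - q^m)^3` equals
`(-1)^k (2k+1)` if `8n + 1 = (2k+1)^2` for some `k ≥ 0`, and `0` otherwise. -/
theorem stmt_9 (a : ℕ → ℤ)
    (ha : ∀ n N : ℕ, n ≤ N →
      a n = (((∏ m ∈ Finset.Icc 1 N, ((1 : Polynomial ℤ) - Polynomial.X ^ m)) ^ 3).coeff n)) :
    ∀ n : ℕ,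
      (∀ k : ℕ, 8 * n + 1 = (2 * k + 1) ^ 2 →
        a n = (-1) ^ k * (2 * k + 1)) ∧
      ((¬ ∃ k : ℕ, 8 * n + 1 = (2 * k + 1) ^ 2) → a n = 0) := by
  intro n
  have h := (ha n (2 * n) (by omega)).trans (coeff_eulerProd_cube le_rfl)
  refine ⟨fun k hk => ?_, fun hn => ?_⟩
  · rw [h, sum_eq_single_of_mem k (mem_range.mpr (by nlinarith)), if_pos hk]
    intro j _ hj
    refine if_neg fun hj' => hj ?_
    have := Nat.pow_left_injective two_ne_zero (hj'.symm.trans hk)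
    omega
  · rw [h]
    exact sum_eq_zero fun k _ => if_neg fun hk => hn ⟨k, hk⟩
end
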